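/- arXiv:1911.04375 — 2 statements merged into one kernel-verified Lean document; each statement's English description precedes it below -/
import Mathlib

section
/- There exists a set R_C ⊆ [0,1] of irrational numbers which contains a residual subset of [0,1], whose complement in [0,1] has Lebesgue measure zero, and which contains 𝔼_∞, such that for every ρ∈R_C there exist C^∞ multicritical circle maps f,g:S¹→S¹ with: (1) ρ(f)=ρ(g)=ρ; (2) f has exactly one critical point c₀, whereas g has exactly two critical points c₁ and c₂; (3) every circle homeomorphism h with h∘f=g∘h and h(c₀)=c₁ fails to be quasisymmetric. -/
noncomputable section

open Set Filter MeasureTheory Topology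

/-- The circle `ℝ/ℤ`. -/
abbrev S1 := AddCircle (1 : ℝ)

/-- `F` is an (orientation-preserving) lift of the circle map `f`. -/
def IsLift (f : S1 → S1) (F : ℝ → ℝ) : Prop :=
  StrictMono F ∧ Function.Surjective F ∧ (∀ x : ℝ, F (x + 1) = F x + 1) ∧
    ∀ x : ℝ, f (x : S1) = (F x : S1)

/-- `f` is an orientation-preserving circle homeomorphism. -/
def IsCircleHomeo (f : S1 → S1) : Prop := ∃ F : ℝ → ℝ, IsLift f F

/-- `f` has rotation number `ρ ∈ [0,1)`: some lift of `f` has translation number `ρ`. -/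
def HasRotNum (f : S1 → S1) (ρ : ℝ) : Prop :=
  ∃ F : ℝ → ℝ, IsLift f F ∧ Tendsto (fun n : ℕ => F^[n] 0 / (n : ℝ)) atTop (𝓝 ρ)

/-- The lift `F` has a non-flat (power-law) critical point at `c`:
on a neighbourhood `W` of `c`, `F y = F c + φ(y)|φ(y)|^(d-1)` for a `C³` diffeomorphism `φ`
with `φ c = 0`. -/
def NonFlatAt (F : ℝ → ℝ) (c : ℝ) : Prop :=
  ∃ d : ℝ, 1 < d ∧ ∃ W : Set ℝ, IsOpen W ∧ c ∈ W ∧ ∃ φ : ℝ → ℝ,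
    ContDiffOn ℝ 3 φ W ∧ InjOn φ W ∧ (∀ y ∈ W, deriv φ y ≠ 0) ∧ φ c = 0 ∧
    ∀ y ∈ W, F y = F c + φ y * |φ y| ^ (d - 1)

/-- `f` is a `C^k` unicritical circle map: an orientation-preserving `C^k` circle
homeomorphism whose only critical point is `c`, and it is non-flat. -/
def Unicritical (f : S1 → S1) (c : S1) (k : ℕ∞) : Prop :=
  ∃ (F : ℝ → ℝ) (x₀ : ℝ), IsLift f F ∧ ContDiff ℝ k F ∧ (x₀ : S1) = c ∧
    {x : ℝ | deriv F x = 0} = {x : ℝ | ∃ m : ℤ, x = x₀ + m} ∧ NonFlatAt F x₀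

/-- `f` is a `C^k` bi-critical circle map: an orientation-preserving `C^k` circle
homeomorphism with exactly two critical points `c₁ ≠ c₂`, both non-flat. -/
def Bicritical (f : S1 → S1) (c₁ c₂ : S1) (k : ℕ∞) : Prop :=
  c₁ ≠ c₂ ∧ ∃ (F : ℝ → ℝ) (x₁ x₂ : ℝ), IsLift f F ∧ ContDiff ℝ k F ∧
    (x₁ : S1) = c₁ ∧ (x₂ : S1) = c₂ ∧
    {x : ℝ | deriv F x = 0} =
      {x : ℝ | ∃ m : ℤ, x = x₁ + m} ∪ {x : ℝ | ∃ m : ℤ, x = x₂ + m} ∧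
    NonFlatAt F x₁ ∧ NonFlatAt F x₂

/-- `h` is a quasisymmetric (orientation-preserving) circle homeomorphism. -/
def QuasiSymm (h : S1 → S1) : Prop :=
  ∃ H : ℝ → ℝ, IsLift h H ∧ ∃ M : ℝ, 1 < M ∧ ∀ x t : ℝ, 0 < t →
    1 / M ≤ (H (x + t) - H x) / (H x - H (x - t)) ∧
      (H (x + t) - H x) / (H x - H (x - t)) ≤ M

/-- The length (in `[0,1)`) of the positively oriented arc from `x` to `y`. -/
def arcLen (x y : S1) : ℝ := (AddCircle.equivIco 1 0 (y - x) : ℝ)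

/-- The positively oriented open arc from `x` to `y` on the circle. -/
def posArc (x y : S1) : Set S1 := (fun t : ℝ => x + (t : S1)) '' Ioo 0 (arcLen x y)

/-- The Gauss map `G(ρ) = {1/ρ}`, `G(0) = 0`. -/
def gaussMap (ρ : ℝ) : ℝ := if ρ = 0 then 0 else Int.fract (1 / ρ)

/-- The fiber maps `T_ρ : [-1,1] → [-1,1]` of the skew product. -/
def fiberMap (ρ α : ℝ) : ℝ :=
  if ρ = 0 then 0
  else if α ≤ 0 then -α
  else if α ≤ ρ * gaussMap ρ then -α / (ρ * gaussMap ρ)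
  else Int.fract ((1 - α) / ρ)

/-- The skew product `T(ρ,α) = (G(ρ), T_ρ(α))`. -/
def skewProd (p : ℝ × ℝ) : ℝ × ℝ := (gaussMap p.1, fiberMap p.1 p.2)

/-- The rectangle `R = [0,1] × [-1,1]`. -/
def Rect : Set (ℝ × ℝ) := Icc (0 : ℝ) 1 ×ˢ Icc (-1 : ℝ) 1

/-- `M = ([0,1] ∖ ℚ) × [-1,1]`. -/
def Mset : Set (ℝ × ℝ) := {p | p ∈ Rect ∧ Irrational p.1}

/-- The `n`-th partial quotient of the continued fraction expansion of `θ`: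
`a_n(θ) = ⌊1 / Gⁿ(θ)⌋`. -/
def pquot (θ : ℝ) (n : ℕ) : ℕ := ⌊1 / gaussMap^[n] θ⌋₊

/-- The set `𝔼_∞` of irrational numbers in `(0,1)` all of whose partial quotients are even
and tend to infinity. -/
def Einf : Set ℝ :=
  {θ | θ ∈ Ioo (0 : ℝ) 1 ∧ Irrational θ ∧ (∀ n, Even (pquot θ n)) ∧
    Tendsto (fun n => pquot θ n) atTop atTop}

/-- Reals admitting arbitrarily good rational approximations from below. -/
def WellApproxBelow (ρ : ℝ) : Prop :=
  ∀ ε : ℝ, 0 < ε → ∃ r : ℚ, 0 < ρ - r ∧ (ρ - r) * (r.den : ℝ) ^ 2 < ε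

theorem WellApproxBelow.irrational {ρ : ℝ} (h : WellApproxBelow ρ) : Irrational ρ := by
  rintro ⟨x, rfl⟩
  have hx : (0 : ℝ) < x.den := by exact_mod_cast x.den_pos
  obtain ⟨r, h1, h2⟩ := h (1 / x.den) (by positivity)
  have hr : (1 : ℝ) ≤ r.den := by exact_mod_cast r.den_pos
  have hxr : (x : ℝ) - r = ((x.num * r.den - r.num * x.den : ℤ) : ℝ) / (x.den * r.den) := by
    rw [Rat.cast_def x, Rat.cast_def r]
    push_cast
    field_simp
  rw [hxr] at h1 h2
  have hpos : 0 < x.num * r.den - r.num * x.den := by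
    have : (0 : ℝ) < ((x.num * r.den - r.num * x.den : ℤ) : ℝ) := by
      by_contra hc
      exact absurd h1 (not_lt.2 (div_nonpos_of_nonpos_of_nonneg (not_lt.1 hc) (by positivity)))
    exact_mod_cast this
  have h3 : (1 : ℝ) ≤ ((x.num * r.den - r.num * x.den : ℤ) : ℝ) := by exact_mod_cast hpos
  have h4 : ((x.num * r.den - r.num * x.den : ℤ) : ℝ) / (x.den * r.den) * (r.den : ℝ) ^ 2
      = ((x.num * r.den - r.num * x.den : ℤ) : ℝ) * r.den / x.den := by
    field_simp
  rw [h4] at h2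
  have h5 := (div_lt_div_iff_of_pos_right hx).1 h2
  nlinarith

theorem exists_between_Icc {x η : ℝ} (hx : x ∈ Icc (0 : ℝ) 1) (hη : 0 < η) :
    max (x - η) 0 < min (x + η) 1 := by
  rcases hx with ⟨h0, h1⟩
  simp only [max_lt_iff, lt_min_iff]
  refine ⟨⟨?_, ?_⟩, ?_, ?_⟩ <;> linarith

theorem wellApproxBelow_residual :
    (Subtype.val ⁻¹' {ρ : ℝ | ρ ∈ Icc (0 : ℝ) 1 ∧ WellApproxBelow ρ} : Set ↥(Icc (0 : ℝ) 1)) ∈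
      residual ↥(Icc (0 : ℝ) 1) := by
  let U : ℕ → Set ↥(Icc (0 : ℝ) 1) := fun n =>
    {x | ∃ r : ℚ, (r : ℝ) < x ∧ ((x : ℝ) - r) * (r.den : ℝ) ^ 2 < 1 / (n + 1)}
  have hU : ∀ n, U n ∈ residual ↥(Icc (0 : ℝ) 1) := by
    intro n
    apply residual_of_dense_open
    · have : U n = ⋃ r : ℚ, {x : ↥(Icc (0 : ℝ) 1) |
        (r : ℝ) < x ∧ ((x : ℝ) - r) * (r.den : ℝ) ^ 2 < 1 / (n + 1)} := by
        ext x; simp [U]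
      rw [this]
      refine isOpen_iUnion fun r => ?_
      have hc : Continuous fun x : ↥(Icc (0 : ℝ) 1) => ((x : ℝ) - r) * (r.den : ℝ) ^ 2 := by
        fun_prop
      exact (isOpen_lt continuous_const continuous_subtype_val).inter
        (isOpen_lt hc continuous_const)
    · rw [Metric.dense_iff]
      rintro ⟨x, hx⟩ η hη
      obtain ⟨r, hr1, hr2⟩ := exists_rat_btwn (exists_between_Icc hx hη)
      have hd : (0 : ℝ) < r.den := by exact_mod_cast r.den_pos
      have hpos : (0 : ℝ) < 1 / (n + 1) / (r.den : ℝ) ^ 2 := by positivity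
      obtain ⟨y, hy1, hy2⟩ := exists_between (lt_min hr2 (lt_add_of_pos_right (r : ℝ) hpos))
      rw [lt_min_iff, lt_min_iff] at hy2
      rw [max_lt_iff] at hr1
      refine ⟨⟨y, ?_, ?_⟩, ?_, r, hy1, ?_⟩
      · linarith
      · linarith
      · rw [Metric.mem_ball, Subtype.dist_eq, Real.dist_eq, abs_lt]
        constructor <;> linarith
      · have : y - r < 1 / (n + 1) / (r.den : ℝ) ^ 2 := by linarith
        exact (lt_div_iff₀ (by positivity)).1 this
  refine mem_of_superset (countable_iInter_mem.2 hU) ?_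
  intro x hx
  refine ⟨x.2, fun ε hε => ?_⟩
  obtain ⟨n, hn⟩ := exists_nat_one_div_lt hε
  obtain ⟨r, h1, h2⟩ := mem_iInter.1 hx n
  exact ⟨r, sub_pos.2 h1, h2.trans hn⟩

/-- The irrational numbers not approximable from below within `ε / q²` form a null set. -/
theorem volume_not_approx_below {ε : ℝ} (hε : 0 < ε) (hε1 : ε ≤ 1) :
    volume {x : ℝ | Irrational x ∧ ∀ r : ℚ, (r : ℝ) < x → ε ≤ (x - r) * (r.den : ℝ) ^ 2} = 0 := by
  set B := {x : ℝ | Irrational x ∧ ∀ r : ℚ, (r : ℝ) < x → ε ≤ (x - r) * (r.den : ℝ) ^ 2} with hB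
  have key : ∀ x ∈ B, ¬ Tendsto (fun r => volume (B ∩ Metric.closedBall x r) /
      volume (Metric.closedBall x r)) (𝓝[>] 0) (𝓝 1) := by
    intro x hx ht
    have hlt : ∀ᶠ r in 𝓝[>] (0 : ℝ), ENNReal.ofReal (1 - ε / 4) <
        volume (B ∩ Metric.closedBall x r) / volume (Metric.closedBall x r) := by
      apply ht.eventually_const_lt
      rw [← ENNReal.ofReal_one]
      exact (ENNReal.ofReal_lt_ofReal_iff one_pos).2 (by linarith)
    obtain ⟨η, hη, hη2⟩ := (mem_nhdsGT_iff_exists_Ioo_subset).1 hlt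
    obtain ⟨n, hn⟩ := exists_nat_one_div_lt (half_pos (show (0 : ℝ) < η from hη))
    obtain ⟨r, hr1, hr2⟩ := Real.exists_rat_abs_sub_le_and_den_le x (Nat.succ_pos n)
    have hd : (1 : ℝ) ≤ r.den := by exact_mod_cast r.den_pos
    have hdn : (r.den : ℝ) ≤ n + 1 := by exact_mod_cast hr2
    have hn1 : (0 : ℝ) < n + 1 := by positivity
    have hne : 0 < |x - r| := abs_pos.2 (sub_ne_zero.2 (hx.1.ne_rat r))
    have hs1 : |x - r| < η / 2 := by
      refine (hr1.trans ?_).trans_lt hn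
      push_cast
      apply one_div_le_one_div_of_le hn1
      nlinarith
    have hs2 : |x - r| * (r.den : ℝ) ^ 2 < 1 := by
      push_cast at hr1
      have h1 := (le_div_iff₀ (by positivity)).1 hr1
      have : |x - r| * (r.den : ℝ) ^ 2 < |x - r| * ((n + 1 + 1) * r.den) := by
        apply mul_lt_mul_of_pos_left _ hne
        nlinarith
      linarith
    set κ := |x - r| with hκ
    have hmem := hη2 (show 2 * κ ∈ Ioo 0 η from ⟨by linarith, by linarith⟩)
    have hsub : B ∩ Metric.closedBall x (2 * κ) ⊆
        Metric.closedBall x (2 * κ) \ Ioo (r : ℝ) (r + ε * κ) := by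
      rintro y ⟨hyB, hyb⟩
      refine ⟨hyb, fun hy => ?_⟩
      have h1 := hyB.2 r hy.1
      have h2 : (y - r) * (r.den : ℝ) ^ 2 < ε * κ * (r.den : ℝ) ^ 2 := by
        apply mul_lt_mul_of_pos_right _ (by positivity)
        linarith [hy.2]
      nlinarith
    have hin : Ioo (r : ℝ) (r + ε * κ) ⊆ Metric.closedBall x (2 * κ) := by
      intro y hy
      rw [Metric.mem_closedBall, Real.dist_eq, abs_le]
      have h1 := abs_le.1 hκ.symm.le
      have h2 : ε * κ ≤ κ := by nlinarith
      constructor <;> linarith [hy.1, hy.2]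
    have hvol : volume (B ∩ Metric.closedBall x (2 * κ)) ≤ ENNReal.ofReal (4 * κ - ε * κ) := by
      refine (measure_mono hsub).trans ?_
      rw [measure_sdiff hin measurableSet_Ioo.nullMeasurableSet (by simp),
        Real.volume_closedBall, Real.volume_Ioo, ← ENNReal.ofReal_sub _ (by nlinarith)]
      apply ENNReal.ofReal_le_ofReal
      linarith
    have hdiv : volume (B ∩ Metric.closedBall x (2 * κ)) /
        volume (Metric.closedBall x (2 * κ)) ≤ ENNReal.ofReal (1 - ε / 4) := by
      refine (ENNReal.div_le_div_right hvol _).trans ?_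
      rw [Real.volume_closedBall, ← ENNReal.ofReal_div_of_pos (by linarith)]
      apply ENNReal.ofReal_le_ofReal
      apply le_of_eq
      field_simp
      ring
    exact absurd hmem (not_lt.2 hdiv)
  have hae := Besicovitch.ae_tendsto_measure_inter_div (volume : Measure ℝ) B
  have hT : ∀ᵐ x ∂(volume.restrict B), x ∉ B := by
    filter_upwards [hae] with x hx hxB using key x hxB hx
  have h2 : (volume.restrict B) B = 0 := by
    have := ae_iff.1 hT
    simpa using this
  rwa [Measure.restrict_apply_self] at h2

theorem volume_diff_wellApproxBelow :
    volume (Icc (0 : ℝ) 1 \ {ρ : ℝ | ρ ∈ Icc (0 : ℝ) 1 ∧ WellApproxBelow ρ}) = 0 := by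
  have hsub : Icc (0 : ℝ) 1 \ {ρ : ℝ | ρ ∈ Icc (0 : ℝ) 1 ∧ WellApproxBelow ρ} ⊆
      range ((↑) : ℚ → ℝ) ∪ ⋃ n : ℕ, {x : ℝ | Irrational x ∧ ∀ r : ℚ, (r : ℝ) < x →
        1 / ((n : ℝ) + 1) ≤ (x - r) * (r.den : ℝ) ^ 2} := by
    rintro x ⟨hx, hx2⟩
    by_cases hirr : Irrational x
    · right
      have : ¬ WellApproxBelow x := fun h => hx2 ⟨hx, h⟩
      unfold WellApproxBelow at this
      push Not at this
      obtain ⟨ε, hε, h⟩ := this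
      obtain ⟨n, hn⟩ := exists_nat_one_div_lt hε
      exact mem_iUnion.2 ⟨n, hirr, fun r hr => hn.le.trans (h r (sub_pos.2 hr))⟩
    · left
      exact not_not.1 hirr
  refine measure_mono_null hsub (measure_union_null ?_ (measure_iUnion_null fun n => ?_))
  · exact (countable_range _).measure_zero _
  · refine volume_not_approx_below (by positivity) ?_
    rw [div_le_one (by positivity)]
    linarith [Nat.cast_nonneg (α := ℝ) n]

/-- Convergents: the error of the `n`-th convergent in terms of the Gauss orbit. -/
theorem exists_convergent {θ : ℝ} (hθ : Irrational θ) (h01 : θ ∈ Ioo (0 : ℝ) 1) (n : ℕ) :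
    Irrational (gaussMap^[n] θ) ∧ gaussMap^[n] θ ∈ Ioo (0 : ℝ) 1 ∧
    ∃ (q q' : ℕ) (p p' : ℤ), 1 ≤ q ∧ 0 < (-1) ^ n * (q * θ - p) ∧
      q * θ - p = -(gaussMap^[n] θ) * (q' * θ - p') ∧
      (-1) ^ n * (q' * (q * θ - p) - q * (q' * θ - p')) = 1 := by
  induction n with
  | zero => exact ⟨hθ, h01, 1, 0, 0, 1, by simp, by simpa using h01.1, by simp, by simp⟩
  | succ n ih =>
    obtain ⟨hirr, hmem, q, q', p, p', hq, hpos, hrec, hdet⟩ := ih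
    set x := gaussMap^[n] θ with hx
    have hx0 : x ≠ 0 := hmem.1.ne'
    have hstep : gaussMap^[n + 1] θ = 1 / x - ⌊1 / x⌋ := by
      rw [Function.iterate_succ_apply', ← hx, gaussMap, if_neg hx0, Int.fract]
    have hirr' : Irrational (gaussMap^[n + 1] θ) := by
      rw [hstep, one_div]
      exact hirr.inv.sub_intCast _
    have hge : 1 ≤ 1 / x := by
      rw [le_div_iff₀ hmem.1]; linarith [hmem.2]
    obtain ⟨a, ha⟩ : ∃ a : ℕ, (⌊1 / x⌋ : ℤ) = a :=
      ⟨⌊1 / x⌋.toNat, (Int.toNat_of_nonneg (Int.floor_nonneg.2 (by linarith))).symm⟩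
    have ha1 : 1 ≤ a := by
      have : (1 : ℤ) ≤ ⌊1 / x⌋ := Int.le_floor.2 (by simpa using hge)
      omega
    have hmem' : gaussMap^[n + 1] θ ∈ Ioo (0 : ℝ) 1 := by
      have h1 : gaussMap^[n + 1] θ = Int.fract (1 / x) := hstep
      refine ⟨lt_of_le_of_ne (h1 ▸ Int.fract_nonneg _) fun h => hirr' ⟨0, by simpa using h⟩, ?_⟩
      rw [h1]; exact Int.fract_lt_one _
    have hy : gaussMap^[n + 1] θ = 1 / x - a := by rw [hstep, ha]; simp
    refine ⟨hirr', hmem', a * q + q', q, a * p + p', p, ?_, ?_, ?_, ?_⟩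
    · nlinarith
    · have h1 : ((a * q + q' : ℕ) : ℝ) * θ - ((a * p + p' : ℤ) : ℝ)
          = -(gaussMap^[n + 1] θ) * (q * θ - p) := by
        rw [hy]
        have : (q' * θ - p') = -(1 / x) * (q * θ - p) := by
          rw [hrec]; field_simp
        push_cast
        linear_combination this
      rw [h1, pow_succ]
      have := mul_pos hmem'.1 hpos
      linarith
    · rw [hy]
      have : (q' * θ - p') = -(1 / x) * (q * θ - p) := by
        rw [hrec]; field_simp
      push_cast
      linear_combination this
    · rw [pow_succ]
      push_cast
      linear_combination hdet

theorem Einf_subset : Einf ⊆ {ρ : ℝ | ρ ∈ Icc (0 : ℝ) 1 ∧ WellApproxBelow ρ} := by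
  rintro θ ⟨h01, hirr, -, hlim⟩
  refine ⟨Ioo_subset_Icc_self h01, fun ε hε => ?_⟩
  obtain ⟨k, hk⟩ := exists_nat_one_div_lt hε
  obtain ⟨n₀, hn₀⟩ := eventually_atTop.1 (hlim.eventually_ge_atTop (k + 1))
  have hbig := hn₀ (2 * n₀) (by omega)
  obtain ⟨-, hmem, q, q', p, p', hq, hpos, hrec, hdet⟩ := exists_convergent hirr h01 (2 * n₀)
  set x := gaussMap^[2 * n₀] θ with hx
  have hsmall : x < ε := by
    have h1 : ((k + 1 : ℕ) : ℝ) ≤ 1 / x := by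
      refine le_trans ?_ (Nat.floor_le (a := 1 / x) (by have := hmem.1; positivity))
      exact_mod_cast hbig
    push_cast at h1
    have h2 := (le_div_iff₀ hmem.1).1 h1
    refine lt_of_le_of_lt ?_ hk
    rw [le_div_iff₀ (by positivity)]
    linarith
  rw [pow_mul, neg_one_sq, one_pow, one_mul] at hpos hdet
  have hq0 : (0 : ℝ) < q := by exact_mod_cast hq
  have hr : (((p : ℚ) / (q : ℚ) : ℚ) : ℝ) = (p : ℝ) / q := by push_cast; rfl
  refine ⟨(p : ℚ) / (q : ℚ), ?_, ?_⟩
  · rw [hr, sub_pos, div_lt_iff₀ hq0]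
    linarith
  · have hden : ((((p : ℚ) / (q : ℚ) : ℚ).den : ℕ) : ℝ) ≤ q := by
      have h1 : ((((p : ℚ) / (q : ℚ) : ℚ).den : ℕ) : ℤ) ∣ (q : ℤ) := by
        have := Rat.den_dvd p q
        rwa [Rat.divInt_eq_div, Int.cast_natCast] at this
      exact_mod_cast Int.le_of_dvd (by exact_mod_cast hq) h1
    rw [hr]
    have he : θ - (p : ℝ) / q = (q * θ - p) / q := by field_simp
    have h3 : (θ - (p : ℝ) / q) * ((((p : ℚ) / (q : ℚ) : ℚ).den : ℕ) : ℝ) ^ 2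
        ≤ (θ - (p : ℝ) / q) * (q : ℝ) ^ 2 := by
      apply mul_le_mul_of_nonneg_left
      · gcongr
      · rw [he]; positivity
    refine lt_of_le_of_lt h3 (lt_of_le_of_lt ?_ hsmall)
    rw [he]
    have h4 : (q * θ - p) / q * (q : ℝ) ^ 2 = q * (q * θ - p) := by field_simp
    rw [h4, hrec]
    have h5 : 0 ≤ (q' : ℝ) * (q * θ - p) := by positivity
    have h6 : q * -(q' * θ - p') ≤ 1 := by linarith
    have := hmem.1
    nlinarith


/-- Good approximations from below in lowest terms, with the separation of intermediate times. -/
theorem WellApproxBelow.exists_pair {ρ : ℝ} (h : WellApproxBelow ρ) {ε : ℝ} (hε : 0 < ε) :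
    ∃ (q : ℕ) (p : ℤ), 1 ≤ q ∧ 0 < q * ρ - p ∧ (q * ρ - p) * q < ε ∧
      ∀ i : ℕ, 0 < i → i < q → ∀ k : ℤ, 1 - ε ≤ |i * ρ - k| * q := by
  obtain ⟨r, h1, h2⟩ := h ε hε
  have hq : (0 : ℝ) < r.den := by exact_mod_cast r.den_pos
  have hr : (r : ℝ) = r.num / r.den := Rat.cast_def r
  have hd : (r.den : ℝ) * ρ - r.num = (ρ - r) * r.den := by rw [hr]; field_simp
  refine ⟨r.den, r.num, r.den_pos, ?_, ?_, ?_⟩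
  · rw [hd]; positivity
  · rw [hd]; linarith
  · intro i hi hiq k
    have hne : (i : ℤ) * r.num - k * r.den ≠ 0 := by
      intro h0
      have h3 : (r.den : ℤ) ∣ i * r.num := ⟨k, by linarith⟩
      have h4 : IsCoprime (r.den : ℤ) r.num := by
        have := r.reduced
        rw [Int.isCoprime_iff_gcd_eq_one, Int.gcd_comm]
        simpa [Int.gcd] using this
      have h5 := h4.dvd_of_dvd_mul_right h3
      have h6 := Int.le_of_dvd (by exact_mod_cast hi) h5
      omega
    have h3 : (1 : ℝ) ≤ |(((i : ℤ) * r.num - k * r.den : ℤ) : ℝ)| := by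
      rw [← Int.cast_abs]
      exact_mod_cast Int.one_le_abs hne
    have h4 : ((i : ℝ) * ρ - k) * r.den =
        (((i : ℤ) * r.num - k * r.den : ℤ) : ℝ) + i * ((ρ - r) * r.den) := by
      push_cast
      rw [hr]; field_simp; ring
    have h5 : (i : ℝ) * ((ρ - r) * r.den) ≤ ε := by
      have : (i : ℝ) ≤ r.den := by exact_mod_cast hiq.le
      nlinarith
    have h6 : (0 : ℝ) ≤ i * ((ρ - r) * r.den) := by positivity
    rw [← abs_of_pos hq, ← abs_mul, h4]
    have := abs_sub_abs_le_abs_sub (((i : ℤ) * r.num - k * r.den : ℤ) : ℝ) (-(i * ((ρ - r) * r.den)))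
    rw [abs_neg, abs_of_nonneg h6, sub_neg_eq_add] at this
    linarith

theorem WellApproxBelow.exists_small {ρ : ℝ} (h : WellApproxBelow ρ) {ε : ℝ} (hε : 0 < ε) :
    ∃ (q : ℕ) (p : ℤ), 1 ≤ q ∧ 0 < q * ρ - p ∧ q * ρ - p < ε := by
  obtain ⟨q, p, hq, h1, h2, -⟩ := h.exists_pair hε
  refine ⟨q, p, hq, h1, ?_⟩
  have : (1 : ℝ) ≤ q := by exact_mod_cast hq
  nlinarith

/-- Density of the forward orbit of `0` under the rotation. -/
theorem WellApproxBelow.exists_between {ρ : ℝ} (h : WellApproxBelow ρ) {a b : ℝ} (hab : a < b) :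
    ∃ (j : ℕ) (k : ℤ), a < j * ρ + k ∧ j * ρ + k < b := by
  obtain ⟨q, p, hq, h1, h2⟩ := h.exists_small (sub_pos.2 hab)
  set δ := q * ρ - p with hδ
  set m : ℤ := ⌊a⌋ with hm
  have hma : (m : ℝ) ≤ a := Int.floor_le a
  set n : ℕ := ⌊(a - m) / δ⌋₊ + 1 with hn
  have hn1 : (a - m) / δ < n := by rw [hn]; push_cast; exact Nat.lt_floor_add_one _
  have hn2 : (n : ℝ) - 1 ≤ (a - m) / δ := by
    rw [hn]; push_cast
    have : 0 ≤ (a - m) / δ := div_nonneg (by linarith) h1.le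
    linarith [Nat.floor_le this]
  rw [div_lt_iff₀ h1] at hn1
  rw [le_div_iff₀ h1] at hn2
  refine ⟨n * q, m - n * p, ?_, ?_⟩ <;> push_cast <;> nlinarith

/-- Density of the backward orbit of `0` under the rotation. -/
theorem WellApproxBelow.exists_between_neg {ρ : ℝ} (h : WellApproxBelow ρ) {a b : ℝ}
    (hab : a < b) : ∃ (j : ℕ) (k : ℤ), a < -(j * ρ) + k ∧ -(j * ρ) + k < b := by
  obtain ⟨j, k, h1, h2⟩ := h.exists_between (neg_lt_neg hab)
  exact ⟨j, -k, by push_cast; linarith, by push_cast; linarith⟩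

/-- Normalising constant of the family. -/
def famW (s : ℝ) : ℝ := 1 + Real.cos (2 * Real.pi * s) / 2

/-- A two-parameter family of lifts of circle maps with critical points over `0` and `s`. -/
def fam (s t x : ℝ) : ℝ :=
  t + x + (-Real.sin (2 * Real.pi * x) - Real.sin (2 * Real.pi * (x - s))
    + Real.sin (2 * Real.pi * (2 * x - s)) / 4) / (2 * Real.pi * famW s)

/-- The derivative of `fam s t`. -/
def wt (s x : ℝ) : ℝ :=
  (1 - Real.cos (2 * Real.pi * x)) * (1 - Real.cos (2 * Real.pi * (x - s))) / famW s

theorem half_le_famW (s : ℝ) : 1 / 2 ≤ famW s := by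
  unfold famW; linarith [Real.neg_one_le_cos (2 * Real.pi * s)]

theorem famW_le (s : ℝ) : famW s ≤ 3 / 2 := by
  unfold famW; linarith [Real.cos_le_one (2 * Real.pi * s)]

theorem famW_pos (s : ℝ) : 0 < famW s := by linarith [half_le_famW s]

theorem hasDerivAt_fam (s t x : ℝ) : HasDerivAt (fam s t) (wt s x) x := by
  have hW := (famW_pos s).ne'
  have hpi := Real.pi_pos.ne'
  have h1 : HasDerivAt (fun x : ℝ => 2 * Real.pi * x) (2 * Real.pi) x := by
    simpa using (hasDerivAt_id x).const_mul (2 * Real.pi)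
  have h2 : HasDerivAt (fun x : ℝ => 2 * Real.pi * (x - s)) (2 * Real.pi) x := by
    simpa using ((hasDerivAt_id x).sub_const s).const_mul (2 * Real.pi)
  have h3 : HasDerivAt (fun x : ℝ => 2 * Real.pi * (2 * x - s)) (2 * Real.pi * 2) x := by
    simpa using (((hasDerivAt_id x).const_mul 2).sub_const s).const_mul (2 * Real.pi)
  have := ((hasDerivAt_id x).const_add t).add
    (((h1.sin.neg.sub h2.sin).add (h3.sin.div_const 4)).div_const (2 * Real.pi * famW s))
  refine this.congr_deriv ?_
  have e1 : 2 * Real.pi * (2 * x - s) = 2 * Real.pi * x + 2 * Real.pi * (x - s) := by ring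
  have e2 : 2 * Real.pi * s = 2 * Real.pi * x - 2 * Real.pi * (x - s) := by ring
  unfold wt
  field_simp
  rw [e1, Real.cos_add]
  unfold famW
  rw [e2, Real.cos_sub]
  ring

theorem deriv_fam (s t x : ℝ) : deriv (fam s t) x = wt s x := (hasDerivAt_fam s t x).deriv

theorem wt_nonneg (s x : ℝ) : 0 ≤ wt s x := by
  have := famW_pos s
  have h1 := Real.cos_le_one (2 * Real.pi * x)
  have h2 := Real.cos_le_one (2 * Real.pi * (x - s))
  unfold wt
  apply div_nonneg (mul_nonneg _ _) this.le <;> linarith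

theorem cos_two_pi_eq_one_iff (x : ℝ) : Real.cos (2 * Real.pi * x) = 1 ↔ ∃ m : ℤ, x = m := by
  rw [Real.cos_eq_one_iff]
  have hpi := Real.pi_pos.ne'
  constructor
  · rintro ⟨m, hm⟩
    refine ⟨m, ?_⟩
    have : 2 * Real.pi * (x - m) = 0 := by linarith
    rcases mul_eq_zero.1 this with h | h
    · exact absurd h (by positivity)
    · linarith
  · rintro ⟨m, rfl⟩; exact ⟨m, by ring⟩

theorem wt_eq_zero_iff (s x : ℝ) :
    wt s x = 0 ↔ (∃ m : ℤ, x = m) ∨ ∃ m : ℤ, x = s + m := by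
  unfold wt
  rw [div_eq_zero_iff, or_iff_left (famW_pos s).ne', mul_eq_zero, sub_eq_zero, sub_eq_zero,
    eq_comm, cos_two_pi_eq_one_iff, eq_comm (a := (1 : ℝ)), cos_two_pi_eq_one_iff]
  simp only [sub_eq_iff_eq_add']

theorem fam_add_one (s t x : ℝ) : fam s t (x + 1) = fam s t x + 1 := by
  unfold fam
  have e1 : 2 * Real.pi * (x + 1) = 2 * Real.pi * x + 2 * Real.pi := by ring
  have e2 : 2 * Real.pi * (x + 1 - s) = 2 * Real.pi * (x - s) + 2 * Real.pi := by ring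
  have e3 : 2 * Real.pi * (2 * (x + 1) - s) =
    2 * Real.pi * (2 * x - s) + 2 * Real.pi + 2 * Real.pi := by ring
  rw [e1, e2, e3, Real.sin_add_two_pi, Real.sin_add_two_pi, Real.sin_add_two_pi,
    Real.sin_add_two_pi]
  ring

theorem continuous_fam : Continuous fun v : ℝ × ℝ × ℝ => fam v.1 v.2.1 v.2.2 := by
  unfold fam
  have h : ∀ v : ℝ × ℝ × ℝ, 2 * Real.pi * famW v.1 ≠ 0 := fun v => by
    have := famW_pos v.1
    positivity
  have hW : Continuous famW := by unfold famW; fun_prop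
  refine Continuous.add (by fun_prop) (Continuous.div (by fun_prop) (by fun_prop) h)

theorem contDiff_fam (s t : ℝ) {n : WithTop ℕ∞} : ContDiff ℝ n (fam s t) := by
  unfold fam; fun_prop

theorem monotone_fam (s t : ℝ) : Monotone (fam s t) :=
  monotone_of_deriv_nonneg (fun x => (hasDerivAt_fam s t x).differentiableAt)
    fun x => by rw [deriv_fam]; exact wt_nonneg s x

theorem strictMono_fam (s t : ℝ) : StrictMono (fam s t) := by
  refine (monotone_fam s t).strictMono_of_injective ?_
  have key : ∀ x y : ℝ, x < y → fam s t x ≠ fam s t y := by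
    intro x y hxy he
    have hsub : Ioo x y ⊆ (range fun m : ℤ => (m : ℝ)) ∪ range fun m : ℤ => s + m := by
      intro z hz
      have hconst : fam s t =ᶠ[𝓝 z] fun _ => fam s t x := by
        filter_upwards [Ioo_mem_nhds hz.1 hz.2] with w hw
        exact le_antisymm (he ▸ monotone_fam s t hw.2.le) (monotone_fam s t hw.1.le)
      have h0 : wt s z = 0 := by
        rw [← deriv_fam s t z, hconst.deriv_eq]; simp
      rcases (wt_eq_zero_iff s z).1 h0 with ⟨m, hm⟩ | ⟨m, hm⟩
      · exact Or.inl ⟨m, hm.symm⟩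
      · exact Or.inr ⟨m, hm.symm⟩
    have hc : (Ioo x y).Countable :=
      ((countable_range _).union (countable_range _)).mono hsub
    have := hc.measure_zero volume
    rw [Real.volume_Ioo, ENNReal.ofReal_eq_zero] at this
    linarith
  intro x y he
  rcases lt_trichotomy x y with h | h | h
  · exact absurd he (key x y h)
  · exact h
  · exact absurd he.symm (key y x h)

theorem abs_fam_sub_le (s t x : ℝ) : |fam s t x - x - t| ≤ 1 := by
  have hW := half_le_famW s
  have hpi := Real.pi_gt_three
  have e : fam s t x - x - t = (-Real.sin (2 * Real.pi * x) - Real.sin (2 * Real.pi * (x - s))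
    + Real.sin (2 * Real.pi * (2 * x - s)) / 4) / (2 * Real.pi * famW s) := by unfold fam; ring
  have hden : 3 ≤ 2 * Real.pi * famW s := by nlinarith
  rw [e, abs_div, abs_of_pos (show 0 < 2 * Real.pi * famW s by linarith),
    div_le_one (by linarith)]
  refine le_trans ?_ hden
  have h1 := abs_le.1 (Real.abs_sin_le_one (2 * Real.pi * x))
  have h2 := abs_le.1 (Real.abs_sin_le_one (2 * Real.pi * (x - s)))
  have h3 := abs_le.1 (Real.abs_sin_le_one (2 * Real.pi * (2 * x - s)))
  rw [abs_le]; constructor <;> linarith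

theorem surjective_fam (s t : ℝ) : Function.Surjective (fam s t) := by
  apply (contDiff_fam s t (n := 0)).continuous.surjective
  · refine tendsto_atTop_mono (f := fun x => x + (t - 1)) (fun x => ?_)
      (tendsto_atTop_add_const_right _ _ tendsto_id)
    linarith [(abs_le.1 (abs_fam_sub_le s t x)).1]
  · refine tendsto_atBot_mono (f := fun x => x + (t + 1)) (fun x => ?_)
      (tendsto_atBot_add_const_right _ _ tendsto_id)
    linarith [(abs_le.1 (abs_fam_sub_le s t x)).2]

theorem analyticAt_fam (s t c : ℝ) : AnalyticAt ℝ (fam s t) c :=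
  (contDiff_fam s t (n := ⊤)).contDiffAt.analyticAt

/-- A critical point of a strictly increasing analytic map is non-flat. -/
theorem nonFlatAt_of_analyticAt {F : ℝ → ℝ} {c : ℝ} (hF : AnalyticAt ℝ F c) (hm : StrictMono F)
    (h0 : deriv F c = 0) : NonFlatAt F c := by
  have hA : AnalyticAt ℝ (fun x => F x - F c) c := hF.sub analyticAt_const
  have hne : ¬ ∀ᶠ z in 𝓝 c, F z - F c = 0 := by
    intro h
    obtain ⟨η, hη, hball⟩ := Metric.eventually_nhds_iff.1 h
    have h1 := hball (y := c + η / 2) (by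
      rw [Real.dist_eq, add_sub_cancel_left, abs_of_pos (half_pos hη)]; linarith)
    have h2 := hm (show c < c + η / 2 by linarith)
    linarith
  obtain ⟨n, R, hR, hRc, hev⟩ := hA.exists_eventuallyEq_pow_smul_nonzero_iff.2 hne
  simp only [smul_eq_mul] at hev
  have hn0 : n ≠ 0 := by
    rintro rfl
    have := hev.self_of_nhds
    simp at this
    exact hRc this.symm
  have hn1 : n ≠ 1 := by
    rintro rfl
    have hd : HasDerivAt (fun x => (x - c) ^ 1 * R x) (R c) c := by
      have := ((hasDerivAt_id c).sub_const c).mul hR.differentiableAt.hasDerivAt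
      have e : (fun x => (x - c) ^ 1 * R x) = (fun x => id x - c) * R := by
        funext x; simp
      rw [e]
      exact this.congr_deriv (by simp)
    have hd2 : HasDerivAt (fun x => F x - F c) (R c) c := hd.congr_of_eventuallyEq hev
    have := hd2.deriv
    rw [deriv_sub_const] at this
    exact hRc (this.symm.trans h0)
  have hRpos : 0 < R c := by
    refine lt_of_le_of_ne ?_ hRc.symm
    have ht : Tendsto R (𝓝[>] c) (𝓝 (R c)) := hR.continuousAt.tendsto.mono_left inf_le_left
    refine ge_of_tendsto ht ?_
    filter_upwards [hev.filter_mono inf_le_left, self_mem_nhdsWithin] with x hx hxc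
    have h1 : 0 < F x - F c := sub_pos.2 (hm hxc)
    rw [hx] at h1
    exact (pos_of_mul_pos_right h1 (pow_nonneg (sub_nonneg.2 (le_of_lt hxc)) n)).le
  have hRev : ∀ᶠ x in 𝓝 c, 0 < R x := hR.continuousAt.eventually_const_lt hRpos
  have hodd : Odd n := by
    obtain ⟨x, hx1, hx2, hxc⟩ := ((hev.filter_mono nhdsWithin_le_nhds).and
      ((hRev.filter_mono nhdsWithin_le_nhds).and
        (self_mem_nhdsWithin : Iio c ∈ 𝓝[<] c))).exists
    have h1 : F x - F c < 0 := sub_neg.2 (hm hxc)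
    rw [hx1] at h1
    by_contra hn
    have := (Nat.not_odd_iff_even.1 hn).pow_nonneg (x - c)
    nlinarith
  set φ : ℝ → ℝ := fun x => (x - c) * R x ^ (1 / (n : ℝ)) with hφ
  have hφ4 : ContDiffAt ℝ 3 φ c := by
    have h1 : ContDiffAt ℝ 3 R c := hR.contDiffAt
    exact (contDiffAt_id.sub contDiffAt_const).mul (h1.rpow_const_of_ne hRpos.ne')
  have hφd : 0 < deriv φ c := by
    have h1 : DifferentiableAt ℝ (fun x => R x ^ (1 / (n : ℝ))) c :=
      hR.differentiableAt.rpow_const (Or.inl hRpos.ne')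
    have := (((hasDerivAt_id c).sub_const c).mul h1.hasDerivAt).deriv
    have h2 : deriv φ c = R c ^ (1 / (n : ℝ)) := by
      rw [hφ]; refine Eq.trans this ?_; simp
    rw [h2]; positivity
  have hderiv : ContinuousAt (deriv φ) c := by
    have : ContDiffAt ℝ 1 φ c := hφ4.of_le (by norm_num)
    have h1 := this.fderiv_right (m := 0) (by norm_num)
    have h2 : ContinuousAt (fun y => fderiv ℝ φ y 1) c :=
      h1.continuousAt.clm_apply continuousAt_const
    simpa using h2
  have hφn : ∀ᶠ x in 𝓝 c, ContDiffAt ℝ 3 φ x := hφ4.eventually (by norm_num)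
  obtain ⟨η, hη, hball⟩ := Metric.eventually_nhds_iff_ball.1
    (hev.and (hRev.and (hφn.and (hderiv.eventually_const_lt hφd))))
  refine ⟨n, ?_, Metric.ball c η, Metric.isOpen_ball, Metric.mem_ball_self hη, φ, ?_, ?_, ?_, ?_, ?_⟩
  · have : 1 < n := by omega
    exact_mod_cast this
  · exact fun x hx => (hball x hx).2.2.1.contDiffWithinAt
  · refine StrictMonoOn.injOn (strictMonoOn_of_deriv_pos (convex_ball c η) ?_ ?_)
    · exact fun x hx => (hball x hx).2.2.1.continuousAt.continuousWithinAt
    · rw [Metric.isOpen_ball.interior_eq]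
      exact fun x hx => (hball x hx).2.2.2
  · exact fun x hx => (hball x hx).2.2.2.ne'
  · simp [hφ]
  · intro x hx
    have h1 := (hball x hx).1
    have hRx := (hball x hx).2.1
    obtain ⟨m, hm2⟩ := hodd
    have e1 : |φ x| ^ ((n : ℝ) - 1) = φ x ^ (2 * m) := by
      have : (n : ℝ) - 1 = ((2 * m : ℕ) : ℝ) := by rw [hm2]; push_cast; ring
      rw [this, Real.rpow_natCast, pow_mul, sq_abs, ← pow_mul]
    have e2 : φ x * φ x ^ (2 * m) = (x - c) ^ n * R x := by
      rw [← pow_succ', ← hm2, hφ]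
      simp only
      rw [mul_pow, ← Real.rpow_natCast, ← Real.rpow_natCast, ← Real.rpow_mul hRx.le,
        one_div_mul_cancel (by exact_mod_cast hn0), Real.rpow_one]
    rw [e1, e2, ← h1]; ring

/-- The circle map induced by a lift. -/
def inducedMap (F : ℝ → ℝ) (x : S1) : S1 := ((F (AddCircle.equivIco 1 0 x : ℝ) : ℝ) : S1)

theorem add_int_of_add_one {F : ℝ → ℝ} (h : ∀ x, F (x + 1) = F x + 1) (x : ℝ) (m : ℤ) :
    F (x + m) = F x + m := by
  induction m using Int.induction_on with
  | zero => simp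
  | succ i ih =>
    have := h (x + i)
    push_cast at ih ⊢
    rw [← add_assoc, this, ih]; ring
  | pred i ih =>
    have := h (x + ((-(i : ℤ) - 1 : ℤ) : ℝ))
    push_cast at ih this ⊢
    rw [show x + (-(i : ℝ) - 1) + 1 = x + -i by ring, ih] at this
    linarith

theorem inducedMap_coe {F : ℝ → ℝ} (h : ∀ x, F (x + 1) = F x + 1) (x : ℝ) :
    inducedMap F (x : S1) = (F x : S1) := by
  unfold inducedMap
  have : ((AddCircle.equivIco 1 0 (x : S1) : ℝ)) = Int.fract x := by
    rw [AddCircle.coe_equivIco_mk_apply]; simp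
  rw [this]
  have h2 := add_int_of_add_one h (Int.fract x) ⌊x⌋
  rw [Int.fract_add_floor] at h2
  rw [h2]
  rw [AddCircle.coe_add]
  have : ((⌊x⌋ : ℝ) : S1) = 0 := by
    rw [AddCircle.coe_eq_zero_iff]; exact ⟨⌊x⌋, by simp⟩
  rw [this, add_zero]

theorem isLift_fam (s t : ℝ) : IsLift (inducedMap (fam s t)) (fam s t) :=
  ⟨strictMono_fam s t, surjective_fam s t, fam_add_one s t,
    fun x => inducedMap_coe (fam_add_one s t) x⟩

theorem unicritical_fam (t : ℝ) : Unicritical (inducedMap (fam 0 t)) ((0 : ℝ) : S1) ⊤ := by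
  have hz : {x : ℝ | deriv (fam 0 t) x = 0} = {x : ℝ | ∃ m : ℤ, x = 0 + m} := by
    ext x
    simp only [mem_ofPred_eq, deriv_fam, wt_eq_zero_iff, zero_add, or_self]
  refine ⟨fam 0 t, 0, isLift_fam 0 t, contDiff_fam 0 t, rfl, hz, ?_⟩
  refine nonFlatAt_of_analyticAt (analyticAt_fam 0 t 0) (strictMono_fam 0 t) ?_
  have : (0 : ℝ) ∈ {x : ℝ | ∃ m : ℤ, x = 0 + m} := ⟨0, by simp⟩
  rw [← hz] at this
  exact this

theorem bicritical_fam {s : ℝ} (hs : s ∈ Ioo (0 : ℝ) 1) (t : ℝ) :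
    Bicritical (inducedMap (fam s t)) ((0 : ℝ) : S1) (s : S1) ⊤ := by
  have hz : {x : ℝ | deriv (fam s t) x = 0} =
      {x : ℝ | ∃ m : ℤ, x = 0 + m} ∪ {x : ℝ | ∃ m : ℤ, x = s + m} := by
    ext x
    simp only [mem_ofPred_eq, deriv_fam, wt_eq_zero_iff, zero_add, mem_union]
  refine ⟨?_, fam s t, 0, s, isLift_fam s t, contDiff_fam s t, rfl, rfl, hz, ?_, ?_⟩
  · intro h
    have h2 : (s : S1) = 0 := h.symm
    rw [AddCircle.coe_eq_zero_iff] at h2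
    obtain ⟨m, hm⟩ := h2
    simp only [zsmul_eq_mul, mul_one] at hm
    have h1 : (0 : ℝ) < (m : ℝ) := hm ▸ hs.1
    have h2 : (m : ℝ) < 1 := hm ▸ hs.2
    have h3 : 0 < m := by exact_mod_cast h1
    have h4 : m < 1 := by exact_mod_cast h2
    omega
  · refine nonFlatAt_of_analyticAt (analyticAt_fam s t 0) (strictMono_fam s t) ?_
    have : (0 : ℝ) ∈ {x : ℝ | deriv (fam s t) x = 0} := hz ▸ Or.inl ⟨0, by simp⟩
    exact this
  · refine nonFlatAt_of_analyticAt (analyticAt_fam s t s) (strictMono_fam s t) ?_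
    have : s ∈ {x : ℝ | deriv (fam s t) x = 0} := hz ▸ Or.inr ⟨0, by simp⟩
    exact this

/-- Lifts of orientation-preserving circle homeomorphisms. -/
structure DegOne (L : ℝ → ℝ) : Prop where
  mono : StrictMono L
  surj : Function.Surjective L
  add_one : ∀ x, L (x + 1) = L x + 1

/-- `φ` semiconjugates `L` to the translation by `ρ`, normalised at `0`. -/
structure IsRot (L φ : ℝ → ℝ) (ρ : ℝ) : Prop where
  mono : Monotone φ
  add_one : ∀ x, φ (x + 1) = φ x + 1
  semi : ∀ x, φ (L x) = φ x + ρ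
  zero : φ 0 = 0

theorem degOne_fam (s t : ℝ) : DegOne (fam s t) :=
  ⟨strictMono_fam s t, surjective_fam s t, fam_add_one s t⟩

namespace DegOne

variable {L : ℝ → ℝ}

theorem continuous (h : DegOne L) : Continuous L := h.mono.monotone.continuous_of_surjective h.surj

theorem add_int (h : DegOne L) (x : ℝ) (m : ℤ) : L (x + m) = L x + m :=
  add_int_of_add_one h.add_one x m

theorem iterate (h : DegOne L) (n : ℕ) : DegOne L^[n] := by
  refine ⟨h.mono.iterate n, h.surj.iterate n, ?_⟩
  induction n with
  | zero => simp
  | succ n ih => intro x; rw [Function.iterate_succ_apply', ih, h.add_one,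
      Function.iterate_succ_apply']

theorem sub_int (h : DegOne L) (p : ℤ) : DegOne fun x => L x - p :=
  ⟨fun x y hxy => sub_lt_sub_right (h.mono hxy) _,
    fun y => (h.surj (y + p)).imp fun x hx => by rw [hx]; ring,
    fun x => by rw [h.add_one]; ring⟩

/-- The bundled monotone degree one lift. -/
def bundle (h : DegOne L) : CircleDeg1Lift := ⟨⟨L, h.mono.monotone⟩, h.add_one⟩

theorem exists_isRot (h : DegOne L) {ρ : ℝ} (hρ : h.bundle.translationNumber = ρ) :
    ∃ φ, IsRot L φ ρ := by
  have hb : Function.Bijective (CircleDeg1Lift.translate (Multiplicative.ofAdd ρ) :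
      CircleDeg1Lift) :=
    CircleDeg1Lift.isUnit_iff_bijective.1 (Units.isUnit _)
  obtain ⟨P, hP⟩ := CircleDeg1Lift.semiconj_of_bijective_of_translationNumber_eq
    (f₁ := h.bundle) ⟨h.mono.injective, h.surj⟩ hb
    (by rw [hρ, CircleDeg1Lift.translationNumber_translate])
  refine ⟨fun x => P x - P 0, fun x y hxy => sub_le_sub_right (P.monotone hxy) _, fun x => ?_,
    fun x => ?_, sub_self _⟩
  · rw [P.map_add_one]; ring
  · have := hP x
    rw [CircleDeg1Lift.translate_apply] at this
    have h2 : P (L x) = ρ + P x := this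
    rw [h2]; ring

end DegOne

namespace IsRot

variable {L φ : ℝ → ℝ} {ρ : ℝ}

theorem add_int (h : IsRot L φ ρ) (x : ℝ) (m : ℤ) : φ (x + m) = φ x + m :=
  add_int_of_add_one h.add_one x m

theorem int (h : IsRot L φ ρ) (m : ℤ) : φ m = m := by
  have := h.add_int 0 m
  rwa [zero_add, h.zero, zero_add] at this

theorem iter (h : IsRot L φ ρ) (n : ℕ) (x : ℝ) : φ (L^[n] x) = φ x + n * ρ := by
  induction n with
  | zero => simp
  | succ n ih => rw [Function.iterate_succ_apply', h.semi, ih]; push_cast; ring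

theorem iterate_sub (h : IsRot L φ ρ) (q : ℕ) (p : ℤ) :
    IsRot (fun x => L^[q] x - p) φ (q * ρ - p) := by
  refine ⟨h.mono, h.add_one, fun x => ?_, h.zero⟩
  have := h.add_int (L^[q] x) (-p)
  push_cast at this
  rw [← sub_eq_add_neg] at this
  rw [this, h.iter]; ring

theorem orbit (h : IsRot L φ ρ) (j : ℕ) (k : ℤ) (x : ℝ) : φ (L^[j] x + k) = φ x + j * ρ + k := by
  rw [h.add_int, h.iter]

theorem lt_of_lt (h : IsRot L φ ρ) {x y : ℝ} (hxy : φ x < φ y) : x < y := h.mono.reflect_lt hxy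

theorem abs_sub_le (h : IsRot L φ ρ) (x : ℝ) : |φ x - x| ≤ 1 := by
  have h1 := h.mono (Int.floor_le x)
  have h2 := h.mono (Int.lt_floor_add_one x).le
  rw [h.add_one, h.int] at h2
  rw [h.int] at h1
  rw [abs_le]
  constructor <;> linarith [Int.floor_le x, Int.lt_floor_add_one x]

theorem tendsto (h : IsRot L φ ρ) : Tendsto (fun n : ℕ => L^[n] 0 / (n : ℝ)) atTop (𝓝 ρ) := by
  have h1 : Tendsto (fun n : ℕ => 1 / (n : ℝ)) atTop (𝓝 0) := tendsto_one_div_atTop_nhds_zero_nat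
  rw [tendsto_iff_dist_tendsto_zero]
  refine squeeze_zero' (Eventually.of_forall fun _ => dist_nonneg) ?_ h1
  filter_upwards [eventually_gt_atTop 0] with n hn
  have hn' : (0 : ℝ) < n := by exact_mod_cast hn
  rw [Real.dist_eq]
  have h2 := h.abs_sub_le (L^[n] 0)
  rw [h.iter, h.zero, zero_add, abs_sub_comm] at h2
  have : L^[n] 0 / n - ρ = (L^[n] 0 - n * ρ) / n := by field_simp
  rw [this, abs_div, abs_of_pos hn']
  gcongr

theorem continuous (h : IsRot L φ ρ) (hρ : WellApproxBelow ρ) : Continuous φ := by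
  refine h.mono.continuous_of_denseRange ?_
  rw [DenseRange, dense_iff_exists_between]
  intro a b hab
  obtain ⟨j, k, h1, h2⟩ := hρ.exists_between hab
  have := h.orbit j k 0
  rw [h.zero, zero_add] at this
  exact ⟨_, ⟨L^[j] 0 + k, this⟩, h1, h2⟩

theorem le_of_isRot (hρ : WellApproxBelow ρ) {ψ : ℝ → ℝ} (h : IsRot L φ ρ) (h' : IsRot L ψ ρ)
    (x : ℝ) : φ x ≤ ψ x := by
  by_contra hc
  obtain ⟨j, k, h1, h2⟩ := hρ.exists_between (not_le.1 hc)
  have e1 := h.orbit j k 0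
  have e2 := h'.orbit j k 0
  rw [h.zero, zero_add] at e1
  rw [h'.zero, zero_add] at e2
  rw [← e2] at h1
  rw [← e1] at h2
  exact lt_asymm (h.lt_of_lt h2) (h'.lt_of_lt h1)

theorem unique (hρ : WellApproxBelow ρ) {ψ : ℝ → ℝ} (h : IsRot L φ ρ) (hψ : IsRot L ψ ρ) :
    φ = ψ :=
  funext fun x => le_antisymm (le_of_isRot hρ h hψ x) (le_of_isRot hρ hψ h x)

/-- Along an orbit segment of small total rotation some step is short. -/
theorem exists_short_step {Φ : ℝ → ℝ} {δ : ℝ} (h : IsRot Φ φ δ) {N : ℕ} (hN : 0 < N)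
    (hNδ : N * δ < 1) (x : ℝ) : ∃ i < N, Φ^[i + 1] x - Φ^[i] x < 1 / N := by
  by_contra! hc
  have h1 : ∑ i ∈ Finset.range N, (Φ^[i + 1] x - Φ^[i] x) = Φ^[N] x - x := by
    rw [Finset.sum_range_sub (fun i => Φ^[i] x)]; simp
  have h2 : ∑ i ∈ Finset.range N, (1 / (N : ℝ)) ≤ ∑ i ∈ Finset.range N, (Φ^[i + 1] x - Φ^[i] x) :=
    Finset.sum_le_sum fun i hi => hc i (Finset.mem_range.1 hi)
  have hN' : (0 : ℝ) < N := by exact_mod_cast hN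
  rw [h1, Finset.sum_const, Finset.card_range, nsmul_eq_mul, mul_one_div_cancel hN'.ne'] at h2
  have h3 : Φ^[N] x < x + 1 := h.lt_of_lt (by rw [h.iter, h.add_one]; linarith)
  linarith

end IsRot

theorem iterate_le_iterate_sub {L L' : ℝ → ℝ} (hL : Monotone L) {δ : ℝ} (hδ : 0 ≤ δ)
    (h : ∀ x, L x ≤ L' x - δ) (n : ℕ) (x : ℝ) : L^[n + 1] x ≤ L'^[n + 1] x - δ := by
  induction n with
  | zero => simpa using h x
  | succ n ih =>
    rw [Function.iterate_succ_apply' L, Function.iterate_succ_apply' L']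
    exact (hL (ih.trans (sub_le_self _ hδ))).trans (h _)

theorem not_isRot_of_lt {ρ : ℝ} (hρ : WellApproxBelow ρ) {L L' φ φ' : ℝ → ℝ} (hL : Monotone L)
    (h : IsRot L φ ρ) (h' : IsRot L' φ' ρ) {δ : ℝ} (hδ : 0 < δ) (hle : ∀ x, L x ≤ L' x - δ) :
    False := by
  obtain ⟨n, hn⟩ := exists_nat_one_div_lt hδ
  obtain ⟨q, p, hq, h1, h2⟩ := hρ.exists_small (ε := 1 / (n + 1)) (by positivity)
  have hr := h'.iterate_sub q p
  obtain ⟨i, -, hi⟩ := hr.exists_short_step (N := n + 1) (Nat.succ_pos n)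
    (by push_cast; rw [lt_div_iff₀ (by positivity)] at h2; linarith) 0
  rw [Function.iterate_succ_apply'] at hi
  set x := (fun x => L'^[q] x - p)^[i] 0
  obtain ⟨m, rfl⟩ : ∃ m, q = m + 1 := ⟨q - 1, by omega⟩
  have h3 := iterate_le_iterate_sub hL hδ.le hle m x
  push_cast at hi h1
  have h4 := h.mono (show L^[m + 1] x ≤ x + p by linarith)
  rw [h.iter, h.add_int] at h4
  push_cast at h4
  linarith

/-- The combinatorial condition expressing that `fam s t` has rotation number `ρ` and that the
point `s` sits at position `a`. -/
def Adm (ρ : ℝ) (v : ℝ × ℝ × ℝ) : Prop :=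
  ∀ (j : ℕ) (k : ℤ),
    (j * ρ + k < 0 → (fam v.1 v.2.1)^[j] 0 + k ≤ 0) ∧
    (0 < j * ρ + k → 0 ≤ (fam v.1 v.2.1)^[j] 0 + k) ∧
    (j * ρ + k < v.2.2 → (fam v.1 v.2.1)^[j] 0 + k ≤ v.1) ∧
    (v.2.2 < j * ρ + k → v.1 ≤ (fam v.1 v.2.1)^[j] 0 + k)

theorem continuous_fam_iterate (j : ℕ) :
    Continuous fun v : ℝ × ℝ × ℝ => (fam v.1 v.2.1)^[j] 0 := by
  induction j with
  | zero => simpa using continuous_const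
  | succ j ih =>
    simp only [Function.iterate_succ_apply']
    exact continuous_fam.comp (continuous_fst.prodMk
      ((continuous_fst.comp continuous_snd).prodMk ih))

theorem isClosed_adm (ρ : ℝ) : IsClosed {v | Adm ρ v} := by
  have : {v | Adm ρ v} = ⋂ (j : ℕ) (k : ℤ),
      ({v : ℝ × ℝ × ℝ | 0 ≤ j * ρ + k} ∪ {v | (fam v.1 v.2.1)^[j] 0 + k ≤ 0}) ∩
      (({v : ℝ × ℝ × ℝ | j * ρ + k ≤ 0} ∪ {v | 0 ≤ (fam v.1 v.2.1)^[j] 0 + k}) ∩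
      (({v : ℝ × ℝ × ℝ | v.2.2 ≤ j * ρ + k} ∪ {v | (fam v.1 v.2.1)^[j] 0 + k ≤ v.1}) ∩
      ({v : ℝ × ℝ × ℝ | j * ρ + k ≤ v.2.2} ∪ {v | v.1 ≤ (fam v.1 v.2.1)^[j] 0 + k}))) := by
    ext v
    simp only [Adm, mem_ofPred_eq, mem_iInter, mem_inter_iff, mem_union]
    refine forall_congr' fun j => forall_congr' fun k => ?_
    simp only [← not_lt (a := j * ρ + (k : ℝ)), ← not_lt (b := j * ρ + (k : ℝ)),
      imp_iff_not_or]
  rw [this]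
  refine isClosed_iInter fun j => isClosed_iInter fun k => ?_
  have hc := continuous_fam_iterate j
  refine IsClosed.inter (IsClosed.union ?_ ?_) (IsClosed.inter (IsClosed.union ?_ ?_)
    (IsClosed.inter (IsClosed.union ?_ ?_) (IsClosed.union ?_ ?_))) <;>
  exact isClosed_le (by fun_prop) (by fun_prop)

theorem adm_of_isRot {ρ s t : ℝ} {φ : ℝ → ℝ} (h : IsRot (fam s t) φ ρ) : Adm ρ (s, t, φ s) := by
  intro j k
  have e := h.orbit j k 0
  rw [h.zero, zero_add] at e
  refine ⟨fun hh => ?_, fun hh => ?_, fun hh => ?_, fun hh => ?_⟩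
  · exact (h.lt_of_lt (by rw [e, h.zero]; exact hh)).le
  · exact (h.lt_of_lt (by rw [e, h.zero]; exact hh)).le
  · exact (h.lt_of_lt (by rw [e]; exact hh)).le
  · exact (h.lt_of_lt (by rw [e]; exact hh)).le

theorem exists_isRot_of_bounds {L : ℝ → ℝ} (hL : DegOne L) {ρ : ℝ}
    (h : ∀ (j : ℕ) (k : ℤ), (j * ρ + k < 0 → L^[j] 0 + k ≤ 0) ∧ (0 < j * ρ + k → 0 ≤ L^[j] 0 + k)) :
    ∃ φ, IsRot L φ ρ := by
  refine hL.exists_isRot (CircleDeg1Lift.translationNumber_eq_of_tendsto₀ _ ?_)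
  have hco : ⇑hL.bundle = L := rfl
  rw [hco]
  have h1 : Tendsto (fun n : ℕ => 2 * (1 / (n : ℝ))) atTop (𝓝 (2 * 0)) :=
    tendsto_one_div_atTop_nhds_zero_nat.const_mul 2
  rw [mul_zero] at h1
  rw [tendsto_iff_dist_tendsto_zero]
  refine squeeze_zero' (Eventually.of_forall fun _ => dist_nonneg) ?_ h1
  filter_upwards [eventually_gt_atTop 0] with n hn
  have hn' : (0 : ℝ) < n := by exact_mod_cast hn
  rw [Real.dist_eq]
  have : L^[n] 0 / n - ρ = (L^[n] 0 - n * ρ) / n := by field_simp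
  rw [this, abs_div, abs_of_pos hn', ← mul_div_assoc, mul_one]
  gcongr
  have f1 := Int.floor_le ((n : ℝ) * ρ)
  have f2 := Int.lt_floor_add_one ((n : ℝ) * ρ)
  have g1 := (h n (-⌊(n : ℝ) * ρ⌋ - 1)).1 (by push_cast; linarith)
  have g2 := (h n (-⌊(n : ℝ) * ρ⌋ + 1)).2 (by push_cast; linarith)
  push_cast at g1 g2
  rw [abs_le]; constructor <;> linarith

theorem Adm.exists_isRot {ρ s t a : ℝ} (hρ : WellApproxBelow ρ) (h : Adm ρ (s, t, a)) :
    ∃ φ, IsRot (fam s t) φ ρ ∧ φ s = a := by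
  obtain ⟨φ, hφ⟩ := exists_isRot_of_bounds (degOne_fam s t) (ρ := ρ)
    fun j k => ⟨(h j k).1, (h j k).2.1⟩
  refine ⟨φ, hφ, ?_⟩
  rcases lt_trichotomy (φ s) a with hlt | heq | hlt
  · obtain ⟨j, k, h1, h2⟩ := hρ.exists_between hlt
    have e := hφ.orbit j k 0
    rw [hφ.zero, zero_add] at e
    have h3 := hφ.mono ((h j k).2.2.1 h2)
    rw [e] at h3
    exact absurd h1 (not_lt.2 h3)
  · exact heq
  · obtain ⟨j, k, h1, h2⟩ := hρ.exists_between hlt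
    have e := hφ.orbit j k 0
    rw [hφ.zero, zero_add] at e
    have h3 := hφ.mono ((h j k).2.2.2 h1)
    rw [e] at h3
    exact absurd h2 (not_lt.2 h3)

theorem exists_fam_isRot (s ρ : ℝ) : ∃ t φ, IsRot (fam s t) φ ρ := by
  let A : Set ℝ := {t | ∀ (j : ℕ) (k : ℤ), 0 < j * ρ + k → 0 ≤ (fam s t)^[j] 0 + k}
  let B : Set ℝ := {t | ∀ (j : ℕ) (k : ℤ), j * ρ + k < 0 → (fam s t)^[j] 0 + k ≤ 0}
  have hcont : ∀ j : ℕ, Continuous fun t : ℝ => (fam s t)^[j] 0 := fun j =>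
    (continuous_fam_iterate j).comp
      (continuous_const.prodMk (continuous_id.prodMk (continuous_const (y := (0 : ℝ)))))
  have hA : IsClosed A := by
    simp only [A, ofPred_forall]
    refine isClosed_iInter fun j => isClosed_iInter fun k => isClosed_iInter fun _ => ?_
    have := hcont j
    exact isClosed_le (by fun_prop) (by fun_prop)
  have hB : IsClosed B := by
    simp only [B, ofPred_forall]
    refine isClosed_iInter fun j => isClosed_iInter fun k => isClosed_iInter fun _ => ?_
    have := hcont j
    exact isClosed_le (by fun_prop) (by fun_prop)
  have hcover : (univ : Set ℝ) ⊆ A ∪ B := by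
    intro t _
    by_contra hc
    rw [mem_union, not_or] at hc
    obtain ⟨h1, h2⟩ := hc
    simp only [A, B, mem_ofPred_eq, not_forall, not_le] at h1 h2
    obtain ⟨j, k, a1, a2⟩ := h1
    obtain ⟨j', k', b1, b2⟩ := h2
    set f := (degOne_fam s t).bundle
    have c1 : (f ^ j).translationNumber ≤ ((-k : ℤ) : ℝ) := by
      apply CircleDeg1Lift.translationNumber_le_of_le_add_int (x := 0)
      rw [CircleDeg1Lift.coe_pow]
      push_cast
      change (fam s t)^[j] 0 ≤ _
      linarith
    have c2 : ((-k' : ℤ) : ℝ) ≤ (f ^ j').translationNumber := by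
      apply CircleDeg1Lift.le_translationNumber_of_add_int_le (x := 0)
      rw [CircleDeg1Lift.coe_pow]
      push_cast
      change _ ≤ (fam s t)^[j'] 0
      linarith
    rw [CircleDeg1Lift.translationNumber_pow] at c1 c2
    push_cast at c1 c2
    have d1 : (j : ℝ) * (f.translationNumber - ρ) < 0 := by linarith
    have d2 : 0 < (j' : ℝ) * (f.translationNumber - ρ) := by linarith
    have e1 := neg_of_mul_neg_right d1 (Nat.cast_nonneg j)
    have e2 := pos_of_mul_pos_right d2 (Nat.cast_nonneg j')
    linarith
  have hA0 : (univ ∩ A).Nonempty := by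
    refine ⟨ρ + 1, mem_univ _, fun j k hjk => ?_⟩
    have : ∀ j : ℕ, j * ρ ≤ (fam s (ρ + 1))^[j] 0 := by
      intro j
      induction j with
      | zero => simp
      | succ j ih =>
        rw [Function.iterate_succ_apply']
        have := (abs_le.1 (abs_fam_sub_le s (ρ + 1) ((fam s (ρ + 1))^[j] 0))).1
        push_cast
        linarith
    linarith [this j]
  have hB0 : (univ ∩ B).Nonempty := by
    refine ⟨ρ - 1, mem_univ _, fun j k hjk => ?_⟩
    have : ∀ j : ℕ, (fam s (ρ - 1))^[j] 0 ≤ j * ρ := by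
      intro j
      induction j with
      | zero => simp
      | succ j ih =>
        rw [Function.iterate_succ_apply']
        have := (abs_le.1 (abs_fam_sub_le s (ρ - 1) ((fam s (ρ - 1))^[j] 0))).2
        push_cast
        linarith
    linarith [this j]
  obtain ⟨t, -, hta, htb⟩ := isPreconnected_closed_iff.1 isPreconnected_univ A B hA hB hcover hA0 hB0
  obtain ⟨φ, hφ⟩ := exists_isRot_of_bounds (degOne_fam s t) fun j k => ⟨htb j k, hta j k⟩
  exact ⟨t, φ, hφ⟩

theorem fam_parameter_unique {ρ : ℝ} (hρ : WellApproxBelow ρ) {s t t' : ℝ} {φ φ' : ℝ → ℝ}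
    (h : IsRot (fam s t) φ ρ) (h' : IsRot (fam s t') φ' ρ) : t = t' := by
  rcases lt_trichotomy t t' with hlt | heq | hlt
  · exact (not_isRot_of_lt hρ (monotone_fam s t) h h' (sub_pos.2 hlt)
      fun x => by unfold fam; linarith).elim
  · exact heq
  · exact (not_isRot_of_lt hρ (monotone_fam s t') h' h (sub_pos.2 hlt)
      fun x => by unfold fam; linarith).elim

/-- Realisation of any prescribed position of the second critical point. -/
theorem exists_fam_position {ρ : ℝ} (hρ : WellApproxBelow ρ) (h01 : ρ ∈ Icc (0 : ℝ) 1) {α : ℝ}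
    (hα : α ∈ Ioo (0 : ℝ) 1) :
    ∃ s ∈ Ioo (0 : ℝ) 1, ∃ t φ, IsRot (fam s t) φ ρ ∧ φ s = α := by
  have hpos : 0 < ρ := lt_of_le_of_ne h01.1 fun h => hρ.irrational ⟨0, by simpa using h⟩
  have hlt1 : ρ < 1 := lt_of_le_of_ne h01.2 fun h => hρ.irrational ⟨1, by simpa using h.symm⟩
  let K : Set (ℝ × ℝ × ℝ) := (Icc 0 1 ×ˢ (Icc (-1) 2 ×ˢ Icc 0 1)) ∩ {v | Adm ρ v}
  have hK : IsCompact K :=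
    (isCompact_Icc.prod (isCompact_Icc.prod isCompact_Icc)).inter_right (isClosed_adm ρ)
  have hmem : ∀ {s t : ℝ} {φ : ℝ → ℝ}, s ∈ Icc (0 : ℝ) 1 → IsRot (fam s t) φ ρ →
      (s, t, φ s) ∈ K := by
    intro s t φ hs hφ
    have hA := adm_of_isRot hφ
    have a1 := (hA 1 0).2.1 (by simpa using hpos)
    have a2 := (hA 1 (-1)).1 (by push_cast; linarith)
    have a3 := abs_le.1 (abs_fam_sub_le s t 0)
    push_cast at a1 a2
    simp only [Function.iterate_one] at a1 a2
    have b1 := hφ.mono hs.1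
    have b2 := hφ.mono hs.2
    have b3 := hφ.int 1
    push_cast at b3
    rw [hφ.zero] at b1
    rw [b3] at b2
    refine ⟨⟨hs, ⟨?_, ?_⟩, b1, b2⟩, hA⟩ <;> simp only <;> linarith [a3.1, a3.2]
  let A : Set ℝ := Prod.fst '' (K ∩ {v | v.2.2 ≤ α})
  let B : Set ℝ := Prod.fst '' (K ∩ {v | α ≤ v.2.2})
  have hA : IsClosed A := by
    refine ((hK.inter_right ?_).image continuous_fst).isClosed
    exact isClosed_le (by fun_prop) (by fun_prop)
  have hB : IsClosed B := by
    refine ((hK.inter_right ?_).image continuous_fst).isClosed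
    exact isClosed_le (by fun_prop) (by fun_prop)
  have hcover : Icc (0 : ℝ) 1 ⊆ A ∪ B := by
    intro s hs
    obtain ⟨t, φ, hφ⟩ := exists_fam_isRot s ρ
    rcases le_total (φ s) α with h | h
    · exact Or.inl ⟨_, ⟨hmem hs hφ, h⟩, rfl⟩
    · exact Or.inr ⟨_, ⟨hmem hs hφ, h⟩, rfl⟩
  have hA0 : (Icc (0 : ℝ) 1 ∩ A).Nonempty := by
    obtain ⟨t, φ, hφ⟩ := exists_fam_isRot 0 ρ
    have h0 : (0 : ℝ) ∈ Icc (0 : ℝ) 1 := ⟨le_rfl, zero_le_one⟩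
    exact ⟨0, h0, _, ⟨hmem h0 hφ, by simpa [hφ.zero] using hα.1.le⟩, rfl⟩
  have hB0 : (Icc (0 : ℝ) 1 ∩ B).Nonempty := by
    obtain ⟨t, φ, hφ⟩ := exists_fam_isRot 1 ρ
    have h1 : (1 : ℝ) ∈ Icc (0 : ℝ) 1 := ⟨zero_le_one, le_rfl⟩
    have e : φ 1 = 1 := by simpa using hφ.int 1
    exact ⟨1, h1, _, ⟨hmem h1 hφ, by simpa [e] using hα.2.le⟩, rfl⟩
  obtain ⟨s, hs, ⟨⟨_, t, a⟩, ⟨hv, hva⟩, rfl⟩, ⟨⟨s, t', a'⟩, ⟨hw, hwa⟩, rfl⟩⟩ :=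
    isPreconnected_closed_iff.1 isPreconnected_Icc A B hA hB hcover hA0 hB0
  simp only [mem_ofPred_eq] at hva hwa hs
  obtain ⟨φ, hφ, hφs⟩ := Adm.exists_isRot hρ hv.2
  obtain ⟨φ', hφ', hφs'⟩ := Adm.exists_isRot hρ hw.2
  obtain rfl := fam_parameter_unique hρ hφ hφ'
  obtain rfl := hφ.unique hρ hφ'
  have hfin : φ s = α := le_antisymm (hφs ▸ hva) (hφs' ▸ hwa)
  refine ⟨s, ⟨lt_of_le_of_ne hs.1 ?_, lt_of_le_of_ne hs.2 ?_⟩, t, φ, hφ, hfin⟩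
  · rintro rfl
    rw [hφ.zero] at hfin
    exact hα.1.ne hfin
  · rintro rfl
    have e : φ 1 = 1 := by simpa using hφ.int 1
    rw [e] at hfin
    exact absurd hfin (ne_of_gt hα.2)

/-- The cross-ratio used to measure distortion. -/
def cratio (a z b c : ℝ) : ℝ := (z - a) * (c - b) / ((b - a) * (c - z))

theorem wt_eq_sin (s x : ℝ) :
    wt s x = 4 / famW s * (Real.sin (Real.pi * x) * Real.sin (Real.pi * (x - s))) ^ 2 := by
  unfold wt
  have e1 : 2 * Real.pi * x = 2 * (Real.pi * x) := by ring
  have e2 : 2 * Real.pi * (x - s) = 2 * (Real.pi * (x - s)) := by ring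
  rw [e1, e2, Real.cos_two_mul', Real.cos_two_mul', Real.cos_sq', Real.cos_sq']
  ring

theorem wt_eq_cos (s x : ℝ) :
    wt s x = (Real.cos (Real.pi * s) - Real.cos (2 * Real.pi * x - Real.pi * s)) ^ 2 / famW s := by
  rw [wt_eq_sin]
  have e1 : Real.pi * s = Real.pi * x - Real.pi * (x - s) := by ring
  have e2 : 2 * Real.pi * x - Real.pi * s = Real.pi * x + Real.pi * (x - s) := by ring
  rw [e2, e1, Real.cos_sub, Real.cos_add]
  ring_nf

theorem exists_int_bracket {x y : ℝ} (hxy : x ≤ y) (h : ∀ m : ℤ, (m : ℝ) ∉ Icc x y) :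
    ∃ k : ℤ, k < x ∧ y < k + 1 := by
  refine ⟨⌊x⌋, lt_of_le_of_ne (Int.floor_le x) ?_, ?_⟩
  · exact fun he => h ⌊x⌋ ⟨he.ge, he.le.trans hxy⟩
  · by_contra hc
    have := h (⌊x⌋ + 1)
    push_cast at this
    exact this ⟨(Int.lt_floor_add_one x).le, not_lt.1 hc⟩

theorem sin_mul_sin_mono {m r R : ℝ} (hr : 0 ≤ r) (hrR : r ≤ R)
    (h : ∀ k : ℤ, (k : ℝ) ∉ Icc (m - R) (m + R)) :
    0 < Real.sin (Real.pi * (m + R)) * Real.sin (Real.pi * (m - R)) ∧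
    Real.sin (Real.pi * (m + R)) * Real.sin (Real.pi * (m - R)) ≤
      Real.sin (Real.pi * (m + r)) * Real.sin (Real.pi * (m - r)) := by
  obtain ⟨k, hk1, hk2⟩ := exists_int_bracket (by linarith) h
  have hpi := Real.pi_pos
  have hR : R < 1 / 2 := by linarith
  constructor
  · have e : ∀ x : ℝ, Real.sin (Real.pi * x) = (-1) ^ k * Real.sin (Real.pi * (x - k)) := by
      intro x
      rw [mul_sub, mul_comm Real.pi (k : ℝ), Real.sin_sub_int_mul_pi, ← mul_assoc, ← mul_zpow]
      simp
    rw [e (m + R), e (m - R)]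
    have h1 : 0 < Real.sin (Real.pi * (m + R - k)) :=
      Real.sin_pos_of_pos_of_lt_pi (by apply mul_pos hpi; linarith) (by nlinarith)
    have h2 : 0 < Real.sin (Real.pi * (m - R - k)) :=
      Real.sin_pos_of_pos_of_lt_pi (by apply mul_pos hpi; linarith) (by nlinarith)
    have h3 : ((-1 : ℝ) ^ k) * ((-1 : ℝ) ^ k) = 1 := by rw [← mul_zpow]; simp
    calc (0 : ℝ) < Real.sin (Real.pi * (m + R - k)) * Real.sin (Real.pi * (m - R - k)) :=
          mul_pos h1 h2
      _ = _ := by linear_combination -(Real.sin (Real.pi * (m + R - k)) * Real.sin (Real.pi * (m - R - k))) * h3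
  · have e : ∀ r : ℝ, Real.sin (Real.pi * (m + r)) * Real.sin (Real.pi * (m - r)) =
        (Real.cos (2 * Real.pi * r) - Real.cos (2 * Real.pi * m)) / 2 := by
      intro r
      have e1 : 2 * Real.pi * r = Real.pi * (m + r) - Real.pi * (m - r) := by ring
      have e2 : 2 * Real.pi * m = Real.pi * (m + r) + Real.pi * (m - r) := by ring
      rw [e1, e2, Real.cos_sub, Real.cos_add]; ring
    rw [e, e]
    have := Real.cos_le_cos_of_nonneg_of_le_pi (x := 2 * Real.pi * r) (y := 2 * Real.pi * R)
      (by positivity) (by nlinarith) (by gcongr)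
    linarith

/-- The set of critical points of the family. -/
def critSet (s : ℝ) : Set ℝ := {x | (∃ m : ℤ, x = m) ∨ ∃ m : ℤ, x = s + m}

theorem two_point_inequality {s t x y : ℝ} (hxy : x < y) (h : Disjoint (Icc x y) (critSet s)) :
    wt s x * wt s y * (y - x) ^ 2 ≤ (fam s t y - fam s t x) ^ 2 := by
  set m := (x + y) / 2 with hm
  set R := (y - x) / 2 with hR
  have hy : y = m + R := by rw [hm, hR]; ring
  have hx : x = m - R := by rw [hm, hR]; ring
  have hR0 : 0 < R := by rw [hR]; linarith
  have hn1 : ∀ k : ℤ, (k : ℝ) ∉ Icc (m - R) (m + R) := fun k hk =>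
    disjoint_left.1 h (by rwa [hx, hy]) (Or.inl ⟨k, rfl⟩)
  have hn2 : ∀ k : ℤ, (k : ℝ) ∉ Icc (m - s - R) (m - s + R) := fun k hk =>
    disjoint_left.1 h (show s + (k : ℝ) ∈ Icc x y by
      rw [hx, hy]; constructor <;> linarith [hk.1, hk.2]) (Or.inr ⟨k, rfl⟩)
  have hW := famW_pos s
  set p : ℝ → ℝ := fun r => Real.sin (Real.pi * (m + r)) * Real.sin (Real.pi * (m - r))
  set p2 : ℝ → ℝ := fun r => Real.sin (Real.pi * (m - s + r)) * Real.sin (Real.pi * (m - s - r))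
  set κ := 4 / famW s * (p R * p2 R) with hκ
  have hκ0 : 0 < κ := mul_pos (by positivity)
    (mul_pos (sin_mul_sin_mono hR0.le le_rfl hn1).1 (sin_mul_sin_mono hR0.le le_rfl hn2).1)
  have hsum : ∀ r, 0 ≤ r → r ≤ R → 2 * κ ≤ wt s (m + r) + wt s (m - r) := by
    intro r h0 h1
    have a1 := sin_mul_sin_mono h0 h1 hn1
    have a2 := sin_mul_sin_mono h0 h1 hn2
    have a3 : p R * p2 R ≤ p r * p2 r := mul_le_mul a1.2 a2.2 a2.1.le (a1.1.le.trans a1.2)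
    have e1 : m - s + r = m + r - s := by ring
    have e2 : m - s - r = m - r - s := by ring
    have a4 : 2 * (p r * p2 r) ≤
        (Real.sin (Real.pi * (m + r)) * Real.sin (Real.pi * (m + r - s))) ^ 2 +
        (Real.sin (Real.pi * (m - r)) * Real.sin (Real.pi * (m - r - s))) ^ 2 := by
      simp only [p, p2, e1, e2]
      nlinarith [sq_nonneg (Real.sin (Real.pi * (m + r)) * Real.sin (Real.pi * (m + r - s)) -
        Real.sin (Real.pi * (m - r)) * Real.sin (Real.pi * (m - r - s)))]
    rw [wt_eq_sin, wt_eq_sin, ← mul_add, hκ]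
    have : 0 ≤ 4 / famW s := by positivity
    nlinarith
  have hprod : wt s x * wt s y = κ ^ 2 := by
    rw [wt_eq_sin, wt_eq_sin, hx, hy, hκ]
    simp only [p, p2]
    have e1 : m - s + R = m + R - s := by ring
    have e2 : m - s - R = m - R - s := by ring
    rw [e1, e2]; ring
  have hmono : MonotoneOn (fun r => fam s t (m + r) - fam s t (m - r) - 2 * κ * r) (Icc 0 R) := by
    have hd : ∀ r : ℝ, HasDerivAt (fun r => fam s t (m + r) - fam s t (m - r) - 2 * κ * r)
        (wt s (m + r) + wt s (m - r) - 2 * κ) r := by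
      intro r
      have d1 : HasDerivAt (fun r => fam s t (m + r)) (wt s (m + r)) r := by
        simpa using (hasDerivAt_fam s t (m + r)).comp_const_add m r
      have d2 : HasDerivAt (fun r => fam s t (m - r)) (-wt s (m - r)) r := by
        simpa using (hasDerivAt_fam s t (m - r)).comp_const_sub m r
      have d3 : HasDerivAt (fun r => 2 * κ * r) (2 * κ) r := by
        simpa using (hasDerivAt_id r).const_mul (2 * κ)
      exact ((d1.sub d2).sub d3).congr_deriv (by ring)
    refine monotoneOn_of_deriv_nonneg (convex_Icc 0 R)
      (fun r _ => (hd r).continuousAt.continuousWithinAt)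
      (fun r _ => (hd r).differentiableAt.differentiableWithinAt) fun r hr => ?_
    rw [interior_Icc] at hr
    rw [(hd r).deriv]
    linarith [hsum r hr.1.le hr.2.le]
  have hfin := hmono (left_mem_Icc.2 hR0.le) (right_mem_Icc.2 hR0.le) hR0.le
  simp only [add_zero, sub_zero, sub_self, mul_zero] at hfin
  rw [← hx, ← hy] at hfin
  rw [hprod, ← mul_pow]
  have : κ * (y - x) ≤ fam s t y - fam s t x := by
    have : y - x = 2 * R := by rw [hR]; ring
    rw [this]; linarith
  exact pow_le_pow_left₀ (mul_nonneg hκ0.le (by linarith)) this 2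

theorem slope_defect_antitone {s t A z y : ℝ} (hAz : A ≤ z) (hzy : z < y)
    (h : Disjoint (Icc A y) (critSet s)) :
    wt s y / (fam s t y - fam s t z) - 1 / (y - z) ≤
      wt s y / (fam s t y - fam s t A) - 1 / (y - A) := by
  have hd : ∀ x ∈ Icc A z, HasDerivAt (fun x => wt s y / (fam s t y - fam s t x) - 1 / (y - x))
      (wt s x * wt s y / (fam s t y - fam s t x) ^ 2 - 1 / (y - x) ^ 2) x := by
    intro x hx
    have hF : fam s t y - fam s t x ≠ 0 :=
      (sub_pos.2 (strictMono_fam s t (hx.2.trans_lt hzy))).ne'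
    have hyx : y - x ≠ 0 := (sub_pos.2 (hx.2.trans_lt hzy)).ne'
    have d1 := (hasDerivAt_const x (wt s y)).div ((hasDerivAt_fam s t x).const_sub (fam s t y)) hF
    have d2 := (hasDerivAt_const x (1 : ℝ)).div ((hasDerivAt_id x).const_sub y) hyx
    refine (d1.sub d2).congr_deriv ?_
    simp only [id]
    ring
  have hanti : AntitoneOn (fun x => wt s y / (fam s t y - fam s t x) - 1 / (y - x)) (Icc A z) := by
    refine antitoneOn_of_deriv_nonpos (convex_Icc A z)
      (fun r hr => (hd r hr).continuousAt.continuousWithinAt)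
      (fun r hr => (hd r (interior_subset hr)).differentiableAt.differentiableWithinAt)
      fun r hr => ?_
    have hr' := interior_subset hr
    rw [(hd r hr').deriv]
    have hry : r < y := hr'.2.trans_lt hzy
    have h2 := two_point_inequality (t := t) hry
      (h.mono_left (Icc_subset_Icc_left hr'.1))
    have hF : 0 < fam s t y - fam s t r := sub_pos.2 (strictMono_fam s t hry)
    have hyr : 0 < y - r := sub_pos.2 hry
    rw [sub_nonpos, div_le_div_iff₀ (by positivity) (by positivity), one_mul]
    exact h2
  exact hanti (left_mem_Icc.2 hAz) (right_mem_Icc.2 hAz) hAz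

/-- Away from critical points, the family contracts the cross-ratio. -/
theorem cratio_fam_le {s t A z b c : ℝ} (hAz : A < z) (hzb : z < b) (hbc : b < c)
    (h : Disjoint (Icc A c) (critSet s)) :
    cratio (fam s t A) (fam s t z) (fam s t b) (fam s t c) ≤ cratio A z b c := by
  have hmF := strictMono_fam s t
  let Q : ℝ → ℝ := fun y => Real.log (fam s t y - fam s t A) - Real.log (y - A) -
    (Real.log (fam s t y - fam s t z) - Real.log (y - z))
  have hd : ∀ y ∈ Icc b c, HasDerivAt Q (wt s y / (fam s t y - fam s t A) - 1 / (y - A) -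
      (wt s y / (fam s t y - fam s t z) - 1 / (y - z))) y := by
    intro y hy
    have n1 : fam s t y - fam s t A ≠ 0 := (sub_pos.2 (hmF (by linarith [hy.1]))).ne'
    have n2 : fam s t y - fam s t z ≠ 0 := (sub_pos.2 (hmF (by linarith [hy.1]))).ne'
    have n3 : y - A ≠ 0 := by linarith [hy.1]
    have n4 : y - z ≠ 0 := by linarith [hy.1]
    exact ((((hasDerivAt_fam s t y).sub_const _).log n1).sub
      (((hasDerivAt_id y).sub_const A).log n3)).sub
      ((((hasDerivAt_fam s t y).sub_const _).log n2).sub (((hasDerivAt_id y).sub_const z).log n4))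
  have hmono : MonotoneOn Q (Icc b c) := by
    refine monotoneOn_of_deriv_nonneg (convex_Icc b c)
      (fun r hr => (hd r hr).continuousAt.continuousWithinAt)
      (fun r hr => (hd r (interior_subset hr)).differentiableAt.differentiableWithinAt)
      fun r hr => ?_
    have hr' := interior_subset hr
    rw [(hd r hr').deriv, sub_nonneg]
    exact slope_defect_antitone hAz.le (by linarith [hr'.1])
      (h.mono_left (Icc_subset_Icc_right hr'.2))
  have hQ := hmono (left_mem_Icc.2 hbc.le) (right_mem_Icc.2 hbc.le) hbc.le
  have hzA : fam s t A < fam s t z := hmF hAz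
  have hbz : fam s t z < fam s t b := hmF hzb
  have hcb : fam s t b < fam s t c := hmF hbc
  set A' := fam s t A
  set z' := fam s t z
  set b' := fam s t b
  set c' := fam s t c
  have p1 : 0 < b' - A' := by linarith
  have p2 : 0 < b' - z' := by linarith
  have p3 : 0 < c' - A' := by linarith
  have p4 : 0 < c' - z' := by linarith
  have q1 : 0 < b - A := by linarith
  have q2 : 0 < b - z := by linarith
  have q3 : 0 < c - A := by linarith
  have q4 : 0 < c - z := by linarith
  have hlog : Real.log ((b' - A') * (c' - z') * ((c - A) * (b - z))) ≤
      Real.log ((b - A) * (c - z) * ((c' - A') * (b' - z'))) := by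
    rw [Real.log_mul (by positivity) (by positivity), Real.log_mul (by positivity) (by positivity),
      Real.log_mul (by positivity) (by positivity), Real.log_mul (by positivity) (by positivity),
      Real.log_mul (by positivity) (by positivity), Real.log_mul (by positivity) (by positivity)]
    simp only [Q] at hQ
    linarith
  have hle := (Real.log_le_log_iff (by positivity) (by positivity)).1 hlog
  unfold cratio
  rw [div_le_div_iff₀ (by positivity) (by positivity)]
  nlinarith

/-- Pointwise values of the derivative are controlled by averages. -/
theorem wt_mul_le {s t a b y : ℝ} (hab : a < b) (hy : y ∈ Icc a b) :
    wt s y * (b - a) ≤ 209 * (fam s t b - fam s t a) := by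
  have hW := famW_pos s
  have hrec : ∀ h : ℝ, wt s y ≤ 19 * (wt s (y + 3 * h) + wt s (y + 2 * h) + wt s (y + h)) := by
    intro h
    set v := 2 * Real.pi * y - Real.pi * s
    set θ := 2 * Real.pi * h
    have e1 : 2 * Real.pi * (y + h) - Real.pi * s = v + θ := by simp only [v, θ]; ring
    have e2 : 2 * Real.pi * (y + 2 * h) - Real.pi * s = v + 2 * θ := by simp only [v, θ]; ring
    have e3 : 2 * Real.pi * (y + 3 * h) - Real.pi * s = v + 3 * θ := by simp only [v, θ]; ring
    rw [wt_eq_cos, wt_eq_cos, wt_eq_cos, wt_eq_cos, e1, e2, e3, ← add_div, ← add_div,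
      ← mul_div_assoc]
    apply div_le_div_of_nonneg_right _ hW.le
    set g0 := Real.cos (Real.pi * s)
    have hid : g0 - Real.cos v = (g0 - Real.cos (v + 3 * θ)) - (1 + 2 * Real.cos θ) *
        ((g0 - Real.cos (v + 2 * θ)) - (g0 - Real.cos (v + θ))) := by
      have h1 : Real.cos (v + 3 * θ) + Real.cos (v + θ) = 2 * Real.cos θ * Real.cos (v + 2 * θ) := by
        have a1 : v + 3 * θ = (v + 2 * θ) + θ := by ring
        have a2 : v + θ = (v + 2 * θ) - θ := by ring
        rw [a1, a2, Real.cos_add, Real.cos_sub]; ring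
      have h2 : Real.cos (v + 2 * θ) + Real.cos v = 2 * Real.cos θ * Real.cos (v + θ) := by
        have a1 : v + 2 * θ = (v + θ) + θ := by ring
        have a2 : Real.cos v = Real.cos ((v + θ) - θ) := by ring_nf
        rw [a1, a2, Real.cos_add, Real.cos_sub]; ring
      linear_combination h1 - h2
    have hk1 : (1 + 2 * Real.cos θ) ^ 2 ≤ 9 := by
      have := Real.neg_one_le_cos θ
      have := Real.cos_le_one θ
      nlinarith
    rw [hid]
    set k := 1 + 2 * Real.cos θ
    set x3 := g0 - Real.cos (v + 3 * θ)
    set x2 := g0 - Real.cos (v + 2 * θ)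
    set x1 := g0 - Real.cos (v + θ)
    have c1 : (x3 - k * (x2 - x1)) ^ 2 ≤ (1 + k ^ 2 + k ^ 2) * (x3 ^ 2 + x2 ^ 2 + x1 ^ 2) := by
      nlinarith [sq_nonneg (x2 + k * x3), sq_nonneg (x1 - k * x3), sq_nonneg (k * x1 + k * x2)]
    have c2 : 0 ≤ x3 ^ 2 + x2 ^ 2 + x1 ^ 2 := by positivity
    nlinarith
  have hF := monotone_fam s t
  -- the sign `σ` selects the side of `y` on which there is room
  have key : ∀ σ : ℝ, σ ^ 2 = 1 → ∀ H : ℝ, 0 ≤ H → wt s y * H ≤ 19 *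
      (σ * (fam s t (y + 3 * (σ * H)) - fam s t y) / 3 +
        σ * (fam s t (y + 2 * (σ * H)) - fam s t y) / 2 +
        σ * (fam s t (y + σ * H) - fam s t y)) := by
    intro σ hσ H hH
    let D : ℝ → ℝ := fun H => 19 * (σ * (fam s t (y + 3 * (σ * H)) - fam s t y) / 3 +
        σ * (fam s t (y + 2 * (σ * H)) - fam s t y) / 2 +
        σ * (fam s t (y + σ * H) - fam s t y)) - wt s y * H
    have hd : ∀ H, HasDerivAt D (19 * (wt s (y + 3 * (σ * H)) + wt s (y + 2 * (σ * H)) +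
        wt s (y + σ * H)) - wt s y) H := by
      intro H
      have i3 : HasDerivAt (fun H => y + 3 * (σ * H)) (3 * (σ * 1)) H :=
        (((hasDerivAt_id H).const_mul σ).const_mul 3).const_add y
      have i2 : HasDerivAt (fun H => y + 2 * (σ * H)) (2 * (σ * 1)) H :=
        (((hasDerivAt_id H).const_mul σ).const_mul 2).const_add y
      have i1 : HasDerivAt (fun H => y + σ * H) (σ * 1) H :=
        ((hasDerivAt_id H).const_mul σ).const_add y
      have j3 := ((((hasDerivAt_fam s t _).comp H i3).sub_const (fam s t y)).const_mul σ).div_const 3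
      have j2 := ((((hasDerivAt_fam s t _).comp H i2).sub_const (fam s t y)).const_mul σ).div_const 2
      have j1 := (((hasDerivAt_fam s t _).comp H i1).sub_const (fam s t y)).const_mul σ
      have j0 := (hasDerivAt_id H).const_mul (wt s y)
      refine ((((j3.add j2).add j1).const_mul 19).sub j0).congr_deriv ?_
      linear_combination (19 * (wt s (y + 3 * (σ * H)) + wt s (y + 2 * (σ * H)) +
        wt s (y + σ * H))) * hσ
    have hDm : Monotone D := by
      refine monotone_of_deriv_nonneg (fun H => (hd H).differentiableAt) fun H => ?_
      rw [(hd H).deriv]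
      linarith [hrec (σ * H)]
    have := hDm hH
    simp only [D, mul_zero, add_zero, sub_self, zero_div] at this
    linarith
  rcases le_total y ((a + b) / 2) with hc | hc
  · have h1 := key 1 (by norm_num) ((b - a) / 6) (by linarith)
    have f3 := hF (show y + 3 * (1 * ((b - a) / 6)) ≤ b by linarith)
    have f2 := hF (show y + 2 * (1 * ((b - a) / 6)) ≤ b by linarith)
    have f1 := hF (show y + 1 * ((b - a) / 6) ≤ b by linarith)
    have f0 := hF hy.1
    linarith
  · have h1 := key (-1) (by norm_num) ((b - a) / 6) (by linarith)
    have f3 := hF (show a ≤ y + 3 * (-1 * ((b - a) / 6)) by linarith)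
    have f2 := hF (show a ≤ y + 2 * (-1 * ((b - a) / 6)) by linarith)
    have f1 := hF (show a ≤ y + -1 * ((b - a) / 6) by linarith)
    have f0 := hF hy.2
    linarith

theorem fam_sub_le_of_wt_le {s t x y C : ℝ} (hxy : x ≤ y) (h : ∀ u ∈ Icc x y, wt s u ≤ C) :
    fam s t y - fam s t x ≤ C * (y - x) := by
  have := (convex_Icc x y).image_sub_le_mul_sub_of_deriv_le (f := fam s t) (C := C)
    (fun u _ => (hasDerivAt_fam s t u).continuousAt.continuousWithinAt)
    (fun u _ => (hasDerivAt_fam s t u).differentiableAt.differentiableWithinAt)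
    (fun u hu => by rw [deriv_fam]; exact h u (interior_subset hu))
    x (left_mem_Icc.2 hxy) y (right_mem_Icc.2 hxy) hxy
  exact this

theorem slope_le {s t a b x y : ℝ} (hab : a < b) (hax : a ≤ x) (hxy : x ≤ y) (hyb : y ≤ b) :
    (fam s t y - fam s t x) * (b - a) ≤ 209 * (fam s t b - fam s t a) * (y - x) := by
  have hba : 0 < b - a := sub_pos.2 hab
  have := fam_sub_le_of_wt_le (t := t) (C := 209 * (fam s t b - fam s t a) / (b - a)) hxy
    fun u hu => (le_div_iff₀ hba).2 (wt_mul_le hab ⟨hax.trans hu.1, hu.2.trans hyb⟩)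
  rw [div_mul_eq_mul_div, le_div_iff₀ hba] at this
  exact this

/-- In general the cross-ratio grows by at most a universal factor. -/
theorem cratio_fam_le_mul {s t A z b c : ℝ} (hAz : A < z) (hzb : z < b) (hbc : b < c) :
    cratio (fam s t A) (fam s t z) (fam s t b) (fam s t c) ≤ 209 ^ 2 * cratio A z b c := by
  have hmF := strictMono_fam s t
  have h1 := slope_le (s := s) (t := t) (hAz.trans hzb) le_rfl hAz.le hzb.le
  have h2 := slope_le (s := s) (t := t) (hzb.trans hbc) hzb.le hbc.le le_rfl
  have hzA : fam s t A < fam s t z := hmF hAz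
  have hbz : fam s t z < fam s t b := hmF hzb
  have hcb : fam s t b < fam s t c := hmF hbc
  set A' := fam s t A
  set z' := fam s t z
  set b' := fam s t b
  set c' := fam s t c
  have p1 : 0 < b' - A' := by linarith
  have p4 : 0 < c' - z' := by linarith
  have q1 : 0 < b - A := by linarith
  have q4 : 0 < c - z := by linarith
  have p5 : 0 < z - A := by linarith
  have p6 : 0 < c' - b' := by linarith
  unfold cratio
  rw [← mul_div_assoc, div_le_div_iff₀ (by positivity) (by positivity)]
  have := mul_le_mul h1 h2 (by positivity) (by positivity)
  linarith

theorem wt_le_sq (s x : ℝ) : wt s x ≤ 80 * (x - s) ^ 2 := by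
  rw [wt_eq_sin]
  have hW := half_le_famW s
  have hpi := Real.pi_pos
  have h1 : 4 / famW s ≤ 8 := by rw [div_le_iff₀ (by linarith)]; linarith
  have h2 : Real.sin (Real.pi * (x - s)) ^ 2 ≤ 10 * (x - s) ^ 2 := by
    have a1 : Real.sin (Real.pi * (x - s)) ^ 2 ≤ (Real.pi * (x - s)) ^ 2 :=
      sq_le_sq.2 Real.abs_sin_le_abs
    have a2 : Real.pi ^ 2 ≤ 10 := by nlinarith [Real.pi_lt_d2]
    nlinarith [sq_nonneg (x - s)]
  have h3 : Real.sin (Real.pi * x) ^ 2 ≤ 1 := Real.sin_sq_le_one _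
  have h4 : 0 ≤ 4 / famW s := by apply div_nonneg <;> linarith
  rw [mul_pow]
  have h5 : Real.sin (Real.pi * x) ^ 2 * Real.sin (Real.pi * (x - s)) ^ 2 ≤ 10 * (x - s) ^ 2 := by
    nlinarith [sq_nonneg (Real.sin (Real.pi * (x - s)))]
  have h6 : 0 ≤ Real.sin (Real.pi * x) ^ 2 * Real.sin (Real.pi * (x - s)) ^ 2 := by positivity
  nlinarith

/-- Cubic upper bound at the critical point `s`. -/
theorem fam_sub_le_cube {s t u : ℝ} (hu : 0 ≤ u) :
    fam s t s - fam s t (s - u) ≤ 80 * u ^ 3 := by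
  have := fam_sub_le_of_wt_le (s := s) (t := t) (x := s - u) (y := s) (C := 80 * u ^ 2)
    (by linarith) fun v hv => (wt_le_sq s v).trans (by
      have : (v - s) ^ 2 ≤ u ^ 2 := by nlinarith [hv.1, hv.2]
      linarith)
  calc _ ≤ _ := this
    _ = _ := by ring

/-- Cubic lower bound at the critical point `s`. -/
theorem exists_cube_le_fam_sub {s : ℝ} (hs : s ∈ Ioo (0 : ℝ) 1) :
    ∃ κ > 0, ∀ t u : ℝ, 0 < u → u ≤ 1 → κ * u ^ 3 ≤ fam s t s - fam s t (s - u) := by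
  have hW := famW_pos s
  have hW2 := famW_le s
  have hpi := Real.pi_pos
  obtain ⟨hs0, hs1⟩ := hs
  set μ := min (Real.sin (Real.pi * (s / 2))) (Real.sin (Real.pi * s)) with hμ
  have hμ0 : 0 < μ := lt_min
    (Real.sin_pos_of_pos_of_lt_pi (by positivity) (by nlinarith))
    (Real.sin_pos_of_pos_of_lt_pi (by positivity) (by nlinarith))
  refine ⟨2 * μ ^ 2 * s ^ 2 / 209, by positivity, fun t u hu hu1 => ?_⟩
  set v := u * (s / 2) with hv
  have hv0 : 0 < v := by positivity
  have hvs : v ≤ s / 2 := by nlinarith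
  have hvu : v ≤ u := by nlinarith
  have h1 := wt_mul_le (s := s) (t := t) (a := s - u) (b := s) (y := s - v) (by linarith)
    ⟨by linarith, by linarith⟩
  have h2 : 2 * v ≤ Real.sin (Real.pi * v) := by
    have := Real.mul_le_sin (x := Real.pi * v) (by positivity) (by nlinarith)
    calc 2 * v = 2 / Real.pi * (Real.pi * v) := by field_simp
      _ ≤ _ := this
  have h3 : μ ≤ Real.sin (Real.pi * (s - v)) := by
    have hconc := strictConcaveOn_sin_Icc.concaveOn.min_le_of_mem_Icc
      (x := Real.pi * (s / 2)) (y := Real.pi * s) (z := Real.pi * (s - v))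
      ⟨by positivity, by nlinarith⟩ ⟨by positivity, by nlinarith⟩
      ⟨by nlinarith, by nlinarith⟩
    exact hconc
  have h4 : 8 * (μ * v) ^ 2 ≤ wt s (s - v) * 1 := by
    rw [wt_eq_sin, show s - v - s = -v by ring, mul_neg, Real.sin_neg, mul_neg, neg_sq, mul_one]
    have a1 : 2 ≤ 4 / famW s := by rw [le_div_iff₀ hW]; linarith
    have a2 : μ * (2 * v) ≤ Real.sin (Real.pi * (s - v)) * Real.sin (Real.pi * v) :=
      mul_le_mul h3 h2 (by positivity) (hμ0.le.trans h3)
    have a3 := pow_le_pow_left₀ (by positivity) a2 2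
    nlinarith [sq_nonneg (Real.sin (Real.pi * (s - v)) * Real.sin (Real.pi * v))]
  have h5 : s - (s - u) = u := by ring
  rw [h5] at h1
  have h6 : 8 * (μ * v) ^ 2 * u ≤ 209 * (fam s t s - fam s t (s - u)) := by nlinarith
  rw [div_mul_eq_mul_div, div_le_iff₀ (by norm_num)]
  have h7 : 8 * (μ * v) ^ 2 * u = 2 * μ ^ 2 * s ^ 2 * u ^ 3 := by rw [hv]; ring
  linarith

/-- The return map `F^q - p`. -/
def retMap (F : ℝ → ℝ) (q : ℕ) (p : ℤ) (x : ℝ) : ℝ := F^[q] x - p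

theorem DegOne.retMap {F : ℝ → ℝ} (h : DegOne F) (q : ℕ) (p : ℤ) : DegOne (retMap F q p) :=
  (h.iterate q).sub_int p

theorem IsRot.retMap {F φ : ℝ → ℝ} {ρ : ℝ} (h : IsRot F φ ρ) (q : ℕ) (p : ℤ) :
    IsRot (retMap F q p) φ (q * ρ - p) := h.iterate_sub q p

/-- The set of points near which `φ` is not constant. -/
def growthSet (φ : ℝ → ℝ) : Set ℝ := {x | ∀ a b, a < x → x < b → φ a < φ b}

theorem isClosed_growthSet (φ : ℝ → ℝ) : IsClosed (growthSet φ) := by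
  rw [← isOpen_compl_iff, isOpen_iff_mem_nhds]
  intro x hx
  simp only [growthSet, mem_compl_iff, mem_ofPred_eq, not_forall] at hx
  obtain ⟨a, b, hax, hxb, hab⟩ := hx
  filter_upwards [Ioo_mem_nhds hax hxb] with y hy
  exact fun h => hab (h a b hy.1 hy.2)

theorem mem_growthSet_iff {φ ψ : ℝ → ℝ} {c : ℝ} (hψ : StrictMono ψ) (hs : Function.Surjective ψ)
    (h : ∀ x, φ (ψ x) = φ x + c) (x : ℝ) : ψ x ∈ growthSet φ ↔ x ∈ growthSet φ := by
  constructor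
  · intro hx a b hax hxb
    have := hx (ψ a) (ψ b) (hψ hax) (hψ hxb)
    rw [h, h] at this
    linarith
  · intro hx a b hax hxb
    obtain ⟨a, rfl⟩ := hs a
    obtain ⟨b, rfl⟩ := hs b
    have := hx a b (hψ.lt_iff_lt.1 hax) (hψ.lt_iff_lt.1 hxb)
    rw [h, h]
    linarith

theorem IsRot.growthSet_nonempty {F φ : ℝ → ℝ} {ρ : ℝ} (h : IsRot F φ ρ) :
    (growthSet φ).Nonempty := by
  have hne : {x | φ x ≤ 0}.Nonempty := ⟨0, h.zero.le⟩
  have h1 : φ 1 = 1 := by simpa using h.int 1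
  have hbdd : BddAbove {x | φ x ≤ 0} := by
    refine ⟨1, fun x hx => ?_⟩
    by_contra hc
    have := h.mono (not_le.1 hc).le
    rw [h1] at this
    have hx' : φ x ≤ 0 := hx
    linarith
  refine ⟨sSup {x | φ x ≤ 0}, fun a b ha hb => ?_⟩
  obtain ⟨y, hy, hay⟩ := exists_lt_of_lt_csSup hne ha
  have hb' : 0 < φ b := by
    by_contra hc
    exact absurd (le_csSup hbdd (show b ∈ {x | φ x ≤ 0} from not_lt.1 hc)) (not_le.2 hb)
  exact ((h.mono hay.le).trans hy).trans_lt hb'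

theorem IsRot.add_int_mem_growthSet {F φ : ℝ → ℝ} {ρ : ℝ} (h : IsRot F φ ρ) (m : ℤ) (x : ℝ) :
    x + m ∈ growthSet φ ↔ x ∈ growthSet φ :=
  mem_growthSet_iff (ψ := fun x => x + m) (fun _ _ h => by simpa using h)
    (fun y => ⟨y - m, by ring⟩) (fun x => h.add_int x m) x

/-- The point of the growth set with the shortest step. -/
theorem exists_min_step {Φ φ : ℝ → ℝ} {δ : ℝ} (hΦ : DegOne Φ) (h : IsRot Φ φ δ) (hδ : 0 < δ)
    {N : ℕ} (hN : 0 < N) (hNδ : N * δ < 1) :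
    ∃ x ∈ growthSet φ, x ∈ Icc (0 : ℝ) 1 ∧ 0 < Φ x - x ∧ Φ x - x < 1 / N ∧
      ∀ y ∈ growthSet φ, Φ x - x ≤ Φ y - y := by
  have hK : IsCompact (growthSet φ ∩ Icc 0 1) := isCompact_Icc.inter_left (isClosed_growthSet φ)
  have hred : ∀ y ∈ growthSet φ, ∃ y' ∈ growthSet φ ∩ Icc 0 1, Φ y' - y' = Φ y - y := by
    intro y hy
    refine ⟨Int.fract y, ⟨?_, Int.fract_nonneg y, (Int.fract_lt_one y).le⟩, ?_⟩
    · rw [← h.add_int_mem_growthSet ⌊y⌋, Int.fract_add_floor]; exact hy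
    · have := hΦ.add_int (Int.fract y) ⌊y⌋
      rw [Int.fract_add_floor] at this
      rw [this]
      have := Int.fract_add_floor y
      linarith
  obtain ⟨y₀, hy₀⟩ := h.growthSet_nonempty
  have hne : (growthSet φ ∩ Icc 0 1).Nonempty := by
    obtain ⟨y', hy', -⟩ := hred y₀ hy₀
    exact ⟨y', hy'⟩
  obtain ⟨x, hx, hmin⟩ := hK.exists_isMinOn hne
    ((hΦ.continuous.sub continuous_id).continuousOn (s := growthSet φ ∩ Icc 0 1))
  have hmin' : ∀ y ∈ growthSet φ, Φ x - x ≤ Φ y - y := by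
    intro y hy
    obtain ⟨y', hy', e⟩ := hred y hy
    rw [← e]
    exact hmin hy'
  refine ⟨x, hx.1, hx.2, ?_, ?_, hmin'⟩
  · have : x < Φ x := h.lt_of_lt (by rw [h.semi]; linarith)
    linarith
  · obtain ⟨i, -, hi⟩ := h.exists_short_step hN hNδ x
    have hmem : ∀ i : ℕ, Φ^[i] x ∈ growthSet φ := by
      intro i
      induction i with
      | zero => exact hx.1
      | succ i ih =>
        rw [Function.iterate_succ_apply']
        exact (mem_growthSet_iff hΦ.mono hΦ.surj h.semi _).2 ih
    rw [Function.iterate_succ_apply'] at hi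
    exact (hmin' _ (hmem i)).trans_lt hi

theorem hasStrictDerivAt_fam (s t x : ℝ) : HasStrictDerivAt (fam s t) (wt s x) x := by
  have := (contDiff_fam s t (n := 1)).contDiffAt.hasStrictDerivAt (x := x) (by norm_num)
  rwa [deriv_fam] at this

theorem exists_hasStrictDerivAt_iterate {t x : ℝ} {i : ℕ}
    (h : ∀ l < i, ∀ m : ℤ, (fam 0 t)^[l] x ≠ m) :
    ∃ β > 0, HasStrictDerivAt (fam 0 t)^[i] β x := by
  induction i with
  | zero => exact ⟨1, one_pos, by simpa using hasStrictDerivAt_id x⟩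
  | succ i ih =>
    obtain ⟨β, hβ, hd⟩ := ih fun l hl => h l (by omega)
    have hw : 0 < wt 0 ((fam 0 t)^[i] x) := by
      refine lt_of_le_of_ne (wt_nonneg _ _) fun h0 => ?_
      rcases (wt_eq_zero_iff _ _).1 h0.symm with ⟨m, hm⟩ | ⟨m, hm⟩
      · exact h i (by omega) m hm
      · exact h i (by omega) m (by rw [hm, zero_add])
    refine ⟨_, mul_pos hw hβ, ?_⟩
    rw [Function.iterate_succ']
    exact (hasStrictDerivAt_fam 0 t _).comp x hd

/-- Symmetries commuting with the dynamics, moving a given point to a prescribed position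
with non-zero derivative. -/
theorem exists_transport {ρ t : ℝ} (hρ : WellApproxBelow ρ) {φ : ℝ → ℝ}
    (h : IsRot (fam 0 t) φ ρ) (x : ℝ) {l r : ℝ} (hlr : l < r) :
    ∃ (ψ : ℝ → ℝ) (β c : ℝ), DegOne ψ ∧ (∀ y, ψ (fam 0 t y) = fam 0 t (ψ y)) ∧
      (∀ y, φ (ψ y) = φ y + c) ∧ l < φ x + c ∧ φ x + c < r ∧ 0 < β ∧ HasStrictDerivAt ψ β x := by
  have hF := degOne_fam 0 t
  by_cases hx : ∀ (i : ℕ) (m : ℤ), (fam 0 t)^[i] x ≠ m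
  · obtain ⟨i, k, h1, h2⟩ := hρ.exists_between (sub_lt_sub_right hlr (φ x))
    obtain ⟨β, hβ, hd⟩ := exists_hasStrictDerivAt_iterate (i := i) fun l _ => hx l
    refine ⟨fun y => (fam 0 t)^[i] y + k, β, i * ρ + k, ?_, fun y => ?_, fun y => ?_,
      by linarith, by linarith, hβ, hd.add_const _⟩
    · simpa using (hF.iterate i).sub_int (-k)
    · change (fam 0 t)^[i] (fam 0 t y) + (k : ℝ) = _
      rw [hF.add_int, ← Function.iterate_succ_apply, Function.iterate_succ_apply']
    · rw [h.orbit]; ring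
  · push Not at hx
    obtain ⟨i₀, m, hm⟩ := hx
    obtain ⟨i, k, h1, h2⟩ := hρ.exists_between_neg (sub_lt_sub_right hlr (φ x))
    have hFi := hF.iterate i
    let e : ℝ ≃o ℝ := hFi.mono.orderIsoOfSurjective _ hFi.surj
    have he : ∀ y, (fam 0 t)^[i] (e.symm y) = y := fun y => e.apply_symm_apply y
    have hcomm : ∀ y, e.symm (fam 0 t y) = fam 0 t (e.symm y) := by
      intro y
      apply hFi.mono.injective
      rw [he, ← Function.iterate_succ_apply, Function.iterate_succ_apply', he]
    have hadd : ∀ y, e.symm (y + 1) = e.symm y + 1 := by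
      intro y
      apply hFi.mono.injective
      rw [he, hFi.add_one, he]
    have hφ : ∀ y, φ (e.symm y) = φ y - i * ρ := by
      intro y
      have := h.iter i (e.symm y)
      rw [he] at this
      linarith
    have hdeg : DegOne fun y => e.symm y := ⟨e.symm.strictMono, e.symm.surjective, hadd⟩
    obtain ⟨β, hβ, hd⟩ := exists_hasStrictDerivAt_iterate (t := t) (x := e.symm x) (i := i) <| by
      intro l hl m' hm'
      obtain ⟨d, hd⟩ : ∃ d, i = d + l := ⟨i - l, by omega⟩
      have e1 : (fam 0 t)^[i₀ + d] m' = m := by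
        rw [Function.iterate_add_apply, ← hm', ← Function.iterate_add_apply (fam 0 t) d l, ← hd, he, hm]
      have e2 := h.iter (i₀ + d) m'
      rw [e1, h.int, h.int] at e2
      have hpos : i₀ + d ≠ 0 := by omega
      have := ((hρ.irrational.natCast_mul hpos).intCast_add m')
      exact this ⟨m, by push_cast; exact_mod_cast e2⟩
    have hd' : HasStrictDerivAt (fun y => e.symm y) β⁻¹ x :=
      HasStrictDerivAt.of_local_left_inverse e.symm.continuous.continuousAt hd hβ.ne'
        (Eventually.of_forall he)
    refine ⟨fun y => e.symm y + k, β⁻¹, -(i * ρ) + k, ?_, fun y => ?_, fun y => ?_,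
      by linarith, by linarith, inv_pos.2 hβ, hd'.add_const _⟩
    · simpa using hdeg.sub_int (-k)
    · change e.symm (fam 0 t y) + (k : ℝ) = _
      rw [hF.add_int, hcomm]
    · rw [h.add_int, hφ]; ring

theorem exists_affine_bound {ψ : ℝ → ℝ} {β x : ℝ} (hd : HasStrictDerivAt ψ β x) (hβ : 0 < β) :
    ∃ η > 0, ∀ u v, |u - x| < η → |v - x| < η → v ≤ u →
      9 / 10 * β * (u - v) ≤ ψ u - ψ v ∧ ψ u - ψ v ≤ 11 / 10 * β * (u - v) := by
  have h := (hd.hasStrictFDerivAt.isLittleO.def (c := β / 10) (by positivity))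
  obtain ⟨η, hη, hb⟩ := Metric.eventually_nhds_iff.1 h
  refine ⟨η, hη, fun u v hu hv huv => ?_⟩
  have := hb (y := (u, v)) (by
    rw [Prod.dist_eq]
    exact max_lt (by simpa [Real.dist_eq] using hu) (by simpa [Real.dist_eq] using hv))
  simp only [ContinuousLinearMap.toSpanSingleton_apply, smul_eq_mul, Real.norm_eq_abs,
    abs_of_nonneg (sub_nonneg.2 huv)] at this
  obtain ⟨h1, h2⟩ := abs_le.1 this
  constructor <;> nlinarith

theorem retMap_semiconj {F G ψ : ℝ → ℝ} (hψ : DegOne ψ) (h : ∀ y, ψ (F y) = G (ψ y)) (q : ℕ)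
    (p : ℤ) (y : ℝ) : ψ (retMap F q p y) = retMap G q p (ψ y) := by
  have h1 : ψ (F^[q] y) = G^[q] (ψ y) := (Function.Semiconj.iterate_right h q) y
  have h2 := hψ.add_int (F^[q] y) (-p)
  push_cast at h2
  rw [retMap, retMap, ← h1, sub_eq_add_neg, h2, sub_eq_add_neg]

/-- Preimages along an orbit in the growth set are at least as far as the shortest step allows. -/
theorem le_sub_of_iterate {Φ φ : ℝ → ℝ} {δ u : ℝ} (hΦ : DegOne Φ) (h : IsRot Φ φ δ)
    (hu : ∀ y ∈ growthSet φ, u ≤ Φ y - y) (M : ℕ) {x : ℝ} (hx : Φ^[M] x ∈ growthSet φ) :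
    M * u ≤ Φ^[M] x - x ∧ x ∈ growthSet φ := by
  induction M generalizing x with
  | zero => simpa using hx
  | succ M ih =>
    rw [Function.iterate_succ_apply] at hx ⊢
    obtain ⟨h1, h2⟩ := ih hx
    have h3 := (mem_growthSet_iff hΦ.mono hΦ.surj h.semi _).1 h2
    have := hu x h3
    refine ⟨?_, h3⟩
    push_cast
    linarith

theorem DegOne.eventually_of_iterate {Φ : ℝ → ℝ} (h : DegOne Φ) (N : ℕ) {P : ℝ → Prop} {Y : ℝ}
    (hP : ∀ᶠ z in 𝓝 Y, P z) : ∀ᶠ y in 𝓝 (Φ^[N] Y), ∃ z, Φ^[N] z = y ∧ P z := by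
  have hN := h.iterate N
  let e : ℝ ≃o ℝ := hN.mono.orderIsoOfSurjective _ hN.surj
  have he : e.symm (Φ^[N] Y) = Y := e.symm_apply_apply Y
  have := e.symm.continuous.tendsto (Φ^[N] Y)
  rw [he] at this
  filter_upwards [this.eventually hP] with y hy
  exact ⟨e.symm y, e.apply_symm_apply y, hy⟩

/-- The asymmetric geometry at `y` incompatible with a critical point there. -/
def LongApproach (F : ℝ → ℝ) (ρ : ℝ) (n : ℕ) (y : ℝ) : Prop :=
  ∃ (ε : ℝ) (q : ℕ) (p : ℤ) (M : ℕ) (Y : ℝ), 0 < ε ∧ 1 ≤ q ∧ 0 < q * ρ - p ∧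
    (q * ρ - p) * q < ε ∧ (M + 3) * ε < 1 / 2 ∧
    (∀ i : ℕ, 0 < i → i < q → ∀ k : ℤ, 1 - ε ≤ |i * ρ - k| * q) ∧
    (retMap F q p)^[M + 1] Y = y ∧
    y - (retMap F q p)^[M] Y ≤ 2 * (retMap F q p y - y) ∧
    n * (y - (retMap F q p)^[M] Y) ≤ y - Y

theorem exists_longApproach {ρ t : ℝ} (hρ : WellApproxBelow ρ) {φ : ℝ → ℝ}
    (h : IsRot (fam 0 t) φ ρ) (n : ℕ) {l r : ℝ} (hlr : l < r) :
    ∃ y₀ ∈ growthSet φ, l < φ y₀ ∧ φ y₀ < r ∧ ∀ᶠ y in 𝓝 y₀, LongApproach (fam 0 t) ρ n y := by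
  have hF := degOne_fam 0 t
  set M := 2 * n + 1 with hM
  let ε : ℕ → ℝ := fun m => 1 / ((2 * M + 7) * (m + 1))
  have hε : ∀ m, 0 < ε m := fun m => by simp only [ε]; positivity
  have hMε : ∀ m, (M + 3) * ε m < 1 / 2 := by
    intro m
    have h3 : ε m * ((2 * M + 7) * (m + 1)) = 1 := by
      simp only [ε]; rw [one_div_mul_cancel (by positivity)]
    have h4 : 0 ≤ ε m * (2 * M + 7) * m := by have := hε m; positivity
    nlinarith [hε m]
  choose q p hq hδ hδq hsep using fun m => hρ.exists_pair (hε m)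
  have hNδ : ∀ m : ℕ, ((m + 1 : ℕ) : ℝ) * (q m * ρ - p m) < 1 := by
    intro m
    have h1 : (1 : ℝ) ≤ q m := by exact_mod_cast hq m
    have h2 : q m * ρ - p m < ε m := lt_of_le_of_lt (by nlinarith [hδ m]) (hδq m)
    have h3 : ε m * ((2 * M + 7) * (m + 1)) = 1 := by
      simp only [ε]; rw [one_div_mul_cancel (by positivity)]
    push_cast
    have h4 : (0 : ℝ) ≤ m := by positivity
    have h5 : (0 : ℝ) ≤ M := by positivity
    have h6 : (q m * ρ - p m) * (m + 1) < ε m * (m + 1) := by nlinarith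
    have h7 : ε m * (m + 1) ≤ ε m * ((2 * M + 7) * (m + 1)) := by
      apply mul_le_mul_of_nonneg_left _ (hε m).le
      nlinarith
    linarith
  choose x hxK hx01 hu0 hu1 hmin using fun m =>
    exists_min_step (hF.retMap (q m) (p m)) (h.retMap (q m) (p m)) (hδ m) (Nat.succ_pos m) (hNδ m)
  obtain ⟨x', -, θ, hθ, hlim⟩ := isCompact_Icc.tendsto_subseq hx01
  obtain ⟨ψ, β, c, hψ, hcomm, hφψ, hl, hr, hβ, hd⟩ := exists_transport hρ h x' hlr
  obtain ⟨η₁, hη₁, hlin⟩ := exists_affine_bound hd hβ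
  obtain ⟨η₂, hη₂, hpos⟩ := Metric.eventually_nhds_iff.1
    (((h.continuous hρ).add continuous_const).continuousAt.eventually_mem
      (Ioo_mem_nhds hl hr))
  obtain ⟨η, hη, hηη₁, hηη₂⟩ : ∃ η > 0, η ≤ η₁ ∧ η ≤ η₂ :=
    ⟨min η₁ η₂, lt_min hη₁ hη₂, min_le_left _ _, min_le_right _ _⟩
  have hev : ∀ᶠ k : ℕ in atTop, ((M : ℝ) + 1) * (1 / ((k : ℝ) + 1)) < η / 2 := by
    have := tendsto_one_div_add_atTop_nhds_zero_nat (𝕜 := ℝ).const_mul ((M : ℝ) + 1)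
    rw [mul_zero] at this
    exact this.eventually_lt_const (by positivity)
  obtain ⟨k, hk1, hk2⟩ := ((hθ.tendsto_atTop.eventually hev).and
    (Metric.tendsto_nhds.1 hlim (η / 2) (by positivity))).exists
  simp only [Function.comp_apply, Real.dist_eq] at hk2
  set m := θ k
  have hΦ := hF.retMap (q m) (p m)
  have hΦrot := h.retMap (q m) (p m)
  set Φ := retMap (fam 0 t) (q m) (p m)
  have hψΦ : ∀ y, ψ (Φ y) = Φ (ψ y) := retMap_semiconj hψ hcomm _ _
  set u := Φ (x m) - x m with hu
  have hupos : 0 < u := hu0 m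
  have hM0 : (0 : ℝ) ≤ M := by positivity
  have husmall : ((M : ℝ) + 1) * u < η / 2 := by
    refine lt_of_le_of_lt (mul_le_mul_of_nonneg_left ?_ (by positivity)) hk1
    have := hu1 m
    push_cast at this
    exact this.le
  have hMu : (M : ℝ) * u < η / 2 := by nlinarith
  have h2u : 2 * u < η / 2 := by
    have : (1 : ℝ) ≤ M := by rw [hM]; push_cast; linarith [show (0 : ℝ) ≤ n by positivity]
    nlinarith
  obtain ⟨hk3, hk4⟩ := abs_lt.1 hk2
  have hX0 : Φ (x m) = x m + u := by rw [hu]; ring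
  obtain ⟨Xb, hXb⟩ := (hΦ.iterate M).surj (x m)
  obtain ⟨hfar, -⟩ := le_sub_of_iterate hΦ hΦrot (hmin m) M (x := Xb) (by rw [hXb]; exact hxK m)
  rw [hXb] at hfar
  have hnext : x m + 2 * u ≤ Φ (Φ (x m)) := by
    have := hmin m _ ((mem_growthSet_iff hΦ.mono hΦ.surj hΦrot.semi _).2 (hxK m))
    change u ≤ Φ (Φ (x m)) - Φ (x m) at this
    linarith
  have hiter : ∀ N : ℕ, Φ^[N] (ψ Xb) = ψ (Φ^[N] Xb) := fun N =>
    ((Function.Semiconj.iterate_right hψΦ N) Xb).symm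
  have hit : Φ^[M + 1] (ψ Xb) = ψ (x m + u) := by
    rw [hiter, Function.iterate_succ_apply', hXb, hX0]
  have hnear : ∀ v, -(η / 2) < v → v < η / 2 → |x m + v - x'| < η₁ := fun v h1 h2 =>
    (abs_lt.2 ⟨by linarith, by linarith⟩ : _ < η).trans_le hηη₁
  have hb0 := (hlin (x m + u) (x m + 0) (hnear _ (by linarith) (by linarith))
    (hnear _ (by linarith) (by linarith)) (by linarith)).2
  have hb1 := (hlin (x m + 2 * u) (x m + u) (hnear _ (by linarith) (by linarith))
    (hnear _ (by linarith) (by linarith)) (by linarith)).1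
  have hb2 := (hlin (x m + u) (x m + -(M * u)) (hnear _ (by linarith) (by linarith))
    (hnear _ (by linarith) (by nlinarith)) (by nlinarith)).1
  rw [add_zero] at hb0
  have hm1 : ψ (x m + 2 * u) ≤ Φ (ψ (x m + u)) := by
    rw [← hψΦ, ← hX0]
    exact hψ.mono.monotone hnext
  have hm2 : ψ Xb ≤ ψ (x m + -(M * u)) := hψ.mono.monotone (by linarith)
  have hβu : 0 < β * u := mul_pos hβ hupos
  have hcond1 : Φ^[M + 1] (ψ Xb) - Φ^[M] (ψ Xb) <
      2 * (Φ (Φ^[M + 1] (ψ Xb)) - Φ^[M + 1] (ψ Xb)) := by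
    rw [hit, hiter, hXb]
    nlinarith
  have hcond2 : n * (Φ^[M + 1] (ψ Xb) - Φ^[M] (ψ Xb)) < Φ^[M + 1] (ψ Xb) - ψ Xb := by
    rw [hit, hiter, hXb]
    have hn : (0 : ℝ) ≤ n := by positivity
    have h1 : n * (ψ (x m + u) - ψ (x m)) ≤ n * (11 / 10 * β * (x m + u - x m)) :=
      mul_le_mul_of_nonneg_left (by simpa using hb0) hn
    have h2 : (M : ℝ) = 2 * n + 1 := by rw [hM]; push_cast; ring
    rw [h2] at hb2 hm2
    nlinarith [mul_nonneg hn hβu.le]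
  have hc : ∀ N, Continuous Φ^[N] := fun N => (hΦ.iterate N).continuous
  have hopen : ∀ᶠ z in 𝓝 (ψ Xb), Φ^[M + 1] z - Φ^[M] z < 2 * (Φ (Φ^[M + 1] z) - Φ^[M + 1] z) ∧
      n * (Φ^[M + 1] z - Φ^[M] z) < Φ^[M + 1] z - z :=
    (((hc _).sub (hc _)).continuousAt.eventually_lt
      (continuous_const.mul ((hΦ.continuous.comp (hc _)).sub (hc _))).continuousAt hcond1).and
    ((continuous_const.mul ((hc _).sub (hc _))).continuousAt.eventually_lt
      ((hc _).sub continuous_id).continuousAt hcond2)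
  have hposm := hpos (y := x m + u) (by
    rw [Real.dist_eq]
    exact (abs_lt.2 ⟨by linarith, by linarith⟩ : _ < η).trans_le hηη₂)
  rw [Pi.add_apply, ← hφψ] at hposm
  refine ⟨ψ (x m + u), ?_, hposm.1, hposm.2, ?_⟩
  · rw [← hX0, mem_growthSet_iff hψ.mono hψ.surj hφψ,
      mem_growthSet_iff hΦ.mono hΦ.surj hΦrot.semi]
    exact hxK m
  · rw [← hit]
    filter_upwards [hΦ.eventually_of_iterate (M + 1) hopen] with y hy
    obtain ⟨z, rfl, hz1, hz2⟩ := hy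
    exact ⟨ε m, q m, p m, M, z, hε m, hq m, hδ m, hδq m, hMε m, hsep m, rfl, hz1.le, hz2.le⟩

theorem exists_generic_position {ρ t : ℝ} (hρ : WellApproxBelow ρ) {φ : ℝ → ℝ}
    (h : IsRot (fam 0 t) φ ρ) :
    ∃ α ∈ Ioo (0 : ℝ) 1, ∀ y, φ y = α → ∀ n, LongApproach (fam 0 t) ρ n y := by
  let U : ℕ → Set ℝ := fun n => interior {α | ∀ y, φ y = α → LongApproach (fam 0 t) ρ n y}
  have hU : ∀ n, Dense (U n) := by
    intro n
    rw [dense_iff_inter_open]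
    intro V hV hVne
    obtain ⟨v, hv⟩ := hVne
    obtain ⟨l, r, hlv, hlr⟩ := mem_nhds_iff_exists_Ioo_subset.1 (hV.mem_nhds hv)
    obtain ⟨y₀, hy₀, hl, hr, hev⟩ := exists_longApproach hρ h n (hlv.1.trans hlv.2)
    obtain ⟨a, b, hab, hsub⟩ := mem_nhds_iff_exists_Ioo_subset.1 hev
    have hφab := hy₀ a b hab.1 hab.2
    have hlb : l < φ b := hl.trans_le (h.mono hab.2.le)
    have har : φ a < r := (h.mono hab.1.le).trans_lt hr
    obtain ⟨α, hα1, hα2⟩ := exists_between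
      (show max (φ a) l < min (φ b) r from
        max_lt (lt_min hφab har) (lt_min hlb (hlv.1.trans hlv.2)))
    rw [max_lt_iff] at hα1
    rw [lt_min_iff] at hα2
    refine ⟨α, hlr ⟨hα1.2, hα2.2⟩, mem_interior_iff_mem_nhds.2 ?_⟩
    filter_upwards [Ioo_mem_nhds hα1.1 hα2.1] with α' hα' y hy
    exact hsub ⟨h.lt_of_lt (hy ▸ hα'.1), h.lt_of_lt (hy ▸ hα'.2)⟩
  have hd := dense_iInter_of_isOpen (fun n => isOpen_interior) hU
  obtain ⟨α, hα, hαU⟩ := hd.inter_open_nonempty _ isOpen_Ioo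
    (⟨1 / 2, by norm_num, by norm_num⟩ : (Ioo (0 : ℝ) 1).Nonempty)
  exact ⟨α, hα, fun y hy n => interior_subset (mem_iInter.1 hαU n) y hy⟩

/-- A nonnegative sequence which increases at most once, by a factor `K`. -/
theorem le_mul_of_step_le {R : ℕ → ℝ} {K : ℝ} (hK : 1 ≤ K) {bad : ℕ → Prop} {N : ℕ}
    (h0 : 0 ≤ R 0) (hgood : ∀ j < N, ¬ bad j → R (j + 1) ≤ R j)
    (hall : ∀ j < N, R (j + 1) ≤ K * R j)
    (huniq : ∀ i j, i < j → j < N → bad i → bad j → False) : R N ≤ K * R 0 := by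
  have key : ∀ n ≤ N, R n ≤ K * R 0 ∧ ((∀ j < n, ¬ bad j) → R n ≤ R 0) := by
    intro n
    induction n with
    | zero => exact fun _ => ⟨le_mul_of_one_le_left h0 hK, fun _ => le_rfl⟩
    | succ n ih =>
      intro hn
      obtain ⟨h1, h2⟩ := ih (by omega)
      by_cases hb : bad n
      · have h3 := h2 fun j hj hbj => huniq j n hj (by omega) hbj hb
        refine ⟨(hall n (by omega)).trans (mul_le_mul_of_nonneg_left h3 (by linarith)), fun h => ?_⟩
        exact absurd hb (h n (by omega))
      · have h3 := hgood n (by omega) hb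
        exact ⟨h3.trans h1, fun h => h3.trans (h2 fun j hj => h j (by omega))⟩
  exact (key N le_rfl).1

theorem cratio_nonneg {A z b c : ℝ} (hAz : A < z) (hzb : z < b) (hbc : b < c) :
    0 ≤ cratio A z b c :=
  div_nonneg (mul_nonneg (by linarith) (by linarith)) (mul_nonneg (by linarith) (by linarith))

theorem cratio_le_div {A z b c : ℝ} (hAz : A < z) (hzb : z < b) (hbc : b < c) :
    cratio A z b c ≤ (c - b) / (c - z) := by
  rw [cratio, mul_div_mul_comm]
  exact mul_le_of_le_one_left (div_nonneg (by linarith) (by linarith))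
    ((div_le_one (by linarith)).2 (by linarith))

theorem le_cratio {s x v L c' a : ℝ} (hc : 0 < c') (hc1 : c' ≤ 1) (hL : 1 ≤ L) (ha : 0 < a)
    (hx : s - L * a < x) (hxs : x < s) (hv : s < v) (hstep : c' * a ≤ v - s) :
    c' ≤ 4 * L * cratio (s - 2 * L * a) x s v := by
  have hLa : 0 < L * a := by positivity
  rw [cratio, mul_div_assoc', le_div_iff₀ (mul_pos (by linarith) (by linarith))]
  have h1 : L * a ≤ x - (s - 2 * L * a) := by linarith
  have h2 : c' * (v - x) ≤ 2 * L * (v - s) := by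
    have h3 : c' * (s - x) ≤ c' * (L * a) := mul_le_mul_of_nonneg_left (by linarith) hc.le
    have h4 : L * (c' * a) ≤ L * (v - s) := mul_le_mul_of_nonneg_left hstep (by linarith)
    have h5 : c' * (v - s) ≤ L * (v - s) := mul_le_mul_of_nonneg_right (by linarith) (by linarith)
    linarith
  have h3 := mul_le_mul_of_nonneg_left h2 (show 0 ≤ 2 * (L * a) by positivity)
  have h4 := mul_le_mul_of_nonneg_right h1 (show 0 ≤ 4 * L * (v - s) from
    mul_nonneg (by linarith) (by linarith))
  linarith

/-- Two iterates of a short interval cannot visit the same point. -/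
theorem IsRot.not_revisit {G φ : ℝ → ℝ} {ρ : ℝ} (hG : IsRot G φ ρ) {ε δ L : ℝ} {q : ℕ}
    (hsep : ∀ i : ℕ, 0 < i → i < q → ∀ k : ℤ, 1 - ε ≤ |i * ρ - k| * q)
    (hδq : δ * q < ε) (hL0 : 0 ≤ L) (hL : (L + 1) * ε < 1) {A c w w' : ℝ}
    (hA : φ c - φ A ≤ L * δ) (hw : w ∈ Icc A c) (hw' : w' ∈ Icc A c) {i j : ℕ} (hij : i < j)
    (hjq : j < i + q) {k : ℤ} (h : G^[j] w' = G^[i] w + k) : False := by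
  have e := congrArg φ h
  rw [hG.iter, hG.orbit] at e
  have h1 := hsep (j - i) (by omega) (by omega) k
  rw [Nat.cast_sub hij.le] at h1
  have h2 : |((j : ℝ) - i) * ρ - k| ≤ L * δ := by
    rw [abs_le]
    have := hG.mono hw.1
    have := hG.mono hw.2
    have := hG.mono hw'.1
    have := hG.mono hw'.2
    constructor <;> linarith
  have h3 := mul_le_mul_of_nonneg_right h2 (Nat.cast_nonneg (α := ℝ) q)
  nlinarith [mul_le_mul_of_nonneg_left hδq.le hL0]

/-- Total distortion of the cross-ratio along an orbit visiting the critical set at most once. -/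
theorem cratio_iterate_le {ρ s t : ℝ} {φ : ℝ → ℝ} (hG : IsRot (fam s t) φ ρ) {ε δ L : ℝ} {q : ℕ}
    (hq : 1 ≤ q) (hsep : ∀ i : ℕ, 0 < i → i < q → ∀ k : ℤ, 1 - ε ≤ |i * ρ - k| * q)
    (hδq : δ * q < ε) (hL0 : 0 ≤ L) (hL : (L + 1) * ε < 1) {A z b : ℝ}
    (hA : φ s - φ A ≤ L * δ) (hAz : A < z) (hzb : z < b) (hbs : b < s) :
    cratio ((fam s t)^[q] A) ((fam s t)^[q] z) ((fam s t)^[q] b) ((fam s t)^[q] s) ≤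
      209 ^ 2 * cratio (fam s t A) (fam s t z) (fam s t b) (fam s t s) := by
  have hF := degOne_fam s t
  let R : ℕ → ℝ := fun j => cratio ((fam s t)^[j + 1] A) ((fam s t)^[j + 1] z)
    ((fam s t)^[j + 1] b) ((fam s t)^[j + 1] s)
  have hmono : ∀ j, StrictMono (fam s t)^[j] := fun j => (hF.iterate j).mono
  have hvisit : ∀ j, ¬ Disjoint (Icc ((fam s t)^[j] A) ((fam s t)^[j] s)) (critSet s) →
      ∃ w ∈ Icc A s, (fam s t)^[j] w ∈ critSet s := by
    intro j hj
    obtain ⟨v, hv, hvc⟩ := not_disjoint_iff.1 hj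
    obtain ⟨w, rfl⟩ := (hF.iterate j).surj v
    exact ⟨w, ⟨(hmono j).le_iff_le.1 hv.1, (hmono j).le_iff_le.1 hv.2⟩, hvc⟩
  have hmain : R (q - 1) ≤ 209 ^ 2 * R 0 := by
    refine le_mul_of_step_le (N := q - 1) (bad := fun j => ¬ Disjoint
      (Icc ((fam s t)^[j + 1] A) ((fam s t)^[j + 1] s)) (critSet s)) (by norm_num)
      (cratio_nonneg (hmono _ hAz) (hmono _ hzb) (hmono _ hbs)) ?_ ?_ ?_
    · intro j _ hj
      simp only [R, Function.iterate_succ_apply' _ (j + 1)]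
      exact cratio_fam_le (hmono _ hAz) (hmono _ hzb) (hmono _ hbs) (not_not.1 hj)
    · intro j _
      simp only [R, Function.iterate_succ_apply' _ (j + 1)]
      exact cratio_fam_le_mul (hmono _ hAz) (hmono _ hzb) (hmono _ hbs)
    · intro i j hij hj hbi hbj
      have hno : ∀ j, j + 1 < q → ∀ w ∈ Icc A s, ∀ m : ℤ, (fam s t)^[j + 1] w ≠ s + m :=
        fun j hj w hw m hm => hG.not_revisit hsep hδq hL0 hL hA
          (w := s) ⟨by linarith, le_rfl⟩ hw (i := 0) (Nat.succ_pos j) (by omega) hm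
      obtain ⟨w, hw, hwc⟩ := hvisit _ hbi
      obtain ⟨w', hw', hwc'⟩ := hvisit _ hbj
      rcases hwc with ⟨m, hm⟩ | ⟨m, hm⟩
      · rcases hwc' with ⟨m', hm'⟩ | ⟨m', hm'⟩
        · exact hG.not_revisit hsep hδq hL0 hL hA hw hw' (i := i + 1) (j := j + 1)
            (by omega) (by omega) (k := m' - m) (by rw [hm, hm']; push_cast; ring)
        · exact hno j (by omega) w' hw' m' hm'
      · exact hno i (by omega) w hw m hm
  simpa only [R, Nat.sub_add_cancel hq, zero_add, Function.iterate_one] using hmain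

/-- A critical point `s` forbids a long sequence of steps ending in a step which is not short. -/
theorem exists_step_bound {ρ s t : ℝ} (hs : s ∈ Ioo (0 : ℝ) 1) {φ : ℝ → ℝ}
    (hG : IsRot (fam s t) φ ρ) {c' : ℝ} (hc' : 0 < c') (hc1 : c' ≤ 1) :
    ∃ Λ : ℝ, 1 < Λ ∧ ∀ (ε : ℝ) (q : ℕ) (p : ℤ) (M : ℕ) (Y : ℝ), 0 < ε → 1 ≤ q → 0 < q * ρ - p →
      (q * ρ - p) * q < ε → (M + 3) * ε < 1 / 2 →
      (∀ i : ℕ, 0 < i → i < q → ∀ k : ℤ, 1 - ε ≤ |i * ρ - k| * q) →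
      (retMap (fam s t) q p)^[M + 1] Y = s →
      c' * (s - (retMap (fam s t) q p)^[M] Y) ≤ retMap (fam s t) q p s - s →
      s - Y < 2 * Λ * (s - (retMap (fam s t) q p)^[M] Y) := by
  obtain ⟨κ, hκ, hcube⟩ := exists_cube_le_fam_sub hs
  refine ⟨2 + 4 * 209 ^ 2 * 80 / (c' * κ), by
    have : 0 < 4 * 209 ^ 2 * 80 / (c' * κ) := by positivity
    linarith, ?_⟩
  have hΛ' : 4 * 209 ^ 2 * 80 < (c' * κ) * (2 + 4 * 209 ^ 2 * 80 / (c' * κ)) := by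
    rw [mul_add, mul_div_cancel₀ _ (by positivity)]
    nlinarith [mul_pos hc' hκ]
  have hΛ1 : 1 < 2 + 4 * 209 ^ 2 * 80 / (c' * κ) := by
    have : 0 < 4 * 209 ^ 2 * 80 / (c' * κ) := by positivity
    linarith
  generalize 2 + 4 * 209 ^ 2 * 80 / (c' * κ) = Λ at hΛ' hΛ1
  intro ε q p M Y hε hq hδ hδq hMε hsep hYs hstep
  by_contra! hfar
  have hF := degOne_fam s t
  have hΓ := hF.retMap q p
  have hrot := hG.retMap q p
  set Γ := retMap (fam s t) q p with hΓdef
  set δ := q * ρ - p with hδdef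
  set b := Γ^[M] Y with hb
  have hΓb : Γ b = s := by rw [hb, ← Function.iterate_succ_apply' Γ, hYs]
  have hright : ∀ x, x < Γ x := fun x => hrot.lt_of_lt (by rw [hrot.semi]; linarith)
  have hbs : b < s := by have := hright b; rwa [hΓb] at this
  set a := s - b with ha
  have ha0 : 0 < a := by linarith
  have hq1 : (1 : ℝ) ≤ q := by exact_mod_cast hq
  have hδε : δ < ε := by nlinarith
  have hM0 : (0 : ℝ) ≤ M := by positivity
  have hφY : φ s = φ Y + (M + 1) * δ := by
    have := hrot.iter (M + 1) Y
    rw [hYs] at this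
    rw [this]; push_cast; ring
  have hsY : s - Y < 1 := by
    by_contra! hc
    have := hG.mono (show Y + 1 ≤ s by linarith)
    rw [hG.add_one] at this
    nlinarith
  have hΛa : Λ * a ≤ 1 := by nlinarith
  obtain ⟨A, hA⟩ := hΓ.surj (s - 2 * Λ * a)
  have hφA : φ s - φ A ≤ (M + 2) * δ := by
    have h1 := hG.mono (show Y ≤ Γ A by rw [hA]; linarith)
    rw [hrot.semi] at h1
    linarith
  set z := s - Λ * a with hz
  have hΛa' : a < Λ * a := by nlinarith
  have hAz : A < z := by
    rw [← hΓ.mono.lt_iff_lt, hA]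
    have := hright z
    nlinarith
  have hzb : z < b := by linarith
  have hmain := cratio_iterate_le hG hq hsep hδq (L := M + 2) (by positivity) (by linarith) hφA
    hAz hzb hbs
  have hR0 : cratio (fam s t A) (fam s t z) (fam s t b) (fam s t s) ≤ 80 / (κ * Λ ^ 3) := by
    have h1 := fam_sub_le_cube (s := s) (t := t) ha0.le
    have h2 := hcube t (Λ * a) (by positivity) hΛa
    rw [show s - a = b by rw [ha]; ring] at h1
    rw [← hz] at h2
    have hm := strictMono_fam s t
    refine (cratio_le_div (hm hAz) (hm hzb) (hm hbs)).trans ?_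
    rw [div_le_div_iff₀ (sub_pos.2 (hm (hzb.trans hbs))) (by positivity)]
    have h6 := mul_le_mul_of_nonneg_right h1 (show 0 ≤ κ * Λ ^ 3 by positivity)
    calc _ ≤ 80 * a ^ 3 * (κ * Λ ^ 3) := h6
      _ = 80 * (κ * (Λ * a) ^ 3) := by ring
      _ ≤ _ := mul_le_mul_of_nonneg_left h2 (by norm_num)
  have hsh : cratio ((fam s t)^[q] A) ((fam s t)^[q] z) ((fam s t)^[q] b) ((fam s t)^[q] s) =
      cratio (Γ A) (Γ z) (Γ b) (Γ s) := by
    simp only [cratio, hΓdef, retMap, sub_sub_sub_cancel_right]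
  have hΓz := hΓ.mono hzb
  rw [hΓb] at hΓz
  have hRq := le_cratio hc' hc1 hΛ1.le ha0 (hright z) hΓz (hright s) hstep
  rw [hsh, hA, hΓb] at hmain
  have hΛ0 : 0 < Λ := by linarith
  have f1 : c' ≤ 4 * Λ * (209 ^ 2 * (80 / (κ * Λ ^ 3))) :=
    hRq.trans (mul_le_mul_of_nonneg_left
      (hmain.trans (mul_le_mul_of_nonneg_left hR0 (by norm_num))) (by positivity))
  have f2 : 4 * Λ * (209 ^ 2 * (80 / (κ * Λ ^ 3))) = 4 * 209 ^ 2 * 80 / (κ * Λ ^ 2) := by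
    field_simp
  rw [f2, le_div_iff₀ (by positivity)] at f1
  have f3 : c' * κ * Λ ≤ c' * κ * Λ * Λ := le_mul_of_one_le_right (by positivity) hΛ1.le
  linarith

/-- The two-sided quasisymmetry inequality for differences. -/
def QSBound (H : ℝ → ℝ) (K : ℝ) : Prop := ∀ x t : ℝ, 0 < t →
  H x - H (x - t) ≤ K * (H (x + t) - H x) ∧ H (x + t) - H x ≤ K * (H x - H (x - t))

theorem QSBound.pow_le {H : ℝ → ℝ} {K : ℝ} (hK : 0 < K) (h : QSBound H K) (y : ℝ) {τ : ℝ}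
    (hτ : 0 < τ) (j : ℕ) :
    (1 + 1 / K) ^ j * (H y - H (y - τ)) ≤ H y - H (y - 2 ^ j * τ) := by
  induction j with
  | zero => simp
  | succ j ih =>
    have h1 := (h (y - 2 ^ j * τ) (2 ^ j * τ) (by positivity)).2
    rw [sub_add_cancel, show y - 2 ^ j * τ - 2 ^ j * τ = y - 2 ^ (j + 1) * τ by ring] at h1
    have h2 : 1 / K * (H y - H (y - 2 ^ j * τ)) ≤ H (y - 2 ^ j * τ) - H (y - 2 ^ (j + 1) * τ) := by
      rw [one_div, inv_mul_le_iff₀ hK]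
      exact h1
    have h3 := mul_le_mul_of_nonneg_left ih (show 0 ≤ 1 + 1 / K by positivity)
    rw [pow_succ]
    nlinarith

theorem not_qsBound_of_longApproach {ρ s t t₀ : ℝ} (hs : s ∈ Ioo (0 : ℝ) 1) {φ H : ℝ → ℝ}
    (hG : IsRot (fam s t) φ ρ) (hH : DegOne H) (hconj : ∀ x, H (fam 0 t₀ x) = fam s t (H x))
    {y : ℝ} (hy : H y = s) (hlong : ∀ n, LongApproach (fam 0 t₀) ρ n y) {K : ℝ} (hK : 1 < K) :
    ¬ QSBound H K := by
  intro hqs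
  have hK0 : 0 < K := by linarith
  obtain ⟨Λ, hΛ, hbound⟩ := exists_step_bound hs hG (c' := 1 / (K * (1 + K))) (by positivity) (by
    rw [div_le_one (by positivity)]; nlinarith)
  obtain ⟨j, hj⟩ := pow_unbounded_of_one_lt (2 * Λ)
    (show 1 < 1 + 1 / K by linarith [one_div_pos.2 hK0])
  obtain ⟨ε, q, p, M, Y, hε, hq, hδ, hδq, hMε, hsep, hYy, hstep, hlen⟩ := hlong (2 ^ j)
  have hΦ := (degOne_fam 0 t₀).retMap q p
  have hsc := retMap_semiconj hH hconj q p
  set Φ := retMap (fam 0 t₀) q p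
  set Γ := retMap (fam s t) q p with hΓdef
  have hiter : ∀ N x, Γ^[N] (H x) = H (Φ^[N] x) := fun N x =>
    ((Function.Semiconj.iterate_right hsc N) x).symm
  have hright : ∀ x, x < Γ x := fun x =>
    (hG.retMap q p).lt_of_lt (by rw [(hG.retMap q p).semi]; linarith)
  have hwy : Φ^[M] Y < y := by
    rw [← hH.mono.lt_iff_lt, ← hYy, Function.iterate_succ_apply', hsc]
    exact hright _
  have hb := hbound ε q p M (H Y) hε hq hδ hδq hMε hsep (by rw [hiter, hYy, hy]) ?_
  · rw [← hΓdef, hiter, ← hy] at hb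
    have h1 := hqs.pow_le hK0 y (sub_pos.2 hwy) j
    rw [sub_sub_cancel] at h1
    push_cast at hlen
    have h2 := hH.mono.monotone (show Y ≤ y - 2 ^ j * (y - Φ^[M] Y) by linarith)
    have h3 := mul_le_mul_of_nonneg_right hj.le (sub_pos.2 (hH.mono hwy)).le
    linarith
  · rw [← hΓdef, hiter, ← hy, ← hsc, one_div, inv_mul_le_iff₀ (by positivity)]
    obtain ⟨τ, hτ⟩ : ∃ τ, Φ^[M] Y = y - τ - τ := ⟨(y - Φ^[M] Y) / 2, by ring⟩
    have hτ0 : 0 < τ := by linarith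
    have h1 := (hqs (y - τ) τ hτ0).1
    rw [sub_add_cancel, ← hτ] at h1
    have h2 := (hqs y τ hτ0).1
    have h3 := hH.mono.monotone (show y + τ ≤ Φ y by linarith)
    have h4 : H y - H (y - τ) ≤ K * (H (Φ y) - H y) :=
      h2.trans (mul_le_mul_of_nonneg_left (by linarith) hK0.le)
    have h5 := mul_le_mul_of_nonneg_left h4 (show 0 ≤ 1 + K by linarith)
    linarith

/-- A semiconjugacy modulo integers, normalised at the origin, between maps with the same
rotation number is an exact semiconjugacy. -/
theorem conj_of_conj_mod_int {F G φ φ' H : ℝ → ℝ} {ρ : ℝ} (hFd : DegOne F) (hGd : DegOne G)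
    (hF : IsRot F φ ρ) (hG : IsRot G φ' ρ) (hH : DegOne H) (h0 : H 0 = 0)
    (h : ∀ x, ∃ m : ℤ, H (F x) = G (H x) + m) :
    (∀ x, H (F x) = G (H x)) ∧ IsRot F (fun x => φ' (H x)) ρ := by
  choose m hm using h
  have hmc : Continuous m := by
    rw [Int.isClosedEmbedding_coe_real.isEmbedding.continuous_iff]
    have : (Int.cast ∘ m : ℝ → ℝ) = fun x => H (F x) - G (H x) := by
      funext x
      simp [hm x]
    rw [this]
    exact (hH.continuous.comp hFd.continuous).sub (hGd.continuous.comp hH.continuous)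
  have hconst : ∀ x, m x = m 0 := fun x => PreconnectedSpace.constant inferInstance hmc
  have hrot : IsRot F (fun x => φ' (H x)) (ρ + m 0) :=
    { mono := hG.mono.comp hH.mono.monotone
      add_one := fun x => by simp only [hH.add_one, hG.add_one]
      semi := fun x => by
        simp only [hm x, hconst x, hG.add_int, hG.semi]
        ring
      zero := by simp only [h0, hG.zero] }
  have heq := tendsto_nhds_unique hF.tendsto hrot.tendsto
  have hz : (m 0 : ℝ) = 0 := by linarith
  rw [hz, add_zero] at hrot
  exact ⟨fun x => by rw [hm x, hconst x, hz, add_zero], hrot⟩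

theorem exists_int_of_coe_eq {x y : ℝ} (h : (x : S1) = (y : S1)) : ∃ m : ℤ, x = y + m := by
  rw [← sub_eq_zero, ← AddCircle.coe_sub, AddCircle.coe_eq_zero_iff] at h
  obtain ⟨m, hm⟩ := h
  exact ⟨m, by simp at hm; linarith⟩

theorem QuasiSymm.exists_normalized_lift {h : S1 → S1} (hq : QuasiSymm h)
    (h0 : h ((0 : ℝ) : S1) = ((0 : ℝ) : S1)) :
    ∃ H K, DegOne H ∧ H 0 = 0 ∧ (∀ x : ℝ, h x = (H x : S1)) ∧ 1 < K ∧ QSBound H K := by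
  obtain ⟨H, ⟨hm, hs, ha, hl⟩, K, hK, hb⟩ := hq
  have hH : DegOne H := ⟨hm, hs, ha⟩
  obtain ⟨k, hk⟩ := exists_int_of_coe_eq ((hl 0).symm.trans h0)
  rw [zero_add] at hk
  refine ⟨fun x => H x - k, K, hH.sub_int k, by simp [hk], fun x => ?_, hK, fun x t ht => ?_⟩
  · rw [hl, eq_comm, ← sub_eq_zero, ← AddCircle.coe_sub, AddCircle.coe_eq_zero_iff]
    exact ⟨-k, by simp⟩
  · obtain ⟨h1, h2⟩ := hb x t ht
    have hpos : 0 < H x - H (x - t) := sub_pos.2 (hm (by linarith))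
    rw [div_le_div_iff₀ (by linarith) hpos] at h1
    rw [div_le_iff₀ hpos] at h2
    constructor <;> linarith

theorem not_quasiSymm_of_generic {ρ : ℝ} (hρ : WellApproxBelow ρ) {s t t₀ α : ℝ} {φ φ' : ℝ → ℝ}
    (hs : s ∈ Ioo (0 : ℝ) 1) (hF : IsRot (fam 0 t₀) φ ρ) (hG : IsRot (fam s t) φ' ρ)
    (hα : ∀ y, φ y = α → ∀ n, LongApproach (fam 0 t₀) ρ n y) (hsα : φ' s = α) {h : S1 → S1}
    (hconj : h ∘ inducedMap (fam 0 t₀) = inducedMap (fam s t) ∘ h)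
    (h0 : h ((0 : ℝ) : S1) = ((0 : ℝ) : S1)) : ¬ QuasiSymm h := by
  intro hq
  obtain ⟨H, K, hH, hH0, hlift, hK, hqs⟩ := hq.exists_normalized_lift h0
  have hmod : ∀ x, ∃ m : ℤ, H (fam 0 t₀ x) = fam s t (H x) + m := by
    intro x
    have e := congrFun hconj (x : S1)
    simp only [Function.comp_apply] at e
    rw [(isLift_fam 0 t₀).2.2.2, hlift, hlift, (isLift_fam s t).2.2.2] at e
    exact exists_int_of_coe_eq e
  obtain ⟨hc, hrot⟩ := conj_of_conj_mod_int (degOne_fam 0 t₀) (degOne_fam s t) hF hG hH hH0 hmod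
  obtain ⟨y, hy⟩ := hH.surj s
  refine not_qsBound_of_longApproach hs hG hH hc hy (hα y ?_) hK hqs
  rw [hF.unique hρ hrot]
  exact hsα ▸ congrArg _ hy

/-- **Theorem C.** There is a set `R_C ⊆ [0,1]` of irrational numbers, containing a residual
subset of `[0,1]`, of full Lebesgue measure, and containing `𝔼_∞`, such that for each
`ρ ∈ R_C` there are `C^∞` multicritical circle maps `f` (unicritical) and `g` (bi-critical) with
rotation number `ρ` for which the conjugacy taking `c₀` to `c₁` is not quasisymmetric. -/
theorem thmC :
    ∃ RC : Set ℝ, RC ⊆ Icc (0 : ℝ) 1 ∧ (∀ ρ ∈ RC, Irrational ρ) ∧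
      (Subtype.val ⁻¹' RC : Set ↥(Icc (0 : ℝ) 1)) ∈ residual ↥(Icc (0 : ℝ) 1) ∧
      volume (Icc (0 : ℝ) 1 \ RC) = 0 ∧
      Einf ⊆ RC ∧
      ∀ ρ ∈ RC, ∃ (f g : S1 → S1) (c₀ c₁ c₂ : S1),
        Unicritical f c₀ ⊤ ∧ Bicritical g c₁ c₂ ⊤ ∧ HasRotNum f ρ ∧ HasRotNum g ρ ∧
        ∀ h : S1 → S1, IsCircleHomeo h → h ∘ f = g ∘ h → h c₀ = c₁ → ¬ QuasiSymm h := by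
  refine ⟨{ρ : ℝ | ρ ∈ Icc (0 : ℝ) 1 ∧ WellApproxBelow ρ}, fun ρ h => h.1,
    fun ρ h => h.2.irrational, wellApproxBelow_residual, volume_diff_wellApproxBelow,
    Einf_subset, ?_⟩
  rintro ρ ⟨h01, hρ⟩
  obtain ⟨t₀, φ, hF⟩ := exists_fam_isRot 0 ρ
  obtain ⟨α, hα, hgen⟩ := exists_generic_position hρ hF
  obtain ⟨s, hs, t, φ', hG, hsα⟩ := exists_fam_position hρ h01 hα
  exact ⟨inducedMap (fam 0 t₀), inducedMap (fam s t), _, _, _, unicritical_fam t₀,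
    bicritical_fam hs t, ⟨_, isLift_fam 0 t₀, hF.tendsto⟩, ⟨_, isLift_fam s t, hG.tendsto⟩,
    fun h _ hconj h0 => not_quasiSymm_of_generic hρ hs hF hG hgen hsα hconj h0⟩
end
end

section
/- (C^∞ Realization Lemma) For every irrational ρ∈(0,1) and every α∈(0,1) there exists a C^∞ orientation-preserving circle homeomorphism g having exactly two critical points c₁ and c₂, both non-flat, such that ρ(g)=ρ and the two connected components of S¹∖{c₁,c₂} have μ_g-measures equal to α and 1−α respectively, where μ_g is the unique g-invariant Borel probability measure. -/
noncomputable section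

open Set Filter MeasureTheory Topology

/-! ### Irrational translations -/

/-- The numbers `n * ρ + m` with `n` positive and `m` an integer are dense. -/
lemma Irrational.exists_nat_mul_add_int_mem_Ioo {ρ : ℝ} (hρ : Irrational ρ) {x y : ℝ}
    (hxy : x < y) : ∃ (n : ℕ) (m : ℤ), 0 < n ∧ n * ρ + m ∈ Ioo x y := by
  have hd : DenseRange (fun n : ℕ => n • (ρ : AddCircle (1 : ℝ))) :=
    denseRange_zsmul_iff_nsmul.1 (AddCircle.denseRange_zsmul_coe_iff.2 (by simpa using hρ))
  have hopen : IsOpen ((fun t : ℝ => (t : AddCircle (1 : ℝ))) '' Ioo (x - ρ) (y - ρ)) :=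
    QuotientAddGroup.isOpenMap_coe _ isOpen_Ioo
  obtain ⟨n, t, ht, hnt⟩ := hd.exists_mem_open hopen
    ((nonempty_Ioo.2 (by linarith)).image _)
  have hsub : ((t - n * ρ : ℝ) : AddCircle (1 : ℝ)) = 0 := by
    simp only at hnt
    rw [AddCircle.coe_sub, hnt, ← nsmul_eq_mul, AddCircle.coe_nsmul, sub_self]
  obtain ⟨m, hm⟩ := (AddCircle.coe_eq_zero_iff 1).1 hsub
  refine ⟨n + 1, m, n.succ_pos, ?_⟩
  have : (m : ℝ) = t - n * ρ := by simpa using hm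
  push_cast
  constructor <;> nlinarith [ht.1, ht.2]

namespace CircleDeg1Lift

lemma translationNumber_lt_of_iterate_lt {f : CircleDeg1Lift} {x ρ : ℝ} {n : ℕ} {m : ℤ}
    (hf : f^[n] x ≤ x + m) (hm : m < n * ρ) : f.translationNumber < ρ := by
  have h := translationNumber_le_of_le_add_int (f ^ n) (x := x) (m := m) (by rwa [coe_pow])
  rw [translationNumber_pow] at h
  exact lt_of_mul_lt_mul_left (h.trans_lt hm) n.cast_nonneg

lemma lt_translationNumber_of_lt_iterate {f : CircleDeg1Lift} {x ρ : ℝ} {n : ℕ} {m : ℤ}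
    (hf : x + m ≤ f^[n] x) (hm : n * ρ < m) : ρ < f.translationNumber := by
  have h := le_translationNumber_of_add_int_le (f ^ n) (x := x) (m := m) (by rwa [coe_pow])
  rw [translationNumber_pow] at h
  exact lt_of_mul_lt_mul_left (hm.trans_le h) n.cast_nonneg

lemma translationNumber_lt_iff_exists {f : CircleDeg1Lift} {ρ : ℝ} :
    f.translationNumber < ρ ↔ ∃ (n : ℕ) (m : ℤ), m < n * ρ ∧ f^[n] 0 < m := by
  constructor
  · intro h
    obtain ⟨r, hr₁, hr₂⟩ := exists_rat_btwn h
    have hden : (0 : ℝ) < r.den := by exact_mod_cast r.den_pos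
    have hr : (r.num : ℝ) = r.den * r := by
      rw [mul_comm]; exact_mod_cast r.mul_den_eq_num.symm
    refine ⟨r.den, r.num, ?_, ?_⟩
    · rw [hr]; gcongr
    · have := map_lt_of_translationNumber_lt_int (f ^ r.den) (n := r.num)
        (by rw [translationNumber_pow, hr]; gcongr) 0
      simpa [coe_pow] using this
  · rintro ⟨n, m, hm, hf⟩
    exact translationNumber_lt_of_iterate_lt (x := 0) (by simpa using hf.le) hm

lemma lt_translationNumber_iff_exists {f : CircleDeg1Lift} {ρ : ℝ} :
    ρ < f.translationNumber ↔ ∃ (n : ℕ) (m : ℤ), n * ρ < m ∧ m < f^[n] 0 := by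
  constructor
  · intro h
    obtain ⟨r, hr₁, hr₂⟩ := exists_rat_btwn h
    have hden : (0 : ℝ) < r.den := by exact_mod_cast r.den_pos
    have hr : (r.num : ℝ) = r.den * r := by
      rw [mul_comm]; exact_mod_cast r.mul_den_eq_num.symm
    refine ⟨r.den, r.num, ?_, ?_⟩
    · rw [hr]; gcongr
    · have := lt_map_of_int_lt_translationNumber (f ^ r.den) (n := r.num)
        (by rw [translationNumber_pow, hr]; gcongr) 0
      simpa [coe_pow] using this
  · rintro ⟨n, m, hm, hf⟩
    exact lt_translationNumber_of_lt_iterate (x := 0) (by simpa using hf.le) hm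

/-- A circle homeomorphism with translation number `ρ` is a factor of the translation by `ρ`,
through a possibly discontinuous monotone map. -/
lemma exists_map_add_eq {f : CircleDeg1Lift} (hf : Function.Bijective f) {ρ : ℝ}
    (hρ : f.translationNumber = ρ) : ∃ k : CircleDeg1Lift, ∀ t, k (t + ρ) = f (k t) := by
  obtain ⟨k, hk⟩ := semiconj_of_isUnit_of_translationNumber_eq
    (f₁ := translate (Multiplicative.ofAdd ρ)) (Units.isUnit _) (isUnit_iff_bijective.2 hf)
    (by rw [translationNumber_translate, hρ])
  refine ⟨k, fun t => ?_⟩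
  have := hk t
  rwa [translate_apply, add_comm] at this

/-- A circle homeomorphism with translation number `ρ` is semiconjugate to the translation
by `ρ`. -/
lemma exists_map_eq_add {f : CircleDeg1Lift} (hf : Function.Bijective f) {ρ : ℝ}
    (hρ : f.translationNumber = ρ) : ∃ h : CircleDeg1Lift, ∀ x, h (f x) = h x + ρ := by
  obtain ⟨h, hh⟩ := semiconj_of_isUnit_of_translationNumber_eq
    (f₂ := translate (Multiplicative.ofAdd ρ)) (isUnit_iff_bijective.2 hf) (Units.isUnit _)
    (by rw [translationNumber_translate, hρ])
  refine ⟨h, fun x => ?_⟩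
  have := hh x
  rwa [translate_apply, add_comm ρ] at this

lemma map_add_nat_mul_add_int {f k : CircleDeg1Lift} {ρ : ℝ} (hk : ∀ t, k (t + ρ) = f (k t))
    (n : ℕ) (m : ℤ) (t : ℝ) : k (t + (n * ρ + m)) = f^[n] (k t) + m := by
  rw [← add_assoc, map_add_int]
  congr 1
  induction n with
  | zero => simp
  | succ n ih =>
    rw [Function.iterate_succ_apply', ← ih, ← hk]
    push_cast
    ring_nf

lemma map_iterate_add_int {f h : CircleDeg1Lift} {ρ : ℝ} (hh : ∀ x, h (f x) = h x + ρ)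
    (n : ℕ) (m : ℤ) (x : ℝ) : h (f^[n] x + m) = h x + (n * ρ + m) := by
  rw [map_add_int]
  induction n with
  | zero => simp
  | succ n ih =>
    rw [Function.iterate_succ_apply', hh]
    push_cast
    linarith

lemma strictMono_of_map_add_eq {f k : CircleDeg1Lift} {ρ : ℝ} (hirr : Irrational ρ)
    (hρ : f.translationNumber = ρ) (hk : ∀ t, k (t + ρ) = f (k t)) : StrictMono k := by
  refine (strictMono_iff_injective k).2 ?_
  intro t t' htt'
  wlog hlt : t < t' generalizing t t'
  · rcases eq_or_lt_of_le (not_lt.1 hlt) with h | h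
    exacts [h.symm, (this htt'.symm h).symm]
  obtain ⟨n, m, hn, h0, h1⟩ := hirr.exists_nat_mul_add_int_mem_Ioo (sub_pos.2 hlt)
  have h := map_add_nat_mul_add_int hk n m t
  have hle : k t ≤ k (t + (n * ρ + m)) := k.monotone (by linarith)
  have hge : k (t + (n * ρ + m)) ≤ k t' := k.monotone (by linarith)
  have heq : (f ^ n) (k t) = k t + ((-m : ℤ) : ℝ) := by
    rw [coe_pow]; push_cast; linarith
  have := translationNumber_of_map_pow_eq_add_int f heq hn
  rw [hρ] at this
  exact absurd ⟨(-m : ℤ) / n, by push_cast at this ⊢; exact this.symm⟩ hirr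

/-- At irrational values, the translation number of a circle homeomorphism strictly increases
under composition with a positive translation. -/
lemma lt_translationNumber_of_add_le {f g : CircleDeg1Lift} (hf : Function.Bijective f)
    (hirr : Irrational f.translationNumber) {δ : ℝ} (hδ : 0 < δ) (hfg : ∀ x, f x + δ ≤ g x) :
    f.translationNumber < g.translationNumber := by
  set ρ := f.translationNumber with hρ
  obtain ⟨k, hk⟩ := exists_map_add_eq hf rfl
  obtain ⟨t, ht⟩ : ∃ t, ContinuousAt k t := by
    obtain ⟨t, ht⟩ := (k.monotone.countable_not_continuousAt.dense_compl ℝ).nonempty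
    exact ⟨t, by simpa using ht⟩
  obtain ⟨ε, hε, hball⟩ := Metric.continuousAt_iff.1 ht δ hδ
  obtain ⟨n, m, hn, h0, h1⟩ := hirr.exists_nat_mul_add_int_mem_Ioo (neg_lt_zero.2 hε)
  have hclose := hball (x := t + (n * ρ + m)) (by
    rw [Real.dist_eq, abs_lt]; constructor <;> linarith)
  rw [map_add_nat_mul_add_int hk, Real.dist_eq, abs_lt] at hclose
  obtain ⟨j, rfl⟩ : ∃ j, n = j + 1 := ⟨n - 1, by omega⟩
  have hle : f^[j + 1] (k t) + δ ≤ g^[j + 1] (k t) := by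
    rw [Function.iterate_succ_apply', Function.iterate_succ_apply']
    have h₁ : f^[j] (k t) ≤ g^[j] (k t) :=
      iterate_mono (f := f) (g := g) (fun x => by linarith [hfg x]) j (k t)
    linarith [hfg (f^[j] (k t)), g.monotone h₁]
  refine lt_translationNumber_of_lt_iterate (x := k t) (n := j + 1) (m := -m) ?_ ?_
  · push_cast; linarith
  · push_cast at h1 ⊢; linarith

/-! ### Continuous families of circle homeomorphisms -/

variable {ψ : ℝ → CircleDeg1Lift}

/-- The composition of the circle map lift `f` with the translation by `a`. -/
def addLeft (a : ℝ) (f : CircleDeg1Lift) : CircleDeg1Lift :=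
  (translate (Multiplicative.ofAdd a) : CircleDeg1Lift) * f

@[simp]
lemma addLeft_apply (a : ℝ) (f : CircleDeg1Lift) (x : ℝ) : addLeft a f x = a + f x := by
  simp [addLeft]

lemma bijective_addLeft {f : CircleDeg1Lift} (hf : Function.Bijective f) (a : ℝ) :
    Function.Bijective (addLeft a f) := by
  have : ⇑(addLeft a f) = Equiv.addLeft a ∘ f := by ext x; simp
  rw [this]
  exact (Equiv.addLeft a).bijective.comp hf

lemma addLeft_mono (f : CircleDeg1Lift) {a a' : ℝ} (h : a ≤ a') :
    addLeft a f ≤ addLeft a' f := fun x => by simpa using h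

lemma continuous_iterate_addLeft (hψ : Continuous fun p : ℝ × ℝ => ψ p.1 p.2) (n : ℕ) :
    Continuous fun p : ℝ × ℝ => (addLeft p.1 (ψ p.2))^[n] 0 := by
  induction n with
  | zero => exact continuous_const
  | succ n ih =>
    simp only [Function.iterate_succ_apply', addLeft_apply]
    exact continuous_fst.add (hψ.comp (continuous_snd.prodMk ih))

lemma isOpen_translationNumber_lt (hψ : Continuous fun p : ℝ × ℝ => ψ p.1 p.2) (ρ : ℝ) :
    IsOpen {p : ℝ × ℝ | (addLeft p.1 (ψ p.2)).translationNumber < ρ} := by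
  simp only [translationNumber_lt_iff_exists, ofPred_exists, ofPred_and]
  refine isOpen_iUnion fun n => isOpen_iUnion fun m => isOpen_const.inter ?_
  exact isOpen_lt (continuous_iterate_addLeft hψ n) continuous_const

lemma isOpen_lt_translationNumber (hψ : Continuous fun p : ℝ × ℝ => ψ p.1 p.2) (ρ : ℝ) :
    IsOpen {p : ℝ × ℝ | ρ < (addLeft p.1 (ψ p.2)).translationNumber} := by
  simp only [lt_translationNumber_iff_exists, ofPred_exists, ofPred_and]
  refine isOpen_iUnion fun n => isOpen_iUnion fun m => isOpen_const.inter ?_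
  exact isOpen_lt continuous_const (continuous_iterate_addLeft hψ n)

lemma exists_translationNumber_addLeft_eq (hψ : Continuous fun p : ℝ × ℝ => ψ p.1 p.2)
    (ρ b : ℝ) : ∃ a, (addLeft a (ψ b)).translationNumber = ρ := by
  have hc : Continuous fun a : ℝ => (a, b) := by fun_prop
  by_contra! hne
  obtain ⟨a, -, h₁, h₂⟩ := isPreconnected_univ _ _
    ((isOpen_translationNumber_lt hψ ρ).preimage hc)
    ((isOpen_lt_translationNumber hψ ρ).preimage hc) (fun a _ => lt_or_gt_of_ne (hne a))
    ⟨ρ - 2 - ψ b 0, mem_univ _, by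
      have := dist_map_zero_translationNumber_le (addLeft (ρ - 2 - ψ b 0) (ψ b))
      rw [Real.dist_eq, addLeft_apply, abs_le] at this
      rw [mem_preimage, mem_ofPred]
      linarith⟩
    ⟨ρ + 2 - ψ b 0, mem_univ _, by
      have := dist_map_zero_translationNumber_le (addLeft (ρ + 2 - ψ b 0) (ψ b))
      rw [Real.dist_eq, addLeft_apply, abs_le] at this
      rw [mem_preimage, mem_ofPred]
      linarith⟩
  rw [mem_preimage, mem_ofPred] at h₁ h₂
  exact lt_asymm h₁ h₂

/-- In a continuous family `ψ` of circle homeomorphisms, an irrational translation number `ρ`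
can be maintained by post-composing with continuously varying translations. -/
lemma exists_continuous_translationNumber_addLeft_eq
    (hψ : Continuous fun p : ℝ × ℝ => ψ p.1 p.2) (hbij : ∀ b, Function.Bijective (ψ b))
    {ρ : ℝ} (hirr : Irrational ρ) :
    ∃ a : ℝ → ℝ, Continuous a ∧ ∀ b, (addLeft (a b) (ψ b)).translationNumber = ρ := by
  choose a ha using exists_translationNumber_addLeft_eq hψ ρ
  have hlt : ∀ {c c' b : ℝ}, c < c' → ρ = (addLeft c (ψ b)).translationNumber →
      ρ < (addLeft c' (ψ b)).translationNumber := fun {c c' b} hc h =>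
    h.trans_lt (lt_translationNumber_of_add_le (bijective_addLeft (hbij b) c) (h ▸ hirr)
      (sub_pos.2 hc) fun x => by simp only [addLeft_apply]; linarith)
  have hlt' : ∀ {c b : ℝ}, c < a b → (addLeft c (ψ b)).translationNumber < ρ :=
    fun {c b} hc => lt_of_le_of_ne
      ((translationNumber_mono (addLeft_mono (ψ b) hc.le)).trans (ha b).le)
      fun h => (hlt hc h.symm).ne' (ha b)
  refine ⟨a, OrderTopology.continuous_iff.2 fun c => ⟨?_, ?_⟩, ha⟩
  · convert (isOpen_translationNumber_lt hψ ρ).preimage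
      (by fun_prop : Continuous fun b : ℝ => (c, b)) using 1
    ext b
    simp only [mem_preimage, mem_Ioi, mem_ofPred]
    refine ⟨fun h => hlt' h, fun h => lt_of_not_ge fun hle => ?_⟩
    exact (lt_self_iff_false ρ).1 (((ha b).symm.trans_le
      (translationNumber_mono (addLeft_mono (ψ b) hle))).trans_lt h)
  · convert (isOpen_lt_translationNumber hψ ρ).preimage
      (by fun_prop : Continuous fun b : ℝ => (c, b)) using 1
    ext b
    simp only [mem_preimage, mem_Iio, mem_ofPred]
    refine ⟨fun h => hlt h (ha b).symm, fun h => lt_of_not_ge fun hle => ?_⟩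
    exact (lt_self_iff_false ρ).1 (lt_of_lt_of_le h
      ((translationNumber_mono (addLeft_mono (ψ b) hle)).trans (ha b).le))

/-- `AtOrbitPosition f ρ x α` says that `x` sits relative to the orbit of `0` under `f` and
integer translations as `α` sits relative to the orbit of `0` under the translation by `ρ`. -/
def AtOrbitPosition (f : CircleDeg1Lift) (ρ x α : ℝ) : Prop :=
  (∀ (n : ℕ) (m : ℤ), n * ρ + m < α → f^[n] 0 + m ≤ x) ∧
    ∀ (n : ℕ) (m : ℤ), α < n * ρ + m → x ≤ f^[n] 0 + m

lemma exists_atOrbitPosition (hψ : Continuous fun p : ℝ × ℝ => ψ p.1 p.2)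
    (hbij : ∀ b, Function.Bijective (ψ b)) {ρ α : ℝ} (hirr : Irrational ρ)
    (hα : α ∈ Ioo (0 : ℝ) 1) :
    ∃ a b, b ∈ Ioo (0 : ℝ) 1 ∧ (addLeft a (ψ b)).translationNumber = ρ ∧
      AtOrbitPosition (addLeft a (ψ b)) ρ b α := by
  obtain ⟨a, hac, ha⟩ := exists_continuous_translationNumber_addLeft_eq hψ hbij hirr
  have hit : ∀ n : ℕ, Continuous fun b => (addLeft (a b) (ψ b))^[n] 0 := fun n =>
    (continuous_iterate_addLeft hψ n).comp (hac.prodMk continuous_id)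
  choose h hh using fun b => exists_map_eq_add (bijective_addLeft (hbij b) (a b)) (ha b)
  set U : Set ℝ := {b | ∃ (n : ℕ) (m : ℤ), n * ρ + m < α ∧ b < (addLeft (a b) (ψ b))^[n] 0 + m}
    with hU
  set V : Set ℝ := {b | ∃ (n : ℕ) (m : ℤ), α < n * ρ + m ∧ (addLeft (a b) (ψ b))^[n] 0 + m < b}
    with hV
  have hUo : IsOpen U := by
    simp only [hU, ofPred_exists, ofPred_and]
    exact isOpen_iUnion fun n => isOpen_iUnion fun m => isOpen_const.inter
      (isOpen_lt continuous_id ((hit n).add continuous_const))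
  have hVo : IsOpen V := by
    simp only [hV, ofPred_exists, ofPred_and]
    exact isOpen_iUnion fun n => isOpen_iUnion fun m => isOpen_const.inter
      (isOpen_lt ((hit n).add continuous_const) continuous_id)
  have hdisj : ∀ b, b ∈ U → b ∉ V := by
    rintro b ⟨n, m, h₁, h₂⟩ ⟨n', m', h₁', h₂'⟩
    have := (h b).monotone (h₂'.trans h₂).le
    rw [map_iterate_add_int (hh b), map_iterate_add_int (hh b)] at this
    linarith
  have h0 : (0 : ℝ) ∈ U := by
    obtain ⟨n, m, -, h₁, h₂⟩ := hirr.exists_nat_mul_add_int_mem_Ioo hα.1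
    refine ⟨n, m, h₂, lt_of_not_ge fun hle => ?_⟩
    have := (h 0).monotone hle
    rw [map_iterate_add_int (hh 0)] at this
    linarith
  have h1 : (1 : ℝ) ∈ V := by
    obtain ⟨n, m, -, h₁, h₂⟩ := hirr.exists_nat_mul_add_int_mem_Ioo hα.2
    refine ⟨n, m, h₁, lt_of_not_ge fun hle => ?_⟩
    have := (h 1).monotone hle
    rw [map_iterate_add_int (hh 1), ← zero_add (1 : ℝ), map_add_one, zero_add] at this
    linarith
  obtain ⟨b, hb, hbU, hbV⟩ : ∃ b ∈ Icc (0 : ℝ) 1, b ∉ U ∧ b ∉ V := by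
    by_contra! hcover
    obtain ⟨b, -, hbU, hbV⟩ := isPreconnected_Icc U V hUo hVo
      (fun b hb => or_iff_not_imp_left.2 (hcover b hb))
      ⟨0, left_mem_Icc.2 zero_le_one, h0⟩ ⟨1, right_mem_Icc.2 zero_le_one, h1⟩
    exact hdisj b hbU hbV
  refine ⟨a b, b, ⟨lt_of_le_of_ne hb.1 ?_, lt_of_le_of_ne hb.2 ?_⟩, ha b, ?_, ?_⟩
  · rintro rfl; exact hbU h0
  · rintro rfl; exact hbV h1
  · exact fun n m hm => le_of_not_gt fun hlt => hbU ⟨n, m, hm, hlt⟩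
  · exact fun n m hm => le_of_not_gt fun hlt => hbV ⟨n, m, hm, hlt⟩

/-- If `x` is at orbit position `α`, a map `k` carrying the translation by `ρ` to `f` sends an
interval of length `α` between `0` and `x`, and the adjacent one of length `1 - α` between `x`
and `1`. -/
lemma exists_mapsTo_of_atOrbitPosition {f k : CircleDeg1Lift} {ρ x α : ℝ} (hirr : Irrational ρ)
    (hf : f.translationNumber = ρ) (hk : ∀ t, k (t + ρ) = f (k t))
    (hx : AtOrbitPosition f ρ x α) :
    ∃ s, MapsTo k (Ioo s (s + α)) (Ioo 0 x) ∧ MapsTo k (Ioo (s + α) (s + 1)) (Ioo x 1) := by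
  have hmono := strictMono_of_map_add_eq hirr hf hk
  set s := sSup {t | k t ≤ 0} with hs
  have hne : {t | k t ≤ 0}.Nonempty := (k.tendsto_atBot.eventually_le_atBot 0).exists
  have hbdd : BddAbove {t | k t ≤ 0} := by
    obtain ⟨t, ht⟩ := (k.tendsto_atTop.eventually_gt_atTop 0).exists
    exact ⟨t, fun u hu => le_of_not_gt fun h => absurd (hmono h) (not_lt.2 (hu.trans ht.le))⟩
  have hbelow : ∀ t < s, k t ≤ 0 := fun t ht => by
    obtain ⟨u, hu, htu⟩ := exists_lt_of_lt_csSup hne ht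
    exact (k.monotone htu.le).trans hu
  have habove : ∀ t, s < t → 0 < k t := fun t ht =>
    lt_of_not_ge fun h => not_lt.2 (le_csSup hbdd h) ht
  have hle : ∀ t < s + α, k t < x := fun t ht => by
    obtain ⟨u, htu, hu⟩ := exists_between ht
    refine (hmono htu).trans_le ?_
    obtain ⟨n, m, -, h₁, h₂⟩ := hirr.exists_nat_mul_add_int_mem_Ioo (sub_lt_iff_lt_add'.2 hu)
    refine le_trans ?_ (hx.1 n m h₂)
    have := map_add_nat_mul_add_int hk n m (u - (n * ρ + m))
    rw [sub_add_cancel] at this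
    rw [this]
    gcongr
    rw [← coe_pow]
    exact (f ^ n).monotone (hbelow _ (by linarith))
  have hge : ∀ t, s + α < t → x < k t := fun t ht => by
    obtain ⟨u, hu, hut⟩ := exists_between ht
    refine lt_of_le_of_lt ?_ (hmono hut)
    obtain ⟨n, m, -, h₁, h₂⟩ := hirr.exists_nat_mul_add_int_mem_Ioo (lt_sub_iff_add_lt'.2 hu)
    refine (hx.2 n m h₁).trans ?_
    have := map_add_nat_mul_add_int hk n m (u - (n * ρ + m))
    rw [sub_add_cancel] at this
    rw [this]
    gcongr
    rw [← coe_pow]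
    exact (f ^ n).monotone (habove _ (by linarith)).le
  refine ⟨s, fun t ht => ⟨habove t ht.1, hle t ht.2⟩, fun t ht => ⟨hge t ht.1, ?_⟩⟩
  obtain ⟨u, htu, hu⟩ := exists_between ht.2
  have := hbelow (u - 1) (by linarith)
  have h1 := k.map_add_one (u - 1)
  rw [sub_add_cancel] at h1
  linarith [hmono htu]

end CircleDeg1Lift

/-! ### Invariant measures of circle maps -/

/-- The circle map induced by a degree one lift. -/
def CircleDeg1Lift.toCircleMap (f : CircleDeg1Lift) (y : S1) : S1 :=
  (f (AddCircle.equivIco 1 0 y : ℝ) : S1)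

namespace CircleDeg1Lift

lemma toCircleMap_coe (f : CircleDeg1Lift) (x : ℝ) : f.toCircleMap (x : S1) = (f x : S1) := by
  have h : (AddCircle.equivIco 1 0 (x : S1) : ℝ) = x - ⌊x⌋ := by
    rw [AddCircle.coe_equivIco_mk_apply, Int.self_sub_floor, div_one, mul_one]
  rw [toCircleMap, h, map_sub_int, AddCircle.coe_sub]
  have : ((⌊x⌋ : ℝ) : S1) = 0 := (AddCircle.coe_eq_zero_iff 1).2 ⟨⌊x⌋, by simp⟩
  rw [this, sub_zero]

lemma measurable_toCircleMap (f : CircleDeg1Lift) : Measurable f.toCircleMap :=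
  AddCircle.measurable_mk'.comp (f.monotone.measurable.comp
    (measurable_subtype_coe.comp (AddCircle.measurableEquivIco 1 0).measurable))

/-- The push-forward of Lebesgue measure on the circle by the map induced by `k`. -/
def circleMeasure (k : CircleDeg1Lift) : Measure S1 := (volume : Measure S1).map k.toCircleMap

instance (k : CircleDeg1Lift) : IsProbabilityMeasure k.circleMeasure :=
  haveI : IsProbabilityMeasure (volume : Measure S1) := ⟨by simp [AddCircle.measure_univ]⟩
  Measure.isProbabilityMeasure_map k.measurable_toCircleMap.aemeasurable

lemma map_circleMeasure {f k : CircleDeg1Lift} {ρ : ℝ} (hk : ∀ t, k (t + ρ) = f (k t)) :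
    k.circleMeasure.map f.toCircleMap = k.circleMeasure := by
  have hcomm : f.toCircleMap ∘ k.toCircleMap = k.toCircleMap ∘ fun y : S1 => y + (ρ : S1) := by
    ext y
    obtain ⟨t, rfl⟩ := QuotientAddGroup.mk_surjective y
    show f.toCircleMap (k.toCircleMap (t : S1)) = k.toCircleMap ((t + ρ : ℝ) : S1)
    rw [toCircleMap_coe, toCircleMap_coe, toCircleMap_coe, hk]
  rw [circleMeasure, Measure.map_map f.measurable_toCircleMap k.measurable_toCircleMap, hcomm,
    ← Measure.map_map k.measurable_toCircleMap (measurable_add_const _),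
    (measurePreserving_add_right volume (ρ : S1)).map_eq]

/-- The circle measure associated with `k` of a set containing the image of an interval of length
at most one is at least the length of the interval. -/
lemma ofReal_le_circleMeasure (k : CircleDeg1Lift) {s t u : ℝ} (hs : s ≤ t) (hu : u ≤ s + 1)
    {A : Set S1} (hA : MeasurableSet A) (hk : ∀ v ∈ Ioo t u, (k v : S1) ∈ A) :
    ENNReal.ofReal (u - t) ≤ k.circleMeasure A := by
  rw [circleMeasure, Measure.map_apply k.measurable_toCircleMap hA,
    AddCircle.add_projection_respects_measure 1 s (k.measurable_toCircleMap hA), ← Real.volume_Ioo]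
  refine measure_mono fun v hv => ⟨?_, hs.trans_lt hv.1, hv.2.le.trans hu⟩
  show k.toCircleMap (v : S1) ∈ A
  rw [toCircleMap_coe]
  exact hk v hv

end CircleDeg1Lift

lemma isOpen_posArc (x y : S1) : IsOpen (posArc x y) := by
  have : posArc x y = (x + ·) '' ((fun t : ℝ => (t : S1)) '' Ioo 0 (arcLen x y)) := by
    rw [posArc, image_image]
  rw [this]
  exact isOpenMap_add_left x _ (QuotientAddGroup.isOpenMap_coe _ isOpen_Ioo)

lemma posArc_zero_coe {b : ℝ} (hb : b ∈ Ioo (0 : ℝ) 1) :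
    posArc 0 (b : S1) = (fun t : ℝ => (t : S1)) '' Ioo 0 b := by
  have : arcLen 0 (b : S1) = b := by
    rw [arcLen, sub_zero, AddCircle.coe_equivIco_mk_apply]
    simpa using Int.fract_eq_self.2 ⟨hb.1.le, hb.2⟩
  simp [posArc, this]

lemma posArc_coe_zero {b : ℝ} (hb : b ∈ Ioo (0 : ℝ) 1) :
    posArc (b : S1) 0 = (fun t : ℝ => (t : S1)) '' Ioo b 1 := by
  have : arcLen (b : S1) 0 = 1 - b := by
    rw [arcLen, zero_sub, ← AddCircle.coe_neg, AddCircle.coe_equivIco_mk_apply]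
    simp only [div_one, mul_one]
    rw [Int.fract_eq_iff]
    exact ⟨by linarith [hb.2], by linarith [hb.1], -1, by push_cast; ring⟩
  have himg : Ioo b 1 = (b + ·) '' Ioo 0 (1 - b) := by simp
  rw [posArc, this, himg, image_image]
  simp only [AddCircle.coe_add]

lemma injOn_coe_Ico : InjOn (fun t : ℝ => (t : S1)) (Ico 0 1) := by
  intro x hx y hy hxy
  have := AddCircle.coe_eq_coe_iff_of_mem_Ico (p := (1 : ℝ)) (a := 0) (by simpa using hx)
    (by simpa using hy)
  exact this.1 hxy

lemma disjoint_posArc {b : ℝ} (hb : b ∈ Ioo (0 : ℝ) 1) :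
    Disjoint (posArc 0 (b : S1)) (posArc (b : S1) 0) := by
  rw [posArc_zero_coe hb, posArc_coe_zero hb]
  refine Set.disjoint_left.2 ?_
  rintro _ ⟨t, ht, rfl⟩ ⟨u, hu, hut⟩
  have := injOn_coe_Ico ⟨hb.1.le.trans hu.1.le, hu.2⟩ ⟨ht.1.le, ht.2.trans hb.2⟩ hut
  linarith [hu.1, ht.2]

open CircleDeg1Lift in
lemma circleMeasure_posArc {k : CircleDeg1Lift} {b s α : ℝ} (hb : b ∈ Ioo (0 : ℝ) 1)
    (hα : α ∈ Ioo (0 : ℝ) 1) (h₁ : MapsTo k (Ioo s (s + α)) (Ioo 0 b))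
    (h₂ : MapsTo k (Ioo (s + α) (s + 1)) (Ioo b 1)) :
    (k.circleMeasure (posArc 0 (b : S1))).toReal = α ∧
      (k.circleMeasure (posArc (b : S1) 0)).toReal = 1 - α := by
  have hA := (isOpen_posArc 0 (b : S1)).measurableSet
  have hB := (isOpen_posArc (b : S1) 0).measurableSet
  have hle₁ : α ≤ (k.circleMeasure (posArc 0 (b : S1))).toReal := by
    refine (ENNReal.ofReal_le_iff_le_toReal (measure_ne_top _ _)).1 ?_
    convert k.ofReal_le_circleMeasure (s := s) (t := s) (u := s + α) le_rfl (by linarith [hα.2])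
      hA (fun v hv => ?_) using 2
    · ring
    · rw [posArc_zero_coe hb]
      exact mem_image_of_mem _ (h₁ hv)
  have hle₂ : 1 - α ≤ (k.circleMeasure (posArc (b : S1) 0)).toReal := by
    refine (ENNReal.ofReal_le_iff_le_toReal (measure_ne_top _ _)).1 ?_
    convert k.ofReal_le_circleMeasure (s := s) (t := s + α) (u := s + 1) (by linarith [hα.1]) le_rfl
      hB (fun v hv => ?_) using 2
    · ring
    · rw [posArc_coe_zero hb]
      exact mem_image_of_mem _ (h₂ hv)
  have hsum : (k.circleMeasure (posArc 0 (b : S1))).toReal +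
      (k.circleMeasure (posArc (b : S1) 0)).toReal ≤ 1 := by
    rw [← ENNReal.toReal_add (measure_ne_top _ _) (measure_ne_top _ _),
      ← measure_union (disjoint_posArc hb) hB]
    exact ENNReal.toReal_mono ENNReal.one_ne_top prob_le_one
  constructor <;> linarith

/-! ### Non-flat critical points of analytic maps -/

/-- A strictly increasing analytic map has a non-flat critical point wherever its derivative has
a double zero. -/
lemma nonFlatAt_of_analyticOrderAt_deriv_eq_two {F : ℝ → ℝ} {c : ℝ} (hmono : StrictMono F)
    (hF : AnalyticAt ℝ F c) (hord : analyticOrderAt (deriv F) c = 2) : NonFlatAt F c := by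
  have hord3 : analyticOrderAt (F · - F c) c = (3 : ℕ) := by
    rw [← hF.analyticOrderAt_deriv_add_one, hord]; rfl
  obtain ⟨u, hu, huc, hFu⟩ := ((hF.sub analyticAt_const).analyticOrderAt_eq_natCast).1 hord3
  simp only [smul_eq_mul] at hFu
  have hupos : 0 < u c := by
    refine lt_of_le_of_ne ?_ huc.symm
    refine ge_of_tendsto (hu.continuousAt.tendsto.mono_left nhdsWithin_le_nhds :
      Tendsto u (𝓝[>] c) (𝓝 (u c))) ?_
    filter_upwards [nhdsWithin_le_nhds hFu, self_mem_nhdsWithin] with y hy hcy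
    have hcy' : 0 < (y - c) ^ 3 := pow_pos (sub_pos.2 hcy) 3
    have : 0 < (y - c) ^ 3 * u y := hy ▸ sub_pos.2 (hmono hcy)
    exact (pos_of_mul_pos_right this hcy'.le).le
  set φ : ℝ → ℝ := fun y => (y - c) * u y ^ (1 / 3 : ℝ) with hφ
  have hroot : AnalyticAt ℝ (fun y => u y ^ (1 / 3 : ℝ)) c :=
    (hu.contDiffAt.rpow_const_of_ne hupos.ne').analyticAt
  have hφan : AnalyticAt ℝ φ c := (analyticAt_id.sub analyticAt_const).mul hroot
  have hφc : 0 < deriv φ c := by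
    have hd : HasDerivAt φ _ c :=
      ((hasDerivAt_id c).sub_const c).mul hroot.differentiableAt.hasDerivAt
    have : deriv φ c = u c ^ (1 / 3 : ℝ) := by simpa using hd.deriv
    rw [this]
    positivity
  have hev : ∀ᶠ y in 𝓝 c, AnalyticAt ℝ φ y ∧ 0 < deriv φ y ∧ 0 < u y ∧
      F y - F c = (y - c) ^ 3 * u y := by
    filter_upwards [hφan.eventually_analyticAt, hφan.deriv.continuousAt.eventually (lt_mem_nhds hφc),
      hu.continuousAt.eventually (lt_mem_nhds hupos), hFu] with y h₁ h₂ h₃ h₄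
    exact ⟨h₁, h₂, h₃, h₄⟩
  obtain ⟨ε, hε, hball⟩ := Metric.eventually_nhds_iff_ball.1 hev
  refine ⟨3, by norm_num, Metric.ball c ε, Metric.isOpen_ball, Metric.mem_ball_self hε, φ,
    fun y hy => (hball y hy).1.contDiffAt.contDiffWithinAt, ?_, fun y hy => (hball y hy).2.1.ne',
    by simp [hφ], fun y hy => ?_⟩
  · refine (strictMonoOn_of_deriv_pos (convex_ball c ε)
      (fun y hy => (hball y hy).1.continuousAt.continuousWithinAt) fun y hy => ?_).injOn
    exact (hball y (interior_subset hy)).2.1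
  · obtain ⟨-, -, hy₁, hy₂⟩ := hball y hy
    have hcube : (u y ^ (1 / 3 : ℝ)) ^ 3 = u y := by
      rw [← Real.rpow_natCast, ← Real.rpow_mul hy₁.le]
      norm_num
    have habs : |φ y| ^ ((3 : ℝ) - 1) = φ y ^ 2 := by
      rw [show (3 : ℝ) - 1 = (2 : ℕ) by norm_num, Real.rpow_natCast, sq_abs]
    rw [habs]
    have : φ y * φ y ^ 2 = (y - c) ^ 3 * (u y ^ (1 / 3 : ℝ)) ^ 3 := by simp only [hφ]; ring
    rw [this, hcube]
    linarith

/-! ### A family of bicritical circle maps -/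

open Real in
/-- A lift of an analytic circle map whose critical points are `0` and `b`, with derivative
proportional to `(sin (π x) * sin (π (x - b))) ^ 2`. -/
def bicriticalFun (b x : ℝ) : ℝ :=
  x + (sin (2 * π * (2 * x - b)) / (8 * π) - sin (2 * π * x) / (2 * π)
    - sin (2 * π * (x - b)) / (2 * π)) / (1 + cos (2 * π * b) / 2)

lemma bicriticalFun_normalization_pos (b : ℝ) : 0 < 1 + Real.cos (2 * Real.pi * b) / 2 := by
  linarith [Real.neg_one_le_cos (2 * Real.pi * b)]

lemma continuous_bicriticalFun : Continuous fun p : ℝ × ℝ => bicriticalFun p.1 p.2 := by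
  unfold bicriticalFun
  exact continuous_snd.add (Continuous.div (by fun_prop) (by fun_prop)
    fun p => (bicriticalFun_normalization_pos p.1).ne')

lemma contDiff_bicriticalFun (b : ℝ) (n : WithTop ℕ∞) : ContDiff ℝ n (bicriticalFun b) := by
  unfold bicriticalFun
  fun_prop

lemma bicriticalFun_add_one (b x : ℝ) : bicriticalFun b (x + 1) = bicriticalFun b x + 1 := by
  unfold bicriticalFun
  rw [show 2 * Real.pi * (2 * (x + 1) - b) = 2 * Real.pi * (2 * x - b) + (2 : ℕ) * (2 * Real.pi) by
      push_cast; ring,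
    show 2 * Real.pi * (x + 1) = 2 * Real.pi * x + 2 * Real.pi by ring,
    show 2 * Real.pi * (x + 1 - b) = 2 * Real.pi * (x - b) + 2 * Real.pi by ring,
    Real.sin_add_nat_mul_two_pi, Real.sin_add_two_pi, Real.sin_add_two_pi]
  ring

lemma hasDerivAt_bicriticalFun (b x : ℝ) :
    HasDerivAt (bicriticalFun b) (4 / (1 + Real.cos (2 * Real.pi * b) / 2) *
      (Real.sin (Real.pi * x) * Real.sin (Real.pi * (x - b))) ^ 2) x := by
  have hN := (bicriticalFun_normalization_pos b).ne'
  have hπ := Real.pi_ne_zero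
  have h₁ := (((((hasDerivAt_id x).const_mul 2).sub_const b).const_mul
    (2 * Real.pi)).sin).div_const (8 * Real.pi)
  have h₂ := (((hasDerivAt_id x).const_mul (2 * Real.pi)).sin).div_const (2 * Real.pi)
  have h₃ := ((((hasDerivAt_id x).sub_const b).const_mul
    (2 * Real.pi)).sin).div_const (2 * Real.pi)
  have h := (hasDerivAt_id x).add (((h₁.sub h₂).sub h₃).div_const
    (1 + Real.cos (2 * Real.pi * b) / 2))
  refine h.congr_deriv ?_
  simp only [id]
  have hcosb := Real.cos_sub (2 * (Real.pi * x)) (2 * (Real.pi * (x - b)))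
  have hcosx := Real.cos_add (2 * (Real.pi * x)) (2 * (Real.pi * (x - b)))
  have hcos : ∀ y, Real.cos (2 * y) = 1 - 2 * Real.sin y ^ 2 := fun y => by
    rw [Real.cos_two_mul, Real.cos_sq']; ring
  rw [hcos, hcos, show 2 * (Real.pi * x) - 2 * (Real.pi * (x - b)) = 2 * Real.pi * b by ring]
    at hcosb
  rw [hcos, hcos,
    show 2 * (Real.pi * x) + 2 * (Real.pi * (x - b)) = 2 * Real.pi * (2 * x - b) by ring] at hcosx
  rw [show 2 * Real.pi * x = 2 * (Real.pi * x) by ring,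
    show 2 * Real.pi * (x - b) = 2 * (Real.pi * (x - b)) by ring, hcos, hcos]
  generalize Real.cos (2 * Real.pi * b) = N at *
  generalize Real.cos (2 * Real.pi * (2 * x - b)) = M at *
  have hN₂ : 2 + N ≠ 0 := fun h => hN (by linarith)
  field_simp
  linarith

lemma deriv_bicriticalFun (b : ℝ) : deriv (bicriticalFun b) = fun x =>
    4 / (1 + Real.cos (2 * Real.pi * b) / 2) *
      (Real.sin (Real.pi * x) * Real.sin (Real.pi * (x - b))) ^ 2 :=
  funext fun x => (hasDerivAt_bicriticalFun b x).deriv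

lemma sin_pi_mul_eq_zero_iff (x : ℝ) : Real.sin (Real.pi * x) = 0 ↔ ∃ m : ℤ, x = m := by
  rw [Real.sin_eq_zero_iff]
  refine exists_congr fun m => ?_
  rw [mul_comm, mul_right_inj' Real.pi_ne_zero, eq_comm]

lemma setOf_deriv_bicriticalFun_eq_zero (b : ℝ) : {x | deriv (bicriticalFun b) x = 0} =
    {x : ℝ | ∃ m : ℤ, x = 0 + m} ∪ {x : ℝ | ∃ m : ℤ, x = b + m} := by
  ext x
  have hN := (bicriticalFun_normalization_pos b).ne'
  simp only [deriv_bicriticalFun, mem_ofPred, mem_union, mul_eq_zero, div_eq_zero_iff, hN,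
    OfNat.ofNat_ne_zero, false_or, pow_eq_zero_iff, ne_eq, not_false_eq_true,
    sin_pi_mul_eq_zero_iff, zero_add, sub_eq_iff_eq_add']

lemma strictMono_bicriticalFun (b : ℝ) : StrictMono (bicriticalFun b) := by
  have hdiff : Differentiable ℝ (bicriticalFun b) :=
    (contDiff_bicriticalFun b 1).differentiable one_ne_zero
  have hmono : Monotone (bicriticalFun b) := monotone_of_deriv_nonneg hdiff fun x => by
    have := bicriticalFun_normalization_pos b
    rw [deriv_bicriticalFun]
    positivity
  intro x y hxy
  refine lt_of_le_of_ne (hmono hxy.le) fun heq => ?_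
  have hcount : {x | deriv (bicriticalFun b) x = 0}.Countable := by
    rw [setOf_deriv_bicriticalFun_eq_zero]
    refine ((countable_range fun m : ℤ => (0 : ℝ) + m).union
      (countable_range fun m : ℤ => b + m)).mono ?_
    rintro z (⟨m, rfl⟩ | ⟨m, rfl⟩)
    exacts [Or.inl ⟨m, rfl⟩, Or.inr ⟨m, rfl⟩]
  obtain ⟨z, hz, hzxy⟩ := (hcount.dense_compl ℝ).exists_mem_open isOpen_Ioo (nonempty_Ioo.2 hxy)
  refine hz (mem_ofPred.2 ?_)
  have hconst : bicriticalFun b =ᶠ[𝓝 z] fun _ => bicriticalFun b x := by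
    filter_upwards [isOpen_Ioo.mem_nhds hzxy] with w hw
    exact le_antisymm ((hmono hw.2.le).trans heq.ge) (hmono hw.1.le)
  rw [hconst.deriv_eq, deriv_const]

/-- `bicriticalFun b` as a degree one lift. -/
def bicriticalLift (b : ℝ) : CircleDeg1Lift :=
  ⟨⟨bicriticalFun b, (strictMono_bicriticalFun b).monotone⟩, bicriticalFun_add_one b⟩

lemma bicriticalLift_apply (b x : ℝ) : bicriticalLift b x = bicriticalFun b x := rfl

lemma bijective_bicriticalLift (b : ℝ) : Function.Bijective (bicriticalLift b) :=
  ⟨(strictMono_bicriticalFun b).injective,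
    (bicriticalLift b).continuous_iff_surjective.1 (contDiff_bicriticalFun b 0).continuous⟩

lemma analyticOrderAt_sin_pi_mul_sub {a c : ℝ} (hc : Real.sin (Real.pi * (c - a)) = 0) :
    analyticOrderAt (fun x => Real.sin (Real.pi * (x - a))) c = 1 := by
  refine AnalyticAt.analyticOrderAt_eq_one_of_zero_deriv_ne_zero (by fun_prop) hc ?_
  have h := (((hasDerivAt_id c).sub_const a).const_mul Real.pi).sin
  simp only [id] at h
  rw [h.deriv, mul_one, mul_ne_zero_iff]
  refine ⟨fun h0 => ?_, Real.pi_ne_zero⟩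
  have := Real.sin_sq_add_cos_sq (Real.pi * (c - a))
  rw [hc, h0] at this
  norm_num at this

lemma analyticOrderAt_deriv_bicriticalFun {b c : ℝ}
    (hc : analyticOrderAt (fun x => Real.sin (Real.pi * x)) c +
      analyticOrderAt (fun x => Real.sin (Real.pi * (x - b))) c = 1) :
    analyticOrderAt (deriv (bicriticalFun b)) c = 2 := by
  have hN : 4 / (1 + Real.cos (2 * Real.pi * b) / 2) ≠ 0 :=
    (div_pos four_pos (bicriticalFun_normalization_pos b)).ne'
  have h₁ : AnalyticAt ℝ (fun x => Real.sin (Real.pi * x)) c := by fun_prop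
  have h₂ : AnalyticAt ℝ (fun x => Real.sin (Real.pi * (x - b))) c := by fun_prop
  have h₀ : AnalyticAt ℝ (fun _ : ℝ => 4 / (1 + Real.cos (2 * Real.pi * b) / 2)) c :=
    analyticAt_const
  have heq : deriv (bicriticalFun b) = (fun _ => 4 / (1 + Real.cos (2 * Real.pi * b) / 2)) *
      ((fun x => Real.sin (Real.pi * x)) * fun x => Real.sin (Real.pi * (x - b))) ^ 2 :=
    deriv_bicriticalFun b
  rw [heq, analyticOrderAt_mul h₀ ((h₁.mul h₂).pow 2), analyticOrderAt_pow (h₁.mul h₂),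
    analyticOrderAt_mul h₁ h₂, hc, h₀.analyticOrderAt_eq_zero.2 hN]
  rfl

lemma sin_pi_mul_ne_zero_of_mem_Ioo {b : ℝ} (hb : b ∈ Ioo (0 : ℝ) 1) : Real.sin (Real.pi * b) ≠ 0 :=
  (Real.sin_pos_of_pos_of_lt_pi (mul_pos Real.pi_pos hb.1)
    (mul_lt_of_lt_one_right Real.pi_pos hb.2)).ne'

lemma analyticOrderAt_deriv_bicriticalFun_zero {b : ℝ} (hb : b ∈ Ioo (0 : ℝ) 1) :
    analyticOrderAt (deriv (bicriticalFun b)) 0 = 2 := by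
  refine analyticOrderAt_deriv_bicriticalFun ?_
  have h₁ := analyticOrderAt_sin_pi_mul_sub (a := 0) (c := 0) (by simp)
  have h₂ : AnalyticAt ℝ (fun x => Real.sin (Real.pi * (x - b))) 0 := by fun_prop
  simp only [sub_zero] at h₁
  rw [h₁, h₂.analyticOrderAt_eq_zero.2 (by simpa using sin_pi_mul_ne_zero_of_mem_Ioo hb), add_zero]

lemma analyticOrderAt_deriv_bicriticalFun_self {b : ℝ} (hb : b ∈ Ioo (0 : ℝ) 1) :
    analyticOrderAt (deriv (bicriticalFun b)) b = 2 := by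
  refine analyticOrderAt_deriv_bicriticalFun ?_
  have h₁ := analyticOrderAt_sin_pi_mul_sub (a := b) (c := b) (by simp)
  have h₂ : AnalyticAt ℝ (fun x => Real.sin (Real.pi * x)) b := by fun_prop
  rw [h₁, h₂.analyticOrderAt_eq_zero.2 (sin_pi_mul_ne_zero_of_mem_Ioo hb), zero_add]

lemma isLift_toCircleMap_addLeft_bicriticalLift (a b : ℝ) :
    IsLift (CircleDeg1Lift.addLeft a (bicriticalLift b)).toCircleMap
      (CircleDeg1Lift.addLeft a (bicriticalLift b)) := by
  have hbij := CircleDeg1Lift.bijective_addLeft (bijective_bicriticalLift b) a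
  exact ⟨(CircleDeg1Lift.strictMono_iff_injective _).2 hbij.1, hbij.2,
    CircleDeg1Lift.map_add_one _, CircleDeg1Lift.toCircleMap_coe _⟩

lemma bicritical_toCircleMap_addLeft_bicriticalLift (a : ℝ) {b : ℝ} (hb : b ∈ Ioo (0 : ℝ) 1) :
    Bicritical (CircleDeg1Lift.addLeft a (bicriticalLift b)).toCircleMap 0 (b : S1) ⊤ := by
  set F := CircleDeg1Lift.addLeft a (bicriticalLift b) with hF
  have hFeq : ⇑F = fun x => a + bicriticalFun b x := by
    ext x; simp [hF, bicriticalLift_apply]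
  have hlift := isLift_toCircleMap_addLeft_bicriticalLift a b
  have hsmooth : ∀ n : WithTop ℕ∞, ContDiff ℝ n F := fun n => by
    rw [hFeq]; exact contDiff_const.add (contDiff_bicriticalFun b n)
  have hderiv : deriv F = deriv (bicriticalFun b) := by
    rw [hFeq]; ext x; exact deriv_const_add _
  have han : ∀ x, AnalyticAt ℝ F x := fun x => (hsmooth ⊤).contDiffAt.analyticAt
  refine ⟨fun h => ?_, F, 0, b, hlift, hsmooth _, AddCircle.coe_zero _, rfl, ?_, ?_, ?_⟩
  · have := injOn_coe_Ico (left_mem_Ico.2 zero_lt_one) (Ioo_subset_Ico_self hb)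
      ((AddCircle.coe_zero _).trans h)
    exact hb.1.ne this
  · rw [hderiv, setOf_deriv_bicriticalFun_eq_zero]
  · exact nonFlatAt_of_analyticOrderAt_deriv_eq_two hlift.1 (han 0)
      (hderiv ▸ analyticOrderAt_deriv_bicriticalFun_zero hb)
  · exact nonFlatAt_of_analyticOrderAt_deriv_eq_two hlift.1 (han b)
      (hderiv ▸ analyticOrderAt_deriv_bicriticalFun_self hb)

/-- **The `C^∞` Realization Lemma.** For any irrational `ρ ∈ (0,1)` and any `α ∈ (0,1)` there
exists a `C^∞` bi-critical circle map with rotation number `ρ`, unique invariant measure `μ`,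
and exactly two (non-flat) critical points `c₁, c₂` such that the two connected components of
`S¹ ∖ {c₁, c₂}` have `μ`-measures `α` and `1-α` respectively. -/
theorem realizationLemma (ρ α : ℝ) (hρ : ρ ∈ Ioo (0 : ℝ) 1) (hirr : Irrational ρ)
    (hα : α ∈ Ioo (0 : ℝ) 1) :
    ∃ (g : S1 → S1) (c₁ c₂ : S1) (μ : Measure S1),
      Bicritical g c₁ c₂ ⊤ ∧ HasRotNum g ρ ∧
      IsProbabilityMeasure μ ∧ μ.map g = μ ∧
      (μ (posArc c₁ c₂)).toReal = α ∧ (μ (posArc c₂ c₁)).toReal = 1 - α := by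
  obtain ⟨a, b, hb, hrot, hpos⟩ := CircleDeg1Lift.exists_atOrbitPosition
    (ψ := bicriticalLift) continuous_bicriticalFun bijective_bicriticalLift hirr hα
  set F := CircleDeg1Lift.addLeft a (bicriticalLift b) with hF
  obtain ⟨k, hk⟩ := CircleDeg1Lift.exists_map_add_eq
    (CircleDeg1Lift.bijective_addLeft (bijective_bicriticalLift b) a) hrot
  obtain ⟨s, h₁, h₂⟩ := CircleDeg1Lift.exists_mapsTo_of_atOrbitPosition hirr hrot hk hpos
  refine ⟨F.toCircleMap, 0, (b : S1), k.circleMeasure,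
    bicritical_toCircleMap_addLeft_bicriticalLift a hb,
    ⟨F, isLift_toCircleMap_addLeft_bicriticalLift a b, ?_⟩, inferInstance,
    CircleDeg1Lift.map_circleMeasure hk, circleMeasure_posArc hb hα h₁ h₂⟩
  have := F.tendsto_translation_number₀
  rw [hrot] at this
  simpa only [CircleDeg1Lift.coe_pow] using this
end
end
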